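/- arXiv:2505.07803 — 6 statements merged into one kernel-verified Lean document; each statement's English description precedes it below -/
import Mathlib

section
/- Let λ, θ, θ' be arithmetic functions with λ(1) = 1 and θ(d) + θ'(d) = μ(d) for all d ≥ 1, and define h(d) = Σ_{lcm(d₁,d₂) = d} λ(d₁) θ'(d₂). Then for any V > 1 one has the identity of arithmetic functions Λ = h * log − 1 * h * Λ_{≤V} + ((1*θ)·(1*λ)) * Λ_{>V} + Λ_{≤V}, i.e. for every n ≥ 1, Λ(n) = Σ_{dm = n} h(d) log m − Σ_{abc = n} (1*h)(ab-grouping as stated: (1 * h * Λ_{≤V})(n)) + Σ_{dm = n} (1*θ)(d)(1*λ)(d) Λ_{>V}(m) + Λ_{≤V}(n). -/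
open Finset

/-- If `h(d) = ∑_{lcm(a,b)=d} f(a) g(b)`, then `1 * h = (1 * f) · (1 * g)`. -/
theorem sum_divisors_sum_lcm_eq {R : Type*} [CommSemiring R] (f g : ℕ → R) {n : ℕ}
    (hn : n ≠ 0) :
    ∑ e ∈ n.divisors,
        ∑ p ∈ (e.divisors ×ˢ e.divisors).filter (fun p => Nat.lcm p.1 p.2 = e), f p.1 * g p.2 =
      (∑ e ∈ n.divisors, f e) * ∑ e ∈ n.divisors, g e := by
  rw [sum_mul_sum, ← sum_product',
    ← sum_fiberwise_of_maps_to (s := n.divisors ×ˢ n.divisors) (t := n.divisors)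
      (g := fun p => Nat.lcm p.1 p.2)]
  · refine sum_congr rfl fun e he => sum_congr ?_ fun _ _ => rfl
    have hen := Nat.dvd_of_mem_divisors he
    have he0 : e ≠ 0 := ne_zero_of_dvd_ne_zero hn hen
    ext ⟨a, b⟩
    simp only [mem_filter, mem_product, Nat.mem_divisors]
    constructor
    · rintro ⟨⟨⟨ha, -⟩, hb, -⟩, hab⟩
      exact ⟨⟨⟨ha.trans hen, hn⟩, hb.trans hen, hn⟩, hab⟩
    · rintro ⟨-, hab⟩
      exact ⟨⟨⟨hab ▸ Nat.dvd_lcm_left a b, he0⟩, hab ▸ Nat.dvd_lcm_right a b, he0⟩, hab⟩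
  · rintro ⟨a, b⟩ hab
    simp only [mem_product, Nat.mem_divisors] at hab ⊢
    exact ⟨Nat.lcm_dvd hab.1.1 hab.2.1, hn⟩

/-- The identity `h * log = (1 * h) * Λ`. -/
theorem sum_mul_log_eq_sum_mul_vonMangoldt (h : ℕ → ℝ) (h0 : h 0 = 0) (n : ℕ) :
    ∑ p ∈ n.divisorsAntidiagonal, h p.1 * Real.log p.2 =
      ∑ p ∈ n.divisorsAntidiagonal,
        (∑ e ∈ p.1.divisors, h e) * ArithmeticFunction.vonMangoldt p.2 := by
  let F : ArithmeticFunction ℝ := ⟨h, h0⟩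
  have key : F * ArithmeticFunction.log =
      F * (ArithmeticFunction.zeta : ArithmeticFunction ℝ) * ArithmeticFunction.vonMangoldt := by
    rw [mul_assoc, ArithmeticFunction.zeta_mul_vonMangoldt]
  have key_apply := congrArg (fun G : ArithmeticFunction ℝ => G n) key
  simp only [ArithmeticFunction.mul_apply (n := n), ArithmeticFunction.coe_mul_zeta_apply,
    ArithmeticFunction.log_apply] at key_apply
  exact key_apply

/-- Möbius inversion of the unit: `1 * μ` is the indicator of `1`. -/
theorem sum_divisors_moebius_eq_ite (n : ℕ) :
    ∑ e ∈ n.divisors, ((ArithmeticFunction.moebius e : ℤ) : ℝ) = if n = 1 then 1 else 0 := by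
  rw [← ArithmeticFunction.one_apply, ← ArithmeticFunction.coe_moebius_mul_coe_zeta,
    ArithmeticFunction.coe_mul_zeta_apply]
  rfl

/-- The sieve-weighted Vaughan identity for `Λ` (Lemma 2.1, identity `V_Λ^*`):
for any weights `lam`, `θ`, `θ'` with `lam 1 = 1` and `θ + θ' = μ`, and
`h(d) = ∑_{lcm(d₁,d₂)=d} lam(d₁) θ'(d₂)`, one has
`Λ = h * log − 1 * h * Λ_{≤V} + ((1*θ)·(1*lam)) * Λ_{>V} + Λ_{≤V}`. -/
theorem statement3 (lam θ θ' : ℕ → ℝ) (hlam : lam 1 = 1)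
    (hθ : ∀ d : ℕ, 1 ≤ d → θ d + θ' d = ((ArithmeticFunction.moebius d : ℤ) : ℝ))
    (h : ℕ → ℝ)
    (hh : ∀ d : ℕ, h d =
      ∑ p ∈ (d.divisors ×ˢ d.divisors).filter (fun p => Nat.lcm p.1 p.2 = d),
        lam p.1 * θ' p.2)
    (V : ℝ) (hV : 1 < V) (n : ℕ) (hn : 1 ≤ n) :
    (ArithmeticFunction.vonMangoldt n : ℝ) =
      (∑ p ∈ n.divisorsAntidiagonal, h p.1 * Real.log p.2)
      - (∑ p ∈ n.divisorsAntidiagonal, (∑ e ∈ p.1.divisors, h e) *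
          (if (p.2 : ℝ) ≤ V then ArithmeticFunction.vonMangoldt p.2 else 0))
      + (∑ p ∈ n.divisorsAntidiagonal,
          ((∑ e ∈ p.1.divisors, θ e) * (∑ e ∈ p.1.divisors, lam e)) *
          (if V < (p.2 : ℝ) then ArithmeticFunction.vonMangoldt p.2 else 0))
      + (if (n : ℝ) ≤ V then ArithmeticFunction.vonMangoldt n else 0) := by
  have h0 : h 0 = 0 := by simp [hh]
  have hsum : ∀ d, d ≠ 0 → ∑ e ∈ d.divisors, h e =
      (∑ e ∈ d.divisors, lam e) * ∑ e ∈ d.divisors, θ' e := fun d hd => by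
    rw [← sum_divisors_sum_lcm_eq lam θ' hd]
    exact sum_congr rfl fun e _ => hh e
  have hadd : ∀ d, (∑ e ∈ d.divisors, θ e) + ∑ e ∈ d.divisors, θ' e =
      if d = 1 then 1 else 0 := fun d => by
    rw [← sum_divisors_moebius_eq_ite, ← sum_add_distrib]
    exact sum_congr rfl fun e he => hθ e (Nat.pos_of_mem_divisors he)
  have hmain : ∑ p ∈ n.divisorsAntidiagonal, (if p.1 = 1 then
      (if V < (p.2 : ℝ) then ArithmeticFunction.vonMangoldt p.2 else 0) else 0) =
      if V < (n : ℝ) then ArithmeticFunction.vonMangoldt n else 0 := by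
    rw [sum_eq_single (1, n)]
    · simp
    · rintro ⟨a, b⟩ hab hne
      refine if_neg fun ha => hne ?_
      have hprod := (Nat.mem_divisorsAntidiagonal.mp hab).1
      simp only at ha hprod
      rw [ha, one_mul] at hprod
      rw [ha, hprod]
    · intro hnot
      exact absurd (Nat.mem_divisorsAntidiagonal.mpr ⟨one_mul n, by lia⟩) hnot
  rw [sum_mul_log_eq_sum_mul_vonMangoldt h h0, ← sum_sub_distrib, ← sum_add_distrib]
  trans (if V < (n : ℝ) then ArithmeticFunction.vonMangoldt n else 0) +
    (if (n : ℝ) ≤ V then ArithmeticFunction.vonMangoldt n else 0)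
  · rcases lt_or_ge V (n : ℝ) with hlt | hle
    · simp [hlt, hlt.not_ge]
    · simp [hle, hle.not_gt]
  congr 1
  rw [← hmain]
  refine sum_congr rfl fun p hp => ?_
  have hp0 : p.1 ≠ 0 := fun hp1 => by
    have := Nat.mem_divisorsAntidiagonal.mp hp
    simp [hp1] at this
    lia
  rw [hsum p.1 hp0]
  have hp1 := hadd p.1
  have hone : p.1 = 1 → ∑ e ∈ p.1.divisors, lam e = 1 := fun hp1 => by simp [hp1, hlam]
  rcases lt_or_ge V (p.2 : ℝ) with hlt | hle
  · simp only [hlt, hlt.not_ge, if_true, if_false]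
    split_ifs at hp1 ⊢ with h1
    · rw [hone h1]
      linear_combination (-ArithmeticFunction.vonMangoldt p.2) * hp1
    · linear_combination
        (-(∑ e ∈ p.1.divisors, lam e) * ArithmeticFunction.vonMangoldt p.2) * hp1
  · simp [hle, hle.not_gt]
end

section
/- Let λ, θ, θ' be arithmetic functions with λ(1) = 1 and θ(d) + θ'(d) = μ(d) for all d ≥ 1, and define h(d) = Σ_{lcm(d₁,d₂) = d} λ(d₁) θ'(d₂). Then for any V > 1 one has the identity of arithmetic functions μ = h − 1 * h * μ_{≤V} + ((1*θ)·(1*λ)) * μ_{>V} + μ_{≤V}, i.e. for every n ≥ 1, μ(n) = h(n) − (1 * h * μ_{≤V})(n) + Σ_{dm = n} (1*θ)(d)(1*λ)(d) μ_{>V}(m) + μ_{≤V}(n). -/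
open Finset

/-- The divisor sum of an lcm-convolution is the product of the divisor sums. -/
theorem sum_divisors_lcm_convolution {R : Type*} [CommSemiring R] (f g : ℕ → R) (n : ℕ) :
    ∑ e ∈ n.divisors, ∑ p ∈ (e.divisors ×ˢ e.divisors).filter (fun p => Nat.lcm p.1 p.2 = e),
      f p.1 * g p.2 = (∑ e ∈ n.divisors, f e) * ∑ e ∈ n.divisors, g e := by
  rw [sum_mul_sum, ← sum_product',
    ← sum_fiberwise_of_maps_to (t := n.divisors) (g := fun p : ℕ × ℕ => Nat.lcm p.1 p.2)]
  · refine sum_congr rfl fun e he => sum_congr ?_ fun _ _ => rfl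
    obtain ⟨hen, hn⟩ := Nat.mem_divisors.mp he
    have he0 : e ≠ 0 := ne_zero_of_dvd_ne_zero hn hen
    ext ⟨a, b⟩
    simp only [mem_filter, mem_product, Nat.mem_divisors]
    constructor
    · rintro ⟨⟨⟨ha, -⟩, hb, -⟩, hl⟩
      exact ⟨⟨⟨ha.trans hen, hn⟩, hb.trans hen, hn⟩, hl⟩
    · rintro ⟨-, rfl⟩
      exact ⟨⟨⟨Nat.dvd_lcm_left a b, he0⟩, Nat.dvd_lcm_right a b, he0⟩, rfl⟩
  · rintro ⟨a, b⟩ hp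
    simp only [mem_product, Nat.mem_divisors] at hp ⊢
    exact ⟨Nat.lcm_dvd hp.1.1 hp.2.1, hp.1.2⟩

/-- The divisor sum of the Möbius function is the indicator of `1`. -/
theorem sum_divisors_moebius_cast {R : Type*} [Ring R] (n : ℕ) :
    ∑ e ∈ n.divisors, ((ArithmeticFunction.moebius e : ℤ) : R) = if n = 1 then 1 else 0 := by
  rw [← Int.cast_sum, ← ArithmeticFunction.coe_zeta_mul_apply,
    ArithmeticFunction.coe_zeta_mul_moebius, ArithmeticFunction.one_apply]
  split_ifs <;> simp

/-- Convolving the indicator of `1` with `f` gives `f`. -/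
theorem sum_divisorsAntidiagonal_indicator_one_mul {R : Type*} [Semiring R] (f : ℕ → R) {n : ℕ}
    (hn : n ≠ 0) :
    ∑ p ∈ n.divisorsAntidiagonal, (if p.1 = 1 then 1 else 0) * f p.2 = f n := by
  rw [sum_eq_single (1, n)]
  · simp
  · rintro ⟨a, b⟩ hp hne
    have hab := (Nat.mem_divisorsAntidiagonal.mp hp).1
    have ha : a ≠ 1 := by
      rintro rfl
      exact hne (by simpa using hab)
    simp [ha]
  · simp [hn]

/-- The sieve-weighted Vaughan identity for `μ` (Lemma 2.1, identity `V_μ^*`):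
for any weights `lam`, `θ`, `θ'` with `lam 1 = 1` and `θ + θ' = μ`, and
`h(d) = ∑_{lcm(d₁,d₂)=d} lam(d₁) θ'(d₂)`, one has
`μ = h − 1 * h * μ_{≤V} + ((1*θ)·(1*lam)) * μ_{>V} + μ_{≤V}`. -/
theorem statement4 (lam θ θ' : ℕ → ℝ) (hlam : lam 1 = 1)
    (hθ : ∀ d : ℕ, 1 ≤ d → θ d + θ' d = ((ArithmeticFunction.moebius d : ℤ) : ℝ))
    (h : ℕ → ℝ)
    (hh : ∀ d : ℕ, h d =
      ∑ p ∈ (d.divisors ×ˢ d.divisors).filter (fun p => Nat.lcm p.1 p.2 = d),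
        lam p.1 * θ' p.2)
    (V : ℝ) (hV : 1 < V) (n : ℕ) (hn : 1 ≤ n) :
    ((ArithmeticFunction.moebius n : ℤ) : ℝ) =
      h n
      - (∑ p ∈ n.divisorsAntidiagonal, (∑ e ∈ p.1.divisors, h e) *
          (if (p.2 : ℝ) ≤ V then ((ArithmeticFunction.moebius p.2 : ℤ) : ℝ) else 0))
      + (∑ p ∈ n.divisorsAntidiagonal,
          ((∑ e ∈ p.1.divisors, θ e) * (∑ e ∈ p.1.divisors, lam e)) *
          (if V < (p.2 : ℝ) then ((ArithmeticFunction.moebius p.2 : ℤ) : ℝ) else 0))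
      + (if (n : ℝ) ≤ V then ((ArithmeticFunction.moebius n : ℤ) : ℝ) else 0) := by
  have hn0 : n ≠ 0 := Nat.one_le_iff_ne_zero.mp hn
  have hdivisors : ∀ d : ℕ, (∑ e ∈ d.divisors, θ e) * (∑ e ∈ d.divisors, lam e) =
      (if d = 1 then 1 else 0) - ∑ e ∈ d.divisors, h e := by
    intro d
    have hsum : (∑ e ∈ d.divisors, θ e) + ∑ e ∈ d.divisors, θ' e = if d = 1 then 1 else 0 := by
      rw [← sum_add_distrib, ← sum_divisors_moebius_cast]
      exact sum_congr rfl fun e he => hθ e (Nat.pos_of_mem_divisors he)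
    rw [sum_congr rfl fun e _ => hh e, sum_divisors_lcm_convolution, eq_sub_of_add_eq hsum]
    split_ifs with hd
    · subst hd
      simp [hlam]
    · ring
  have hinv : ∑ p ∈ n.divisorsAntidiagonal,
      (∑ e ∈ p.1.divisors, h e) * ((ArithmeticFunction.moebius p.2 : ℤ) : ℝ) = h n := by
    rw [← (ArithmeticFunction.sum_eq_iff_sum_mul_moebius_eq (f := h)
      (g := fun d => ∑ e ∈ d.divisors, h e)).mp (fun _ _ => rfl) n hn]
    conv_lhs => rw [← Nat.map_swap_divisorsAntidiagonal, sum_map]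
    exact sum_congr rfl fun p _ => mul_comm _ _
  simp only [hdivisors, sub_mul, sum_sub_distrib]
  rw [sum_divisorsAntidiagonal_indicator_one_mul
    (fun m => if V < (m : ℝ) then ((ArithmeticFunction.moebius m : ℤ) : ℝ) else 0) hn0]
  have hsplit : ∀ m : ℕ, ((ArithmeticFunction.moebius m : ℤ) : ℝ) =
      (if (m : ℝ) ≤ V then ((ArithmeticFunction.moebius m : ℤ) : ℝ) else 0) +
        if V < (m : ℝ) then ((ArithmeticFunction.moebius m : ℤ) : ℝ) else 0 := by
    intro m
    by_cases hm : (m : ℝ) ≤ V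
    · simp [hm, hm.not_gt]
    · simp [hm, not_le.mp hm]
  rw [sum_congr rfl fun p _ => congrArg _ (hsplit p.2)] at hinv
  simp only [mul_add, sum_add_distrib] at hinv
  linarith [hsplit n]
end

section
/- Let q ≥ 1, R > 1, and let λ be the Selberg sieve weights λ(d) = (d μ(d)/φ(d)) · G_{qd}(R/d)/G_q(R) for d ≤ R with gcd(d,q) = 1, and λ(d) = 0 otherwise. Then for all n ≥ 1: G_q(R) · Σ_{d | n} λ(d) = Σ_{r ≤ R, gcd(r,q)=1} μ(r) c_r(n) / φ(r), where c_r(n) = Σ_{a mod r, gcd(a,r)=1} e(an/r) is the Ramanujan sum. -/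
open Finset

/-- `e(t) = e^{2πit}`. -/
noncomputable def eF (t : ℝ) : ℂ := Complex.exp (2 * (Real.pi : ℂ) * Complex.I * (t : ℂ))

/-- `G_ℓ(y) = ∑_{r ≤ y, (r,ℓ)=1} μ(r)²/φ(r)`. -/
noncomputable def Gsum (ℓ : ℕ) (y : ℝ) : ℝ :=
  ∑ r ∈ Finset.Icc 1 ⌊y⌋₊,
    if Nat.gcd r ℓ = 1 then ((ArithmeticFunction.moebius r : ℤ) : ℝ) ^ 2 / (Nat.totient r : ℝ)
    else 0

/-- The Selberg sieve weights `λ(d)`, supported on `d ≤ R`, `(d,q) = 1`. -/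
noncomputable def selbergLambda (q : ℕ) (R : ℝ) (d : ℕ) : ℝ :=
  if (d : ℝ) ≤ R ∧ Nat.gcd d q = 1 then
    (d : ℝ) * ((ArithmeticFunction.moebius d : ℤ) : ℝ) / (Nat.totient d : ℝ) *
      (Gsum (q * d) (R / d) / Gsum q R)
  else 0

/-- The Barban–Vehov type weights `θ'(d)`. -/
noncomputable def bvTheta' (U U₁ : ℝ) (d : ℕ) : ℝ :=
  if (d : ℝ) ≤ U then ((ArithmeticFunction.moebius d : ℤ) : ℝ)
  else if (d : ℝ) ≤ U₁ then
    ((ArithmeticFunction.moebius d : ℤ) : ℝ) * Real.log (U₁ / d) / Real.log (U₁ / U)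
  else 0

/-- The complementary weights `θ(d) = μ(d) − θ'(d)`. -/
noncomputable def bvTheta (U U₁ : ℝ) (d : ℕ) : ℝ :=
  ((ArithmeticFunction.moebius d : ℤ) : ℝ) - bvTheta' U U₁ d

/-- `h(d) = ∑_{lcm(d₁,d₂) = d} λ(d₁) θ'(d₂)`. -/
noncomputable def hFun (q : ℕ) (R U U₁ : ℝ) (d : ℕ) : ℝ :=
  ∑ p ∈ (d.divisors ×ˢ d.divisors).filter (fun p => Nat.lcm p.1 p.2 = d),
    selbergLambda q R p.1 * bvTheta' U U₁ p.2

/-- The Ramanujan sum `c_r(n) = ∑_{a mod r, (a,r)=1} e(an/r)`. -/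
noncomputable def ramanujanC (r n : ℕ) : ℂ :=
  ∑ a ∈ (Finset.range r).filter (fun a => Nat.gcd a r = 1), eF ((a : ℝ) * n / r)

/-- Summing over the multiples of `d` up to `N`. -/
theorem sum_Icc_ite_dvd {M : Type*} [AddCommMonoid M] (f : ℕ → M) (N : ℕ) {d : ℕ} (hd : 0 < d) :
    ∑ r ∈ Icc 1 N, (if d ∣ r then f r else 0) = ∑ m ∈ Icc 1 (N / d), f (d * m) := by
  rw [← sum_filter]
  refine sum_nbij' (fun r => r / d) (fun m => d * m) ?_ ?_ ?_ ?_ ?_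
  · intro r hr
    simp only [mem_filter, mem_Icc] at hr ⊢
    exact ⟨Nat.div_pos (Nat.le_of_dvd hr.1.1 hr.2) hd, Nat.div_le_div_right hr.1.2⟩
  · intro m hm
    simp only [mem_filter, mem_Icc] at hm ⊢
    refine ⟨⟨Nat.mul_pos hd hm.1, ?_⟩, dvd_mul_right _ _⟩
    rw [mul_comm]
    exact (Nat.le_div_iff_mul_le hd).1 hm.2
  · intro r hr
    exact Nat.mul_div_cancel' (mem_filter.1 hr).2
  · intro m _
    exact Nat.mul_div_cancel_left m hd
  · intro r hr
    rw [Nat.mul_div_cancel' (mem_filter.1 hr).2]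

/-- Summing over the multiples of `d` below `d * k`. -/
theorem sum_range_mul_ite_dvd {M : Type*} [AddCommMonoid M] (f : ℕ → M) {d : ℕ} (hd : 0 < d)
    (k : ℕ) :
    ∑ a ∈ range (d * k), (if d ∣ a then f a else 0) = ∑ b ∈ range k, f (d * b) := by
  rw [← sum_filter]
  refine sum_nbij' (fun r => r / d) (fun m => d * m) ?_ ?_ ?_ ?_ ?_
  · intro r hr
    simp only [mem_filter, mem_range] at hr ⊢
    exact Nat.div_lt_of_lt_mul hr.1
  · intro m hm
    simp only [mem_filter, mem_range] at hm ⊢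
    exact ⟨Nat.mul_lt_mul_of_pos_left hm hd, dvd_mul_right _ _⟩
  · intro r hr
    exact Nat.mul_div_cancel' (mem_filter.1 hr).2
  · intro m _
    exact Nat.mul_div_cancel_left m hd
  · intro r hr
    rw [Nat.mul_div_cancel' (mem_filter.1 hr).2]

/-- Orthogonality of the additive characters modulo `k`. -/
theorem sum_range_eF (k n : ℕ) (hk : 0 < k) :
    ∑ b ∈ range k, eF ((b : ℝ) * n / k) = if k ∣ n then (k : ℂ) else 0 := by
  have hζ := Complex.isPrimitiveRoot_exp k hk.ne'
  set ζ := Complex.exp (2 * Real.pi * Complex.I / k) with hζ_def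
  have hpow : ∀ b : ℕ, eF ((b : ℝ) * n / k) = (ζ ^ n) ^ b := by
    intro b
    rw [← pow_mul, hζ_def, ← Complex.exp_nat_mul, eF]
    congr 1
    push_cast
    ring
  simp only [hpow]
  split_ifs with h
  · simp [(hζ.pow_eq_one_iff_dvd n).2 h]
  · have hne : ζ ^ n ≠ 1 := fun h1 => h ((hζ.pow_eq_one_iff_dvd n).1 h1)
    rw [geom_sum_eq hne, ← pow_mul, mul_comm, pow_mul, hζ.pow_eq_one]
    simp

/-- The indicator of coprimality as a divisor sum of the Möbius function. -/
theorem sum_divisors_moebius_ite_dvd (a : ℕ) {r : ℕ} (hr : 0 < r) :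
    ∑ d ∈ r.divisors, (if d ∣ a then ((ArithmeticFunction.moebius d : ℤ) : ℂ) else 0) =
      if Nat.gcd a r = 1 then 1 else 0 := by
  have hset : r.divisors.filter (fun d => d ∣ a) = (Nat.gcd a r).divisors := by
    ext d
    have := Nat.gcd_pos_of_pos_right a hr
    simp only [mem_filter, Nat.mem_divisors, Nat.dvd_gcd_iff]
    grind
  rw [← sum_filter, hset]
  have h := DFunLike.congr_fun ArithmeticFunction.moebius_mul_coe_zeta (Nat.gcd a r)
  rw [ArithmeticFunction.coe_mul_zeta_apply, ArithmeticFunction.one_apply] at h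
  exact_mod_cast h

/-- The divisor-sum formula for Ramanujan sums. -/
theorem ramanujanC_eq_sum_divisors {r : ℕ} (n : ℕ) (hr : 0 < r) :
    ramanujanC r n = ∑ d ∈ r.divisors,
      if d ∣ n then (d : ℂ) * ((ArithmeticFunction.moebius (r / d) : ℤ) : ℂ) else 0 := by
  calc ramanujanC r n
      = ∑ a ∈ range r, ∑ d ∈ r.divisors,
          (if d ∣ a then ((ArithmeticFunction.moebius d : ℤ) : ℂ) * eF ((a : ℝ) * n / r)
            else 0) := by
        rw [ramanujanC, sum_filter]
        refine sum_congr rfl fun a _ => ?_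
        have h := congrArg (· * eF ((a : ℝ) * n / r)) (sum_divisors_moebius_ite_dvd a hr)
        simpa only [sum_mul, ite_mul, zero_mul, one_mul] using h.symm
    _ = ∑ d ∈ r.divisors, (if r / d ∣ n then
          ((r / d : ℕ) : ℂ) * ((ArithmeticFunction.moebius d : ℤ) : ℂ) else 0) := by
        rw [sum_comm]
        refine sum_congr rfl fun d hd => ?_
        obtain ⟨k, rfl⟩ := Nat.dvd_of_mem_divisors hd
        have hd0 : 0 < d := Nat.pos_of_mul_pos_right hr
        have hk0 : 0 < k := Nat.pos_of_mul_pos_left hr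
        rw [sum_range_mul_ite_dvd _ hd0, ← mul_sum, Nat.mul_div_cancel_left k hd0]
        have hterm : ∀ b : ℕ, eF (((d * b : ℕ) : ℝ) * n / ((d * k : ℕ) : ℝ)) =
            eF ((b : ℝ) * n / k) := by
          intro b
          congr 1
          have : (d : ℝ) ≠ 0 := by exact_mod_cast hd0.ne'
          push_cast
          rw [mul_assoc, mul_div_mul_left _ _ this]
        simp only [hterm, sum_range_eF k n hk0]
        split_ifs <;> ring
    _ = _ := by
        rw [← Nat.sum_div_divisors]
        refine sum_congr rfl fun d hd => ?_
        rw [Nat.div_div_self (Nat.dvd_of_mem_divisors hd) hr.ne']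

/-- The normalising sum of the Selberg weights does not vanish. -/
theorem Gsum_pos (q : ℕ) {R : ℝ} (hR : 1 ≤ R) : 0 < Gsum q R := by
  refine sum_pos' (fun r _ => ?_) ⟨1, ?_, ?_⟩
  · split_ifs <;> positivity
  · simpa [Nat.one_le_floor_iff] using hR
  · simp

/-- The arithmetic weight at a product `d * m` factors, vanishing unless `d` and `m` are
coprime. -/
theorem moebius_mul_div_totient_factor (q d m : ℕ) :
    (if Nat.gcd (d * m) q = 1 then
      ((ArithmeticFunction.moebius (d * m) : ℤ) : ℝ) *
        ((d : ℝ) * ((ArithmeticFunction.moebius m : ℤ) : ℝ)) / (Nat.totient (d * m) : ℝ) else 0) =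
    if Nat.gcd d q = 1 then
      (d : ℝ) * ((ArithmeticFunction.moebius d : ℤ) : ℝ) / (Nat.totient d : ℝ) *
        (if Nat.gcd m (q * d) = 1 then
          ((ArithmeticFunction.moebius m : ℤ) : ℝ) ^ 2 / (Nat.totient m : ℝ) else 0)
    else 0 := by
  have hdm : Nat.gcd (d * m) q = 1 ↔ Nat.gcd d q = 1 ∧ Nat.gcd m q = 1 :=
    Nat.coprime_mul_iff_left
  have hm : Nat.gcd m (q * d) = 1 ↔ Nat.gcd m q = 1 ∧ Nat.gcd m d = 1 :=
    Nat.coprime_mul_iff_right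
  simp only [hdm, hm]
  by_cases h1 : Nat.gcd d q = 1 <;> by_cases h2 : Nat.gcd m q = 1 <;> simp only [h1, h2] <;>
    try simp
  split_ifs with h3
  · have hc : Nat.Coprime d m := Nat.Coprime.symm h3
    rw [ArithmeticFunction.isMultiplicative_moebius.map_mul_of_coprime hc, Nat.totient_mul hc]
    push_cast
    rw [div_mul_div_comm]
    ring
  · have hns : ¬ Squarefree (d * m) := fun h =>
      h3 (Nat.Coprime.symm (Nat.coprime_of_squarefree_mul h))
    simp [ArithmeticFunction.moebius_eq_zero_of_not_squarefree hns]

/-- The normalised Selberg weight as a sum over the multiples of `d` up to `R`. -/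
theorem Gsum_mul_selbergLambda (q : ℕ) {R : ℝ} (hR : 1 ≤ R) {d : ℕ} (hd : 0 < d) :
    Gsum q R * selbergLambda q R d =
      ∑ r ∈ Icc 1 ⌊R⌋₊, if d ∣ r then
        (if Nat.gcd r q = 1 then ((ArithmeticFunction.moebius r : ℤ) : ℝ) *
          ((d : ℝ) * ((ArithmeticFunction.moebius (r / d) : ℤ) : ℝ)) / (Nat.totient r : ℝ) else 0)
        else 0 := by
  rw [sum_Icc_ite_dvd _ _ hd]
  simp only [Nat.mul_div_cancel_left _ hd, moebius_mul_div_totient_factor]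
  rw [selbergLambda]
  have hG := (Gsum_pos q hR).ne'
  by_cases h1 : Nat.gcd d q = 1
  · by_cases h2 : (d : ℝ) ≤ R
    · simp only [h1, h2, and_self, if_true]
      rw [← mul_sum, ← Nat.floor_div_natCast, ← Gsum]
      field_simp
    · have hlt : ⌊R⌋₊ < d := (Nat.floor_lt (by linarith)).2 (not_le.1 h2)
      simp [h2, Nat.div_eq_of_lt hlt]
  · simp [h1]

/-- Lemma 5.1: `G_q(R) ∑_{d | n} λ(d) = ∑_{r ≤ R, (r,q)=1} μ(r) c_r(n)/φ(r)`. -/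
theorem statement12 (q : ℕ) (hq : 1 ≤ q) (R : ℝ) (hR : 1 < R) (n : ℕ) (hn : 1 ≤ n) :
    ((Gsum q R * ∑ d ∈ n.divisors, selbergLambda q R d : ℝ) : ℂ) =
      ∑ r ∈ (Finset.Icc 1 ⌊R⌋₊).filter (fun r => Nat.gcd r q = 1),
        ((ArithmeticFunction.moebius r : ℤ) : ℂ) * ramanujanC r n / (Nat.totient r : ℂ) := by
  rw [mul_sum, Complex.ofReal_sum, sum_filter]
  have hL : ∀ d ∈ n.divisors, ((Gsum q R * selbergLambda q R d : ℝ) : ℂ) = _ := fun d hd =>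
    congrArg Complex.ofReal (Gsum_mul_selbergLambda q hR.le (Nat.pos_of_mem_divisors hd))
  rw [sum_congr rfl hL]
  push_cast
  rw [sum_comm]
  refine sum_congr rfl fun r hr => ?_
  have hr0 : 0 < r := (mem_Icc.1 hr).1
  split_ifs with h
  · have hswap : n.divisors.filter (fun d => d ∣ r) = r.divisors.filter (fun d => d ∣ n) := by
      ext d
      simp only [mem_filter, Nat.mem_divisors]
      grind
    rw [ramanujanC_eq_sum_divisors n hr0, ← sum_filter, ← Complex.ofReal_sum, ← sum_filter, hswap,
      mul_sum, sum_div]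
    push_cast
    rfl
  · simp
end

section
/- Let q ≥ 1, M ≥ 2 and 3 ≤ L ≤ M/q, and set B = (q/φ(q)) · 2L/log L. Then the set of primes in the interval (M, 2M] can be partitioned into at most ⌈B⌉ subsets 𝓜₁, …, 𝓜_{⌈B⌉} such that for every j, whenever p and p' are distinct primes in 𝓜_j with p ≡ p' (mod q), one has |p − p'| ≥ Lq. -/
open Finset

theorem sum_moebius_divisors_of_dvd {m k : ℕ} (hk : Squarefree k) (hmk : m ∣ k) :
    ∑ d ∈ k.divisors with m ∣ d, ArithmeticFunction.moebius d =
      if m = k then ArithmeticFunction.moebius m else 0 := by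
  obtain ⟨n, rfl⟩ := hmk
  have hm0 : m ≠ 0 := by rintro rfl; simp at hk
  have hn0 : n ≠ 0 := by rintro rfl; simp at hk
  have hset : ({d ∈ (m * n).divisors | m ∣ d} : Finset ℕ) =
      n.divisors.image (fun e => m * e) := by
    ext d
    simp only [mem_filter, Nat.mem_divisors, mem_image]
    constructor
    · rintro ⟨⟨h1, -⟩, e, rfl⟩
      exact ⟨e, ⟨Nat.dvd_of_mul_dvd_mul_left (Nat.pos_of_ne_zero hm0) h1, hn0⟩, rfl⟩
    · rintro ⟨e, ⟨h1, -⟩, rfl⟩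
      exact ⟨⟨Nat.mul_dvd_mul_left m h1, mul_ne_zero hm0 hn0⟩, dvd_mul_right m e⟩
  rw [hset, sum_image (fun a _ b _ h => Nat.eq_of_mul_eq_mul_left (Nat.pos_of_ne_zero hm0) h)]
  have hcop : Nat.Coprime m n := Nat.coprime_of_squarefree_mul hk
  have hmul : ∀ e ∈ n.divisors, ArithmeticFunction.moebius (m * e) =
      ArithmeticFunction.moebius m * ArithmeticFunction.moebius e := fun e he =>
    ArithmeticFunction.isMultiplicative_moebius.map_mul_of_coprime
      (hcop.coprime_dvd_right (Nat.dvd_of_mem_divisors he))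
  rw [sum_congr rfl hmul, ← mul_sum, ← ArithmeticFunction.coe_mul_zeta_apply,
    ArithmeticFunction.moebius_mul_coe_zeta, ArithmeticFunction.one_apply]
  have : m = m * n ↔ n = 1 := by
    constructor
    · intro h
      exact Nat.eq_of_mul_eq_mul_left (Nat.pos_of_ne_zero hm0) (by omega)
    · rintro rfl; simp
  simp only [this]
  split_ifs <;> simp

theorem abs_card_range_filter_dvd_sub_div_le (X r : ℕ) (hr : 0 < r) (c : ℤ) :
    |((#((range X).filter fun j : ℕ => (r : ℤ) ∣ (j : ℤ) - c) : ℕ) : ℝ) - X / r| ≤ 1 := by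
  have hcard : #((range X).filter fun j : ℕ => (r : ℤ) ∣ (j : ℤ) - c) =
      #{x ∈ Ico (0 : ℤ) X | x ≡ c [ZMOD r]} := by
    refine card_bij (fun j _ => (j : ℤ)) ?_ ?_ ?_
    · intro j hj
      simp only [mem_filter, mem_range, mem_Ico] at hj ⊢
      exact ⟨⟨by positivity, by exact_mod_cast hj.1⟩, (Int.modEq_iff_dvd.mpr hj.2).symm⟩
    · intro a _ b _ h
      exact_mod_cast h
    · intro x hx
      simp only [mem_filter, mem_Ico] at hx
      refine ⟨x.toNat, ?_, Int.toNat_of_nonneg hx.1.1⟩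
      simp only [mem_filter, mem_range, Int.toNat_of_nonneg hx.1.1]
      exact ⟨by omega, Int.modEq_iff_dvd.mp hx.2.symm⟩
  have hr' : (0 : ℝ) < r := by exact_mod_cast hr
  have h := Int.Ico_filter_modEq_card 0 X (r := (r : ℤ)) (by exact_mod_cast hr) c
  rw [hcard]
  set n := #{x ∈ Ico (0 : ℤ) X | x ≡ c [ZMOD r]}
  set u : ℚ := ((X : ℤ) - c : ℚ) / (r : ℤ) with hu
  set v : ℚ := ((0 : ℤ) - c : ℚ) / (r : ℤ) with hv
  have huv : u - v = X / r := by
    rw [hu, hv]; push_cast; ring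
  have hle : v ≤ u := by
    have : (0 : ℚ) ≤ X / r := by positivity
    linarith
  have hn : ((n : ℤ) : ℚ) = ⌈u⌉ - ⌈v⌉ := by
    rw [h, max_eq_left (by have := Int.ceil_le_ceil hle; omega)]
    push_cast; rfl
  have key : |(n : ℚ) - X / r| ≤ 1 := by
    rw [Int.cast_natCast] at hn
    have h1 := Int.le_ceil u
    have h2 := Int.ceil_lt_add_one u
    have h3 := Int.le_ceil v
    have h4 := Int.ceil_lt_add_one v
    rw [abs_le]; constructor <;> linarith
  have key' : ((|(n : ℚ) - X / r| : ℚ) : ℝ) ≤ 1 := by exact_mod_cast key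
  push_cast at key'
  exact key'

/-- The optimal weights of Selberg's sieve with moduli in `D`. -/
noncomputable def selbergWeight (D : Finset ℕ) (d : ℕ) : ℝ :=
  ArithmeticFunction.moebius d * d / (∑ k ∈ D, 1 / (Nat.totient k : ℝ)) *
    ∑ k ∈ D with d ∣ k, 1 / (Nat.totient k : ℝ)

section Selberg

variable {D : Finset ℕ}

theorem sum_inv_totient_pos (hsq : ∀ k ∈ D, Squarefree k) (h1 : 1 ∈ D) :
    0 < ∑ k ∈ D, 1 / (Nat.totient k : ℝ) := by
  refine sum_pos (fun k hk => ?_) ⟨1, h1⟩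
  have := Nat.totient_pos.mpr (Nat.pos_of_ne_zero (hsq k hk).ne_zero)
  positivity

theorem selbergWeight_one (hsq : ∀ k ∈ D, Squarefree k) (h1 : 1 ∈ D) :
    selbergWeight D 1 = 1 := by
  have := (sum_inv_totient_pos hsq h1).ne'
  simp only [selbergWeight, one_dvd, filter_true]
  simp only [ArithmeticFunction.moebius_apply_one, Int.cast_one, Nat.cast_one, mul_one]
  field_simp

theorem filter_dvd_eq_divisors {k : ℕ} (hk : k ∈ D) (hsq : ∀ k ∈ D, Squarefree k)
    (hdvd : ∀ k ∈ D, ∀ d, d ∣ k → d ∈ D) : ({d ∈ D | d ∣ k} : Finset ℕ) = k.divisors := by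
  ext d
  simp only [mem_filter, Nat.mem_divisors]
  exact ⟨fun h => ⟨h.2, (hsq k hk).ne_zero⟩, fun h => ⟨hdvd k hk d h.1, h.1⟩⟩

theorem sum_selbergWeight_div (hsq : ∀ k ∈ D, Squarefree k)
    (hdvd : ∀ k ∈ D, ∀ d, d ∣ k → d ∈ D) {m : ℕ} (hm : m ∈ D) :
    ∑ d ∈ D with m ∣ d, selbergWeight D d / d =
      ArithmeticFunction.moebius m / (Nat.totient m : ℝ) /
        ∑ k ∈ D, 1 / (Nat.totient k : ℝ) := by
  set S := ∑ k ∈ D, 1 / (Nat.totient k : ℝ) with hS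
  have hterm : ∀ d ∈ D, selbergWeight D d / d =
      (∑ k ∈ D, if d ∣ k then (ArithmeticFunction.moebius d : ℝ) / (Nat.totient k : ℝ) else 0)
        / S := by
    intro d hd
    have hd0 : (d : ℝ) ≠ 0 := by exact_mod_cast (hsq d hd).ne_zero
    rw [selbergWeight, ← hS, ← sum_filter, mul_sum, sum_div, sum_div]
    refine sum_congr rfl fun k _ => ?_
    field_simp
  rw [sum_congr rfl fun d hd => hterm d (mem_filter.mp hd).1, ← sum_div, sum_comm]
  congr 1
  have hin : ∀ k ∈ D, (∑ d ∈ D with m ∣ d,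
      if d ∣ k then (ArithmeticFunction.moebius d : ℝ) / (Nat.totient k : ℝ) else 0) =
      if m = k then (ArithmeticFunction.moebius m : ℝ) / (Nat.totient k : ℝ) else 0 := by
    intro k hk
    rw [← sum_filter, filter_filter]
    have : ({d ∈ D | m ∣ d ∧ d ∣ k} : Finset ℕ) = {d ∈ k.divisors | m ∣ d} := by
      rw [← filter_dvd_eq_divisors hk hsq hdvd, filter_filter]
      exact filter_congr fun d _ => and_comm
    rw [this, ← sum_div]
    by_cases hmk : m ∣ k
    · have h := sum_moebius_divisors_of_dvd (hsq k hk) hmk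
      have h' : (∑ d ∈ k.divisors with m ∣ d, (ArithmeticFunction.moebius d : ℝ)) =
          ((if m = k then ArithmeticFunction.moebius m else 0 : ℤ) : ℝ) := by
        rw [← h]; push_cast; rfl
      rw [h']
      split_ifs <;> simp
    · have hne : m ≠ k := by rintro rfl; exact hmk dvd_rfl
      rw [if_neg hne, filter_false_of_mem, sum_empty, zero_div]
      intro d hd hmd
      exact hmk (hmd.trans (Nat.dvd_of_mem_divisors hd))
  rw [sum_congr rfl hin, sum_ite_eq, if_pos hm]

theorem sum_abs_selbergWeight_le (hsq : ∀ k ∈ D, Squarefree k)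
    (hdvd : ∀ k ∈ D, ∀ d, d ∣ k → d ∈ D) (h1 : 1 ∈ D) :
    ∑ d ∈ D, |selbergWeight D d| ≤
      (∑ k ∈ D, ((∑ d ∈ k.divisors, d : ℕ) : ℝ) / (Nat.totient k : ℝ)) /
        ∑ k ∈ D, 1 / (Nat.totient k : ℝ) := by
  set S := ∑ k ∈ D, 1 / (Nat.totient k : ℝ) with hS
  have hSpos : 0 < S := sum_inv_totient_pos hsq h1
  have hterm : ∀ d ∈ D, |selbergWeight D d| ≤
      (∑ k ∈ D, if d ∣ k then (d : ℝ) / (Nat.totient k : ℝ) else 0) / S := by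
    intro d hd
    have hmu : |(ArithmeticFunction.moebius d : ℝ)| ≤ 1 := by
      exact_mod_cast ArithmeticFunction.abs_moebius_le_one (n := d)
    have hnn : 0 ≤ ∑ k ∈ D with d ∣ k, 1 / (Nat.totient k : ℝ) :=
      sum_nonneg fun _ _ => by positivity
    rw [selbergWeight, ← hS, abs_mul, abs_div, abs_mul, abs_of_pos hSpos, abs_of_nonneg hnn,
      abs_of_nonneg (Nat.cast_nonneg (α := ℝ) d), ← sum_filter]
    have : ∑ k ∈ D with d ∣ k, (d : ℝ) / (Nat.totient k : ℝ) =
        d * ∑ k ∈ D with d ∣ k, 1 / (Nat.totient k : ℝ) := by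
      rw [mul_sum]; exact sum_congr rfl fun k _ => by ring
    rw [this, div_mul_eq_mul_div]
    gcongr
    nlinarith [Nat.cast_nonneg (α := ℝ) d]
  refine (sum_le_sum hterm).trans ?_
  rw [← sum_div, sum_comm]
  gcongr with k hk
  rw [← sum_filter, filter_dvd_eq_divisors hk hsq hdvd, ← sum_div]
  push_cast
  exact le_rfl

theorem sum_sum_selbergWeight_div_lcm (hsq : ∀ k ∈ D, Squarefree k)
    (hdvd : ∀ k ∈ D, ∀ d, d ∣ k → d ∈ D) (h1 : 1 ∈ D) :
    ∑ d ∈ D, ∑ e ∈ D, selbergWeight D d * selbergWeight D e / (Nat.lcm d e : ℝ) =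
      1 / ∑ k ∈ D, 1 / (Nat.totient k : ℝ) := by
  set S := ∑ k ∈ D, 1 / (Nat.totient k : ℝ) with hS
  have hSpos : 0 < S := sum_inv_totient_pos hsq h1
  have hterm : ∀ d ∈ D, ∀ e ∈ D,
      selbergWeight D d * selbergWeight D e / (Nat.lcm d e : ℝ) =
      ∑ m ∈ D, (Nat.totient m : ℝ) * ((if m ∣ d then selbergWeight D d / d else 0) *
        (if m ∣ e then selbergWeight D e / e else 0)) := by
    intro d hd e he
    have hd0 : (d : ℝ) ≠ 0 := by exact_mod_cast (hsq d hd).ne_zero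
    have he0 : (e : ℝ) ≠ 0 := by exact_mod_cast (hsq e he).ne_zero
    have hgD : Nat.gcd d e ∈ D := hdvd d hd _ (Nat.gcd_dvd_left d e)
    have hg0 : (Nat.gcd d e : ℝ) ≠ 0 := by exact_mod_cast (hsq _ hgD).ne_zero
    have hl0 : (Nat.lcm d e : ℝ) ≠ 0 := by
      exact_mod_cast Nat.lcm_ne_zero (hsq d hd).ne_zero (hsq e he).ne_zero
    have hgl : (Nat.gcd d e : ℝ) * (Nat.lcm d e : ℝ) = d * e := by
      exact_mod_cast Nat.gcd_mul_lcm d e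
    have htot : (Nat.gcd d e : ℝ) = ∑ m ∈ D with m ∣ Nat.gcd d e, (Nat.totient m : ℝ) := by
      rw [filter_dvd_eq_divisors hgD hsq hdvd]
      exact_mod_cast (Nat.sum_totient (Nat.gcd d e)).symm
    have hl : selbergWeight D d * selbergWeight D e / (Nat.lcm d e : ℝ) =
        (Nat.gcd d e : ℝ) * (selbergWeight D d / d * (selbergWeight D e / e)) := by
      rw [div_mul_div_comm, ← hgl]
      field_simp
    rw [hl, htot, sum_mul, sum_filter]
    refine sum_congr rfl fun m _ => ?_
    by_cases h1 : m ∣ d <;> by_cases h2 : m ∣ e <;> simp [h1, h2, Nat.dvd_gcd_iff]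
  rw [sum_congr rfl fun d hd => sum_congr rfl fun e he => hterm d hd e he]
  have hswap : ∑ d ∈ D, ∑ e ∈ D, ∑ m ∈ D, (Nat.totient m : ℝ) *
      ((if m ∣ d then selbergWeight D d / d else 0) *
        (if m ∣ e then selbergWeight D e / e else 0)) =
      ∑ m ∈ D, (Nat.totient m : ℝ) * (∑ d ∈ D with m ∣ d, selbergWeight D d / d) ^ 2 := by
    rw [sum_congr rfl fun d _ => sum_comm, sum_comm]
    refine sum_congr rfl fun m _ => ?_
    rw [sum_filter, sq, sum_mul_sum, mul_sum]
    exact sum_congr rfl fun d _ => by rw [mul_sum]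
  have hfin : ∀ m ∈ D, (Nat.totient m : ℝ) *
      (∑ d ∈ D with m ∣ d, selbergWeight D d / d) ^ 2 = 1 / (Nat.totient m : ℝ) / S ^ 2 := by
    intro m hm
    have hm0 : (Nat.totient m : ℝ) ≠ 0 := by
      exact_mod_cast (Nat.totient_pos.mpr (Nat.pos_of_ne_zero (hsq m hm).ne_zero)).ne'
    have hmu : (ArithmeticFunction.moebius m : ℝ) ^ 2 = 1 := by
      exact_mod_cast ArithmeticFunction.moebius_sq_eq_one_of_squarefree (hsq m hm)
    rw [sum_selbergWeight_div hsq hdvd hm, ← hS, div_pow, div_pow, hmu]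
    field_simp
  rw [hswap, sum_congr rfl hfin, ← sum_div, ← hS]
  field_simp

/-- Selberg's upper bound sieve for an interval: if `j - c` has no divisor in `D` other than `1`
for `j ∈ A ⊆ [0, X)`, then `A` is small. -/
theorem card_le_of_selberg (hsq : ∀ k ∈ D, Squarefree k)
    (hdvd : ∀ k ∈ D, ∀ d, d ∣ k → d ∈ D) (h1 : 1 ∈ D) {X : ℕ} {A : Finset ℕ}
    (hA : A ⊆ range X) (c : ℤ) (hc : ∀ j ∈ A, ∀ d ∈ D, (d : ℤ) ∣ (j : ℤ) - c → d = 1) :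
    (#A : ℝ) ≤ X / (∑ k ∈ D, 1 / (Nat.totient k : ℝ)) +
      ((∑ k ∈ D, ((∑ d ∈ k.divisors, d : ℕ) : ℝ) / (Nat.totient k : ℝ)) /
        ∑ k ∈ D, 1 / (Nat.totient k : ℝ)) ^ 2 := by
  set w := selbergWeight D with hw
  set f : ℕ → ℝ := fun j => ∑ d ∈ D, if (d : ℤ) ∣ (j : ℤ) - c then w d else 0 with hf
  have hfA : ∀ j ∈ A, f j = 1 := by
    intro j hj
    have : ∀ d ∈ D, (if (d : ℤ) ∣ (j : ℤ) - c then w d else 0) = if d = 1 then 1 else 0 := by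
      intro d hd
      by_cases h : d = 1
      · subst h; simp [hw, selbergWeight_one hsq h1]
      · rw [if_neg h, if_neg (fun h' => h (hc j hj d hd h'))]
    rw [hf]
    simp only [sum_congr rfl this, sum_ite_eq', if_pos h1]
  have hcard : (#A : ℝ) ≤ ∑ j ∈ range X, f j ^ 2 := by
    calc (#A : ℝ) = ∑ j ∈ A, f j ^ 2 := by
          rw [sum_congr rfl fun j hj => by rw [hfA j hj]]; simp
      _ ≤ _ := sum_le_sum_of_subset_of_nonneg hA fun _ _ _ => sq_nonneg _
  have hexp : ∑ j ∈ range X, f j ^ 2 = ∑ d ∈ D, ∑ e ∈ D, w d * w e *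
      ((#((range X).filter fun j : ℕ => ((Nat.lcm d e : ℕ) : ℤ) ∣ (j : ℤ) - c) : ℕ) : ℝ) := by
    simp only [hf, sq, sum_mul_sum]
    rw [sum_comm]
    refine sum_congr rfl fun d _ => ?_
    rw [sum_comm]
    refine sum_congr rfl fun e _ => ?_
    rw [card_filter, Nat.cast_sum, mul_sum]
    refine sum_congr rfl fun j _ => ?_
    have hl : ((Nat.lcm d e : ℕ) : ℤ) ∣ (j : ℤ) - c ↔
        (d : ℤ) ∣ (j : ℤ) - c ∧ (e : ℤ) ∣ (j : ℤ) - c := by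
      rw [Int.natCast_dvd, Int.natCast_dvd, Int.natCast_dvd, Nat.lcm_dvd_iff]
    by_cases h1 : (d : ℤ) ∣ (j : ℤ) - c <;> by_cases h2 : (e : ℤ) ∣ (j : ℤ) - c <;>
      simp [hl, h1, h2]
  have hbound : ∀ d ∈ D, ∀ e ∈ D, w d * w e *
      ((#((range X).filter fun j : ℕ => ((Nat.lcm d e : ℕ) : ℤ) ∣ (j : ℤ) - c) : ℕ) : ℝ) ≤
      X * (w d * w e / (Nat.lcm d e : ℝ)) + |w d| * |w e| := by
    intro d hd e he
    have hpos : 0 < Nat.lcm d e := Nat.pos_of_ne_zero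
      (Nat.lcm_ne_zero (hsq d hd).ne_zero (hsq e he).ne_zero)
    have h := abs_card_range_filter_dvd_sub_div_le X (Nat.lcm d e) hpos c
    set n : ℝ := ((#((range X).filter fun j : ℕ => ((Nat.lcm d e : ℕ) : ℤ) ∣ (j : ℤ) - c) : ℕ) : ℝ)
    have h2 : w d * w e * (n - X / (Nat.lcm d e : ℝ)) ≤ |w d| * |w e| := by
      refine (le_abs_self _).trans ?_
      rw [abs_mul, abs_mul]
      exact mul_le_of_le_one_right (by positivity) h
    calc w d * w e * n = X * (w d * w e / (Nat.lcm d e : ℝ)) +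
          w d * w e * (n - X / (Nat.lcm d e : ℝ)) := by ring
      _ ≤ _ := by linarith
  have habs := sum_abs_selbergWeight_le hsq hdvd h1
  have habs0 : 0 ≤ ∑ d ∈ D, |w d| := sum_nonneg fun _ _ => abs_nonneg _
  calc (#A : ℝ) ≤ _ := hcard
    _ = _ := hexp
    _ ≤ ∑ d ∈ D, ∑ e ∈ D, (X * (w d * w e / (Nat.lcm d e : ℝ)) + |w d| * |w e|) :=
        sum_le_sum fun d hd => sum_le_sum fun e he => hbound d hd e he
    _ = X * (∑ d ∈ D, ∑ e ∈ D, w d * w e / (Nat.lcm d e : ℝ)) + (∑ d ∈ D, |w d|) ^ 2 := by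
        simp only [sum_add_distrib, ← mul_sum, sq, sum_mul]
    _ ≤ _ := by
        rw [sum_sum_selbergWeight_div_lcm hsq hdvd h1, mul_one_div]
        gcongr

end Selberg

/-- The squarefree integers in `[1, Q]` coprime to `6`. -/
def sieveModuli (Q : ℕ) : Finset ℕ :=
  (Icc 1 Q).filter fun k => Squarefree k ∧ Nat.Coprime k 6

theorem mem_sieveModuli {Q k : ℕ} :
    k ∈ sieveModuli Q ↔ (1 ≤ k ∧ k ≤ Q) ∧ Squarefree k ∧ Nat.Coprime k 6 := by
  simp [sieveModuli]

theorem mem_sieveModuli_of_dvd {Q k d : ℕ} (hk : k ∈ sieveModuli Q) (hd : d ∣ k) :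
    d ∈ sieveModuli Q := by
  rw [mem_sieveModuli] at hk ⊢
  exact ⟨⟨Nat.pos_of_dvd_of_pos hd hk.1.1, (Nat.le_of_dvd hk.1.1 hd).trans hk.1.2⟩,
    hk.2.1.squarefree_of_dvd hd, hk.2.2.coprime_dvd_left hd⟩

theorem totient_eq_cast_mul_prod (n : ℕ) :
    (Nat.totient n : ℝ) = n * ∏ p ∈ n.primeFactors, (1 - (p : ℝ)⁻¹) := by
  have h := Nat.totient_eq_mul_prod_factors n
  have h' : ((Nat.totient n : ℚ) : ℝ) =
      ((n * ∏ p ∈ n.primeFactors, (1 - (p : ℚ)⁻¹) : ℚ) : ℝ) := by rw [h]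
  push_cast at h'
  exact h'

theorem sum_inv_le_inv_totient {k : ℕ} (hk : 0 < k) (s : Finset ℕ)
    (hs : ∀ n ∈ s, n ≠ 0 ∧ UniqueFactorizationMonoid.radical n = k) :
    ∑ n ∈ s, (1 : ℝ) / n ≤ 1 / (Nat.totient k : ℝ) := by
  let f : ℕ →* ℝ :=
    { toFun := fun n => (n : ℝ)⁻¹
      map_one' := by simp
      map_mul' := fun a b => by push_cast; rw [mul_inv] }
  have hf : ∀ {p : ℕ}, p.Prime → ‖f p‖ < 1 := by
    intro p hp
    have : (1 : ℝ) < p := by exact_mod_cast hp.one_lt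
    change ‖(p : ℝ)⁻¹‖ < 1
    rw [norm_inv, Real.norm_natCast]
    exact inv_lt_one_of_one_lt₀ this
  have hsum := (EulerProduct.summable_and_hasSum_factoredNumbers_prod_filter_prime_geometric hf
    k.primeFactors).2
  rw [filter_true_of_mem fun p hp => Nat.prime_of_mem_primeFactors hp] at hsum
  have hsum' : HasSum (Set.indicator (Nat.factoredNumbers k.primeFactors) f)
      (∏ p ∈ k.primeFactors, (1 - f p)⁻¹) := hasSum_subtype_iff_indicator.mp hsum
  have hdvd : ∀ n ∈ s, k ∣ n := fun n hn => by
    have := UniqueFactorizationMonoid.radical_dvd_self (a := n)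
    rwa [(hs n hn).2] at this
  have hinj : Set.InjOn (fun n => n / k) s := by
    intro a ha b hb hab
    have hab' : a / k = b / k := hab
    rw [← Nat.div_mul_cancel (hdvd a ha), ← Nat.div_mul_cancel (hdvd b hb), hab']
  have hmem : ∀ n ∈ s, n / k ∈ Nat.factoredNumbers k.primeFactors := by
    intro n hn
    have hn0 := (hs n hn).1
    refine Nat.mem_factoredNumbers_of_dvd (m := n) ?_ (Nat.div_dvd_of_dvd (hdvd n hn))
    refine Nat.mem_factoredNumbers_of_primeFactors_subset hn0 ?_
    rw [← (hs n hn).2, Nat.primeFactors_radical]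
  have hle := sum_le_hasSum (s.image fun n => n / k) (fun i _ =>
    Set.indicator_nonneg (fun n _ => inv_nonneg.mpr (Nat.cast_nonneg (α := ℝ) n)) i) hsum'
  rw [sum_image hinj] at hle
  have hk' : (0 : ℝ) < k := by exact_mod_cast hk
  calc ∑ n ∈ s, (1 : ℝ) / n
      = 1 / k * ∑ n ∈ s, Set.indicator (Nat.factoredNumbers k.primeFactors) f (n / k) := by
        rw [mul_sum]
        refine sum_congr rfl fun n hn => ?_
        rw [Set.indicator_of_mem (hmem n hn)]
        change _ = 1 / (k : ℝ) * ((n / k : ℕ) : ℝ)⁻¹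
        rw [Nat.cast_div (hdvd n hn) hk'.ne']
        field_simp
    _ ≤ 1 / k * ∏ p ∈ k.primeFactors, (1 - f p)⁻¹ :=
        mul_le_mul_of_nonneg_left hle (by positivity)
    _ = 1 / (Nat.totient k : ℝ) := by
        rw [totient_eq_cast_mul_prod, prod_inv_distrib]
        change 1 / (k : ℝ) * (∏ p ∈ k.primeFactors, (1 - (p : ℝ)⁻¹))⁻¹ = _
        rw [one_div, one_div, mul_inv]

/-- The sum of `1 / n` over the integers `n ∈ [1, Q]` coprime to `6`. -/
noncomputable def coprimeHarmonic (Q : ℕ) : ℝ :=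
  ∑ n ∈ (Icc 1 Q).filter (fun n => Nat.Coprime n 6), (1 : ℝ) / n

theorem coprimeHarmonic_le_sum_inv_totient (Q : ℕ) :
    coprimeHarmonic Q ≤ ∑ k ∈ sieveModuli Q, 1 / (Nat.totient k : ℝ) := by
  have hmaps : ∀ n ∈ (Icc 1 Q).filter (fun n => Nat.Coprime n 6),
      UniqueFactorizationMonoid.radical n ∈ sieveModuli Q := by
    intro n hn
    simp only [mem_filter, mem_Icc] at hn
    have hd := UniqueFactorizationMonoid.radical_dvd_self (a := n)
    exact mem_sieveModuli.mpr ⟨⟨Nat.pos_of_dvd_of_pos hd hn.1.1,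
      (Nat.le_of_dvd hn.1.1 hd).trans hn.1.2⟩, UniqueFactorizationMonoid.squarefree_radical,
      hn.2.coprime_dvd_left hd⟩
  rw [coprimeHarmonic, ← sum_fiberwise_of_maps_to hmaps]
  refine sum_le_sum fun k hk => sum_inv_le_inv_totient (mem_sieveModuli.mp hk).1.1 _ fun n hn => ?_
  simp only [mem_filter, mem_Icc] at hn
  exact ⟨by omega, hn.2⟩

theorem log_le_of_pow_le {x : ℝ} {a b : ℕ} (hx : 0 < x) (hb : 0 < b)
    (h : x ^ b ≤ 2.7182818283 ^ a) : Real.log x ≤ a / b := by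
  have hb' : (0 : ℝ) < b := by exact_mod_cast hb
  have he : (2.7182818283 : ℝ) ≤ Real.exp 1 := Real.exp_one_gt_d9.le
  rw [le_div_iff₀ hb', mul_comm, ← Real.log_pow,
    Real.log_le_iff_le_exp (by positivity), ← mul_one (a : ℝ), Real.exp_nat_mul]
  exact h.trans (by gcongr)

theorem log_mul_add_le {u : ℝ} (hu : 0 < u) (a : ℝ) (ha : 0 < a) {t : ℝ} (ht : 0 ≤ t) :
    Real.log (a * (u + t)) ≤ Real.log (a * u) + t / u := by
  have h1 : a * (u + t) = a * u * (1 + t / u) := by field_simp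
  have h2 : 0 < 1 + t / u := by positivity
  rw [h1, Real.log_mul (by positivity) h2.ne']
  linarith [Real.log_le_sub_one_of_pos h2]

theorem coprime_six_iff (n : ℕ) : Nat.Coprime n 6 ↔ n % 6 = 1 ∨ n % 6 = 5 := by
  have : n % 6 < 6 := Nat.mod_lt _ (by norm_num)
  rw [Nat.coprime_iff_gcd_eq_one, Nat.gcd_comm, Nat.gcd_rec]
  generalize n % 6 = r at *
  interval_cases r <;> decide

theorem coprimeHarmonic_succ (n : ℕ) : coprimeHarmonic (n + 1) =
    coprimeHarmonic n + if (n + 1) % 6 = 1 ∨ (n + 1) % 6 = 5 then 1 / (n + 1 : ℝ) else 0 := by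
  rw [coprimeHarmonic, coprimeHarmonic, sum_filter, sum_filter, sum_Icc_succ_top (by omega)]
  simp only [coprime_six_iff]
  push_cast
  rfl

theorem coprimeHarmonic_six_mul_add_four (m : ℕ) :
    coprimeHarmonic (6 * m + 4) = coprimeHarmonic (6 * m + 1) := by
  rw [coprimeHarmonic_succ, coprimeHarmonic_succ, coprimeHarmonic_succ, if_neg (by omega),
    if_neg (by omega), if_neg (by omega), add_zero, add_zero, add_zero]

theorem coprimeHarmonic_six_mul_add_five (m : ℕ) :
    coprimeHarmonic (6 * m + 5) = coprimeHarmonic (6 * m + 1) + 1 / (6 * m + 5 : ℝ) := by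
  rw [coprimeHarmonic_succ, coprimeHarmonic_six_mul_add_four, if_pos (by omega)]
  push_cast
  ring

theorem coprimeHarmonic_six_mul_add_seven (m : ℕ) :
    coprimeHarmonic (6 * m + 7) =
      coprimeHarmonic (6 * m + 1) + 1 / (6 * m + 5 : ℝ) + 1 / (6 * m + 7 : ℝ) := by
  rw [coprimeHarmonic_succ, coprimeHarmonic_succ, coprimeHarmonic_six_mul_add_five,
    if_neg (by omega), if_pos (by omega)]
  push_cast
  ring

theorem coprimeHarmonic_mono {m n : ℕ} (h : m ≤ n) : coprimeHarmonic m ≤ coprimeHarmonic n :=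
  sum_le_sum_of_subset_of_nonneg (filter_subset_filter _ (Icc_subset_Icc_right h))
    fun _ _ _ => by positivity

theorem log_le_coprimeHarmonic_six_mul_add_one {m : ℕ} (hm : 2 ≤ m) :
    Real.log (5.4 * (6 * m + 5)) ≤ 3 * coprimeHarmonic (6 * m + 1) := by
  induction m, hm using Nat.le_induction with
  | base =>
    have hs : ((Icc 1 (6 * 2 + 1)).filter (fun n => Nat.Coprime n 6)) = {1, 5, 7, 11, 13} := by
      decide
    rw [coprimeHarmonic, hs]
    refine (log_le_of_pow_le (a := 113) (b := 25) (by norm_num) (by norm_num) ?_).trans ?_ <;>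
      norm_num
  | succ m hm ih =>
    rw [show 6 * (m + 1) + 1 = 6 * m + 7 by ring, coprimeHarmonic_six_mul_add_seven]
    have h1 := log_mul_add_le (u := 6 * m + 5) (by positivity) 5.4 (by norm_num) (t := 2)
      (by norm_num)
    have h2 := log_mul_add_le (u := 6 * m + 7) (by positivity) 5.4 (by norm_num) (t := 4)
      (by norm_num)
    have h3 : (1 : ℝ) / (6 * m + 7) ≤ 1 / (6 * m + 5) :=
      one_div_le_one_div_of_le (by positivity) (by linarith)
    rw [show (6 * (m : ℝ) + 5 + 2) = 6 * m + 7 by ring] at h1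
    rw [show (2 : ℝ) / (6 * m + 5) = 2 * (1 / (6 * m + 5)) by ring] at h1
    rw [show (4 : ℝ) / (6 * m + 7) = 4 * (1 / (6 * m + 7)) by ring] at h2
    rw [show (6 * ((m + 1 : ℕ) : ℝ) + 5) = 6 * m + 7 + 4 by push_cast; ring]
    linarith

theorem log_le_coprimeHarmonic {Q : ℕ} (hQ : 12 ≤ Q) :
    Real.log (5.4 * (Q + 1)) ≤ 3 * coprimeHarmonic Q := by
  obtain rfl | hQ' := hQ.eq_or_lt
  · have hs : ((Icc 1 12).filter (fun n => Nat.Coprime n 6)) = {1, 5, 7, 11} := by decide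
    rw [coprimeHarmonic, hs]
    refine (log_le_of_pow_le (a := 43) (b := 10) (by norm_num) (by norm_num) ?_).trans ?_ <;>
      norm_num
  obtain ⟨m, r, hr, rfl⟩ : ∃ m r, r < 6 ∧ Q = 6 * m + 1 + r :=
    ⟨(Q - 1) / 6, (Q - 1) % 6, Nat.mod_lt _ (by norm_num), by omega⟩
  have hm : 2 ≤ m := by omega
  have hlog := log_le_coprimeHarmonic_six_mul_add_one hm
  rcases Nat.lt_or_ge r 4 with h | h
  · have hr' : (r : ℝ) ≤ 3 := by exact_mod_cast Nat.le_of_lt_succ h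
    refine le_trans (Real.log_le_log (by positivity) ?_)
      (hlog.trans (mul_le_mul_of_nonneg_left (coprimeHarmonic_mono (by omega)) (by norm_num)))
    push_cast
    linarith
  · have hr' : (r : ℝ) ≤ 5 := by exact_mod_cast Nat.le_of_lt_succ hr
    have h5 := coprimeHarmonic_mono (m := 6 * m + 5) (n := 6 * m + 1 + r) (by omega)
    rw [coprimeHarmonic_six_mul_add_five] at h5
    have h1 := log_mul_add_le (u := 6 * m + 5) (by positivity) 5.4 (by norm_num) (t := 2)
      (by norm_num)
    have h2 : Real.log (5.4 * (((6 * m + 1 + r : ℕ) : ℝ) + 1)) ≤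
        Real.log (5.4 * (6 * m + 5 + 2)) := by
      refine Real.log_le_log (by positivity) ?_
      push_cast
      linarith
    have h3 : (0 : ℝ) ≤ 1 / (6 * m + 5) := by positivity
    rw [show (2 : ℝ) / (6 * m + 5) = 2 * (1 / (6 * m + 5)) by ring] at h1
    linarith

theorem sum_divisors_prod_primeFactors {n : ℕ} (hn : Squarefree n) (f : ℕ → ℝ) :
    ∑ d ∈ n.divisors, ∏ p ∈ d.primeFactors, f p = ∏ p ∈ n.primeFactors, (1 + f p) := by
  have h := ArithmeticFunction.IsMultiplicative.prodPrimeFactors_one_add_of_squarefree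
    (ArithmeticFunction.IsMultiplicative.prodPrimeFactors f) hn
  rw [prod_congr rfl fun p hp => ?_, h, sum_congr rfl fun d hd => ?_]
  · rw [ArithmeticFunction.prodPrimeFactors_apply (Nat.pos_of_mem_divisors hd).ne']
  · have hp' := Nat.prime_of_mem_primeFactors hp
    rw [ArithmeticFunction.prodPrimeFactors_apply hp'.ne_zero, hp'.primeFactors, prod_singleton]

theorem sum_divisors_div_totient {k : ℕ} (hk : Squarefree k) :
    ((∑ d ∈ k.divisors, d : ℕ) : ℝ) / (Nat.totient k : ℝ) =
      ∑ d ∈ k.divisors, ∏ p ∈ d.primeFactors, 2 / ((p : ℝ) - 1) := by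
  have h1 : ((∑ d ∈ k.divisors, d : ℕ) : ℝ) = ∏ p ∈ k.primeFactors, (1 + (p : ℝ)) := by
    rw [← sum_divisors_prod_primeFactors hk, Nat.cast_sum]
    refine sum_congr rfl fun d hd => ?_
    have hd' := Nat.prod_primeFactors_of_squarefree
      (hk.squarefree_of_dvd (Nat.dvd_of_mem_divisors hd))
    nth_rw 1 [← hd']
    push_cast
    rfl
  have h2 : (k : ℝ) = ∏ p ∈ k.primeFactors, (p : ℝ) := by
    nth_rw 1 [← Nat.prod_primeFactors_of_squarefree hk]
    push_cast
    rfl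
  rw [h1, sum_divisors_prod_primeFactors hk, totient_eq_cast_mul_prod, h2, ← prod_mul_distrib,
    ← prod_div_distrib]
  refine prod_congr rfl fun p hp => ?_
  have hp1 : (1 : ℝ) < p := by exact_mod_cast (Nat.prime_of_mem_primeFactors hp).one_lt
  have : (p : ℝ) - 1 ≠ 0 := by linarith
  field_simp
  ring

theorem three_mul_card_coprime_six_le (n : ℕ) :
    3 * #((Icc 1 n).filter fun m => Nat.Coprime m 6) ≤ n + 2 := by
  suffices h : #((Icc 1 n).filter fun m => Nat.Coprime m 6) = (n + 5) / 6 + (n + 1) / 6 by omega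
  induction n with
  | zero => simp
  | succ n ih =>
    rw [card_filter] at ih ⊢
    rw [sum_Icc_succ_top (by omega), ih]
    simp only [coprime_six_iff]
    split_ifs <;> omega

theorem card_sieveModuli_filter_dvd_le {Q d : ℕ} (hd : d ∈ sieveModuli Q) :
    (#((sieveModuli Q).filter fun k => d ∣ k) : ℝ) ≤
      Q / 3 * (1 / d) + 2 / 3 * (√Q * (1 / √d)) := by
  obtain ⟨⟨hd1, hdQ⟩, -, -⟩ := mem_sieveModuli.mp hd
  have hcard : #((sieveModuli Q).filter fun k => d ∣ k) ≤
      #((Icc 1 (Q / d)).filter fun m => Nat.Coprime m 6) := by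
    refine card_le_card_of_injOn (fun k => k / d) ?_ ?_
    · intro k hk
      simp only [coe_filter, Set.mem_ofPred_eq, mem_sieveModuli, mem_Icc] at hk ⊢
      obtain ⟨⟨⟨h1, h2⟩, -, h3⟩, h4⟩ := hk
      exact ⟨⟨Nat.div_pos (Nat.le_of_dvd h1 h4) hd1, Nat.div_le_div_right h2⟩,
        h3.coprime_dvd_left (Nat.div_dvd_of_dvd h4)⟩
    · intro a ha b hb hab
      simp only [coe_filter, Set.mem_ofPred_eq] at ha hb
      have hab' : a / d = b / d := hab
      rw [← Nat.div_mul_cancel ha.2, ← Nat.div_mul_cancel hb.2, hab']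
  have h3 : (3 : ℝ) * #((sieveModuli Q).filter fun k => d ∣ k) ≤ ((Q / d : ℕ) : ℝ) + 2 := by
    exact_mod_cast (Nat.mul_le_mul_left 3 hcard).trans (three_mul_card_coprime_six_le (Q / d))
  have h4 : ((Q / d : ℕ) : ℝ) ≤ Q / d := Nat.cast_div_le
  have hd0 : (0 : ℝ) < d := by exact_mod_cast hd1
  have h5 : 1 ≤ √Q * (1 / √d) := by
    rw [mul_one_div, le_div_iff₀ (Real.sqrt_pos.mpr hd0), one_mul]
    exact Real.sqrt_le_sqrt (by exact_mod_cast hdQ)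
  have h6 : (Q : ℝ) / 3 * (1 / d) = (Q / d) / 3 := by ring
  rw [h6]
  linarith

theorem sum_sieveModuli_prod_le (Q : ℕ) (f : ℕ → ℝ) (hf : ∀ n, 1 ≤ n → 0 ≤ f n) :
    ∑ d ∈ sieveModuli Q, ∏ p ∈ d.primeFactors, f p ≤
      ∏ p ∈ (Icc 5 Q).filter Nat.Prime, (1 + f p) := by
  rw [prod_one_add]
  have hinj : Set.InjOn Nat.primeFactors (sieveModuli Q) := by
    intro a ha b hb hab
    rw [← Nat.prod_primeFactors_of_squarefree (mem_sieveModuli.mp ha).2.1, hab,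
      Nat.prod_primeFactors_of_squarefree (mem_sieveModuli.mp hb).2.1]
  rw [← sum_image (f := fun s : Finset ℕ => ∏ p ∈ s, f p) hinj]
  refine sum_le_sum_of_subset_of_nonneg ?_ fun s hs _ => prod_nonneg fun p hp => hf p ?_
  · intro s hs
    obtain ⟨d, hd, rfl⟩ := mem_image.mp hs
    obtain ⟨⟨hd1, hdQ⟩, -, hd6⟩ := mem_sieveModuli.mp hd
    refine mem_powerset.mpr fun p hp => ?_
    have hp' := Nat.prime_of_mem_primeFactors hp
    have hpd := Nat.dvd_of_mem_primeFactors hp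
    have hp6 := (coprime_six_iff p).mp (hd6.coprime_dvd_left hpd)
    have := hp'.one_lt
    exact mem_filter.mpr ⟨mem_Icc.mpr ⟨by omega, (Nat.le_of_dvd hd1 hpd).trans hdQ⟩, hp'⟩
  · have := mem_Icc.mp (mem_filter.mp (mem_powerset.mp hs hp)).1
    omega

/-- A product over the primes above `23` is bounded by telescoping over the odd integers. -/
theorem prod_one_add_primes_tail_le (Q : ℕ) (f v : ℕ → ℝ) (hf : ∀ n, 25 ≤ n → 0 ≤ f n)
    (hfv : ∀ n, 23 ≤ n → f (n + 2) ≤ v n - v (n + 2)) (hv : ∀ n, 0 ≤ v n) (hv1 : v 23 < 1) :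
    ∏ p ∈ (Icc 25 Q).filter Nat.Prime, (1 + f p) ≤ 1 / (1 - v 23) := by
  set s := (Icc 25 Q).filter Nat.Prime with hs
  have hsum : ∑ p ∈ s, f p ≤ v 23 := by
    have hsub : s ⊆ (range Q).image fun j => 2 * j + 23 + 2 := by
      intro p hp
      simp only [hs, mem_filter, mem_Icc] at hp
      have := hp.2.eq_two_or_odd
      exact mem_image.mpr ⟨(p - 25) / 2, mem_range.mpr (by omega), by omega⟩
    calc ∑ p ∈ s, f p ≤ ∑ p ∈ (range Q).image fun j => 2 * j + 23 + 2, f p := by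
          refine sum_le_sum_of_subset_of_nonneg hsub fun p hp _ => hf p ?_
          obtain ⟨j, -, rfl⟩ := mem_image.mp hp
          omega
      _ = ∑ j ∈ range Q, f (2 * j + 23 + 2) := sum_image fun a _ b _ h => by
          have h' : 2 * a + 23 + 2 = 2 * b + 23 + 2 := h
          omega
      _ ≤ ∑ j ∈ range Q, (v (2 * j + 23) - v (2 * (j + 1) + 23)) :=
          sum_le_sum fun j _ => hfv (2 * j + 23) (by omega)
      _ = v 23 - v (2 * Q + 23) := by
          rw [sum_range_sub' (fun j => v (2 * j + 23))]
      _ ≤ v 23 := by linarith [hv (2 * Q + 23)]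
  have hexp : ∏ p ∈ s, (1 + f p) ≤ Real.exp (∑ p ∈ s, f p) := by
    rw [Real.exp_sum]
    refine prod_le_prod (fun p hp => ?_) fun p _ => by linarith [Real.add_one_le_exp (f p)]
    have := hf p (mem_Icc.mp (mem_filter.mp hp).1).1
    linarith
  refine hexp.trans ((Real.exp_le_exp.mpr hsum).trans ?_)
  have h := Real.one_sub_le_exp_neg (v 23)
  rw [Real.exp_neg] at h
  rw [le_div_iff₀ (by linarith)]
  calc Real.exp (v 23) * (1 - v 23) ≤ Real.exp (v 23) * (Real.exp (v 23))⁻¹ := by gcongr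
    _ = 1 := mul_inv_cancel₀ (Real.exp_pos _).ne'

theorem prod_primes_split {Q : ℕ} (hQ : 25 ≤ Q) (f : ℕ → ℝ) :
    ∏ p ∈ (Icc 5 Q).filter Nat.Prime, f p =
      f 5 * f 7 * f 11 * f 13 * f 17 * f 19 * f 23 *
        ∏ p ∈ (Icc 25 Q).filter Nat.Prime, f p := by
  have hset : (Icc 5 Q).filter Nat.Prime =
      {5, 7, 11, 13, 17, 19, 23} ∪ (Icc 25 Q).filter Nat.Prime := by
    ext p
    simp only [mem_filter, mem_Icc, mem_union, mem_insert, mem_singleton]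
    constructor
    · rintro ⟨⟨h1, h2⟩, h3⟩
      by_cases h : 25 ≤ p
      · exact Or.inr ⟨⟨h, h2⟩, h3⟩
      · left
        push Not at h
        interval_cases p <;> first | omega | (exfalso; revert h3; norm_num)
    · rintro (h | h)
      · rcases h with rfl | rfl | rfl | rfl | rfl | rfl | rfl <;> norm_num <;> omega
      · exact ⟨⟨by omega, h.1.2⟩, h.2⟩
  rw [hset, prod_union]
  · repeat rw [prod_insert (by decide)]
    rw [prod_singleton]
    ring
  · rw [disjoint_left]
    intro p hp hp'
    simp only [mem_insert, mem_singleton, mem_filter, mem_Icc] at hp hp'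
    omega

theorem sum_sieveModuli_prod_div_le {Q : ℕ} (hQ : 25 ≤ Q) :
    ∑ d ∈ sieveModuli Q, (∏ p ∈ d.primeFactors, 2 / ((p : ℝ) - 1)) * (1 / d) ≤ 1.264 := by
  set f : ℕ → ℝ := fun p => 2 / ((p : ℝ) - 1) * (1 / p) with hf
  have hpos : ∀ n, 1 ≤ n → 0 ≤ f n := by
    intro n hn
    have : (1 : ℝ) ≤ n := by exact_mod_cast hn
    have : (0 : ℝ) ≤ n - 1 := by linarith
    simp only [hf]
    positivity
  have heq : ∀ d ∈ sieveModuli Q, (∏ p ∈ d.primeFactors, 2 / ((p : ℝ) - 1)) * (1 / d) =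
      ∏ p ∈ d.primeFactors, f p := by
    intro d hd
    have h2 : (d : ℝ) = ∏ p ∈ d.primeFactors, (p : ℝ) := by
      nth_rw 1 [← Nat.prod_primeFactors_of_squarefree (mem_sieveModuli.mp hd).2.1]
      push_cast
      rfl
    simp only [hf, prod_mul_distrib, one_div, prod_inv_distrib]
    rw [← h2]
  rw [sum_congr rfl heq]
  refine (sum_sieveModuli_prod_le Q f hpos).trans ?_
  rw [prod_primes_split hQ]
  have htail := prod_one_add_primes_tail_le Q f (fun n => 1 / n) (fun n hn => hpos n (by omega))
    (by
      intro n hn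
      have : (23 : ℝ) ≤ n := by exact_mod_cast hn
      simp only [hf]
      push_cast
      rw [div_sub_div _ _ (by positivity) (by positivity), div_mul_div_comm,
        div_le_div_iff₀ (mul_pos (by linarith) (by positivity)) (by positivity)]
      nlinarith)
    (fun n => by positivity) (by norm_num)
  calc _ ≤ (1 + f 5) * (1 + f 7) * (1 + f 11) * (1 + f 13) * (1 + f 17) * (1 + f 19) *
        (1 + f 23) * (1 / (1 - 1 / (23 : ℕ))) := by
        refine mul_le_mul_of_nonneg_left htail ?_
        simp only [hf]
        norm_num
    _ ≤ 1.264 := by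
        simp only [hf]
        norm_num

theorem one_div_sqrt_le {x r : ℝ} (hx : 0 < x) (hr : 0 < r) (h : 1 ≤ r ^ 2 * x) :
    1 / √x ≤ r := by
  rw [div_le_iff₀ (Real.sqrt_pos.mpr hx), ← Real.sqrt_sq hr.le, ← Real.sqrt_mul (by positivity)]
  exact Real.one_le_sqrt.mpr h

theorem sum_sieveModuli_prod_div_sqrt_le {Q : ℕ} (hQ : 25 ≤ Q) :
    ∑ d ∈ sieveModuli Q, (∏ p ∈ d.primeFactors, 2 / ((p : ℝ) - 1)) * (1 / √d) ≤ 2.85 := by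
  set f : ℕ → ℝ := fun p => 2 / ((p : ℝ) - 1) * (1 / √p) with hf
  have hpos : ∀ n, 1 ≤ n → 0 ≤ f n := by
    intro n hn
    have : (1 : ℝ) ≤ n := by exact_mod_cast hn
    have : (0 : ℝ) ≤ n - 1 := by linarith
    simp only [hf]
    positivity
  have heq : ∀ d ∈ sieveModuli Q, (∏ p ∈ d.primeFactors, 2 / ((p : ℝ) - 1)) * (1 / √d) =
      ∏ p ∈ d.primeFactors, f p := by
    intro d hd
    have h2 : √(d : ℝ) = ∏ p ∈ d.primeFactors, √(p : ℝ) := by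
      have h3 : (d : ℝ) = (∏ p ∈ d.primeFactors, √(p : ℝ)) ^ 2 := by
        nth_rw 1 [← Nat.prod_primeFactors_of_squarefree (mem_sieveModuli.mp hd).2.1]
        rw [← prod_pow]
        push_cast
        exact prod_congr rfl fun p _ => (Real.sq_sqrt (Nat.cast_nonneg p)).symm
      rw [h3, Real.sqrt_sq (prod_nonneg fun _ _ => Real.sqrt_nonneg _)]
    simp only [hf, prod_mul_distrib, one_div, prod_inv_distrib]
    rw [← h2]
  rw [sum_congr rfl heq]
  refine (sum_sieveModuli_prod_le Q f hpos).trans ?_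
  rw [prod_primes_split hQ]
  have h23 : (1 : ℝ) / √(23 : ℕ) ≤ 0.2086 :=
    one_div_sqrt_le (by norm_num) (by norm_num) (by norm_num)
  have htail := prod_one_add_primes_tail_le Q f (fun n => 2 * (1 / √n))
    (fun n hn => hpos n (by omega))
    (by
      intro n hn
      have hn' : (23 : ℝ) ≤ n := by exact_mod_cast hn
      simp only [hf]
      push_cast
      set a := √(n : ℝ) with ha
      set b := √((n : ℝ) + 2) with hb
      have ha2 : a ^ 2 = n := Real.sq_sqrt (by positivity)
      have hb2 : b ^ 2 = n + 2 := Real.sq_sqrt (by positivity)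
      have ha0 : 0 < a := Real.sqrt_pos.mpr (by linarith)
      have hb0 : 0 < b := Real.sqrt_pos.mpr (by linarith)
      have hkey : 2 / ((n : ℝ) + 2 - 1) ≤ 2 * (b - a) / a := by
        rw [div_le_div_iff₀ (by linarith) ha0, ← ha2]
        have hab : a ≤ b := Real.sqrt_le_sqrt (by linarith)
        have h1 : (b - a) * (b + a) = 2 := by nlinarith
        have h2 : a * (b + a) ≤ 2 * (a ^ 2 + 2 - 1) := by nlinarith [sq_nonneg (a - b)]
        have h3 : a * ((b - a) * (b + a)) ≤ (b - a) * (2 * (a ^ 2 + 2 - 1)) := by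
          nlinarith
        rw [h1] at h3
        linarith
      have hfin : 2 * (1 / a) - 2 * (1 / b) = 2 * (b - a) / a * (1 / b) := by
        field_simp
      rw [hfin]
      gcongr)
    (fun n => by positivity) (by linarith)
  have htail' : ∏ p ∈ (Icc 25 Q).filter Nat.Prime, (1 + f p) ≤ 1 / (1 - 2 * 0.2086) := by
    refine htail.trans (one_div_le_one_div_of_le (by norm_num) (by linarith))
  have h5 : (1 : ℝ) / √(5 : ℕ) ≤ 0.4473 :=
    one_div_sqrt_le (by norm_num) (by norm_num) (by norm_num)
  have h7 : (1 : ℝ) / √(7 : ℕ) ≤ 0.378 :=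
    one_div_sqrt_le (by norm_num) (by norm_num) (by norm_num)
  have h11 : (1 : ℝ) / √(11 : ℕ) ≤ 0.3016 :=
    one_div_sqrt_le (by norm_num) (by norm_num) (by norm_num)
  have h13 : (1 : ℝ) / √(13 : ℕ) ≤ 0.2774 :=
    one_div_sqrt_le (by norm_num) (by norm_num) (by norm_num)
  have h17 : (1 : ℝ) / √(17 : ℕ) ≤ 0.2426 :=
    one_div_sqrt_le (by norm_num) (by norm_num) (by norm_num)
  have h19 : (1 : ℝ) / √(19 : ℕ) ≤ 0.2295 :=
    one_div_sqrt_le (by norm_num) (by norm_num) (by norm_num)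
  have p5 := hpos 5 (by norm_num)
  have p7 := hpos 7 (by norm_num)
  have p11 := hpos 11 (by norm_num)
  have p13 := hpos 13 (by norm_num)
  have p17 := hpos 17 (by norm_num)
  have p19 := hpos 19 (by norm_num)
  have p23 := hpos 23 (by norm_num)
  have f5 : f 5 ≤ 2 / 4 * 0.4473 := by simp only [hf]; norm_num at h5 ⊢; linarith
  have f7 : f 7 ≤ 2 / 6 * 0.378 := by simp only [hf]; norm_num at h7 ⊢; linarith
  have f11 : f 11 ≤ 2 / 10 * 0.3016 := by simp only [hf]; norm_num at h11 ⊢; linarith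
  have f13 : f 13 ≤ 2 / 12 * 0.2774 := by simp only [hf]; norm_num at h13 ⊢; linarith
  have f17 : f 17 ≤ 2 / 16 * 0.2426 := by simp only [hf]; norm_num at h17 ⊢; linarith
  have f19 : f 19 ≤ 2 / 18 * 0.2295 := by simp only [hf]; norm_num at h19 ⊢; linarith
  have f23 : f 23 ≤ 2 / 22 * 0.2086 := by simp only [hf]; norm_num at h23 ⊢; linarith
  calc _ ≤ (1 + 2 / 4 * 0.4473) * (1 + 2 / 6 * 0.378) * (1 + 2 / 10 * 0.3016) *
        (1 + 2 / 12 * 0.2774) * (1 + 2 / 16 * 0.2426) * (1 + 2 / 18 * 0.2295) *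
        (1 + 2 / 22 * 0.2086) * (1 / (1 - 2 * 0.2086)) := by
        gcongr
        refine prod_nonneg fun p hp => ?_
        have := hpos p (le_trans (by norm_num) (mem_Icc.mp (mem_filter.mp hp).1).1)
        linarith
    _ ≤ (2.85 : ℝ) := by norm_num

theorem sum_sigma_div_totient_le_of_large {Q : ℕ} (hQ : 395 ≤ Q) :
    ∑ k ∈ sieveModuli Q, ((∑ d ∈ k.divisors, d : ℕ) : ℝ) / (Nat.totient k : ℝ) ≤ 0.53 * Q := by
  set g : ℕ → ℝ := fun d => ∏ p ∈ d.primeFactors, 2 / ((p : ℝ) - 1) with hg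
  have hg0 : ∀ d, 0 ≤ g d := fun d => prod_nonneg fun p hp => by
    have : (1 : ℝ) < p := by exact_mod_cast (Nat.prime_of_mem_primeFactors hp).one_lt
    exact div_nonneg (by norm_num) (by linarith)
  have h1 : ∑ k ∈ sieveModuli Q, ((∑ d ∈ k.divisors, d : ℕ) : ℝ) / (Nat.totient k : ℝ) =
      ∑ d ∈ sieveModuli Q, g d * #((sieveModuli Q).filter fun k => d ∣ k) := by
    have : ∀ k ∈ sieveModuli Q, ((∑ d ∈ k.divisors, d : ℕ) : ℝ) / (Nat.totient k : ℝ) =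
        ∑ d ∈ sieveModuli Q, if d ∣ k then g d else 0 := by
      intro k hk
      obtain ⟨⟨hk1, -⟩, hksq, -⟩ := mem_sieveModuli.mp hk
      rw [sum_divisors_div_totient hksq, ← sum_filter]
      refine sum_congr ?_ fun _ _ => rfl
      ext d
      simp only [mem_filter, Nat.mem_divisors]
      exact ⟨fun h => ⟨mem_sieveModuli_of_dvd hk h.1, h.1⟩, fun h => ⟨h.2, by omega⟩⟩
    rw [sum_congr rfl this, sum_comm]
    refine sum_congr rfl fun d _ => ?_
    rw [← sum_filter, sum_const, nsmul_eq_mul, mul_comm]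
  have h2 : ∑ d ∈ sieveModuli Q, g d * #((sieveModuli Q).filter fun k => d ∣ k) ≤
      Q / 3 * (∑ d ∈ sieveModuli Q, g d * (1 / d)) +
        2 / 3 * √Q * ∑ d ∈ sieveModuli Q, g d * (1 / √d) := by
    rw [mul_sum, mul_sum, ← sum_add_distrib]
    refine sum_le_sum fun d hd => ?_
    have := mul_le_mul_of_nonneg_left (card_sieveModuli_filter_dvd_le hd) (hg0 d)
    linarith
  have h3 := sum_sieveModuli_prod_div_le (Q := Q) (by omega)
  have h4 := sum_sieveModuli_prod_div_sqrt_le (Q := Q) (by omega)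
  have hQ' : (395 : ℝ) ≤ Q := by exact_mod_cast hQ
  have hsq : √(Q : ℝ) * √Q = Q := Real.mul_self_sqrt (by linarith)
  have hs : (19.8 : ℝ) ≤ √Q := Real.le_sqrt_of_sq_le (by norm_num; linarith)
  calc _ = _ := h1
    _ ≤ _ := h2
    _ ≤ Q / 3 * 1.264 + 2 / 3 * √Q * 2.85 := by gcongr
    _ ≤ 0.53 * Q := by nlinarith

theorem sum_sigma_div_totient_le_of_check {a b Q : ℕ} (haQ : a ≤ Q) (hQb : Q ≤ b)
    (h : ∑ k ∈ (Icc 1 b).filter (fun k => Nat.gcd k 6 = 1),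
      (10000 * (∑ d ∈ k.divisors, d) / Nat.totient k + 1) ≤ 5300 * a) :
    ∑ k ∈ sieveModuli Q, ((∑ d ∈ k.divisors, d : ℕ) : ℝ) / (Nat.totient k : ℝ) ≤ 0.53 * Q := by
  have hsub : sieveModuli Q ⊆ (Icc 1 b).filter (fun k => Nat.gcd k 6 = 1) := by
    intro k hk
    obtain ⟨⟨hk1, hk2⟩, -, hk6⟩ := mem_sieveModuli.mp hk
    exact mem_filter.mpr ⟨mem_Icc.mpr ⟨hk1, hk2.trans hQb⟩, hk6⟩
  have hterm : ∀ k ∈ (Icc 1 b).filter (fun k => Nat.gcd k 6 = 1),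
      ((∑ d ∈ k.divisors, d : ℕ) : ℝ) / (Nat.totient k : ℝ) ≤
      ((10000 * (∑ d ∈ k.divisors, d) / Nat.totient k + 1 : ℕ) : ℝ) / 10000 := by
    intro k hk
    have hk1 := (mem_Icc.mp (mem_filter.mp hk).1).1
    have hφ : 0 < Nat.totient k := Nat.totient_pos.mpr hk1
    have hlt := Nat.lt_mul_div_succ (10000 * ∑ d ∈ k.divisors, d) hφ
    rw [div_le_div_iff₀ (by exact_mod_cast hφ) (by norm_num)]
    have : (10000 * ∑ d ∈ k.divisors, d) ≤
      (10000 * (∑ d ∈ k.divisors, d) / Nat.totient k + 1) * Nat.totient k := by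
      rw [mul_comm]; rw [mul_comm] at hlt; linarith
    have h' : ((10000 * ∑ d ∈ k.divisors, d : ℕ) : ℝ) ≤
      (((10000 * (∑ d ∈ k.divisors, d) / Nat.totient k + 1) * Nat.totient k : ℕ) : ℝ) := by
      exact_mod_cast this
    rw [Nat.cast_mul, Nat.cast_mul] at h'
    linarith
  have hcast : ((∑ k ∈ (Icc 1 b).filter (fun k => Nat.gcd k 6 = 1),
      (10000 * (∑ d ∈ k.divisors, d) / Nat.totient k + 1) : ℕ) : ℝ) ≤ ((5300 * a : ℕ) : ℝ) := by
    exact_mod_cast h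
  rw [Nat.cast_sum, Nat.cast_mul] at hcast
  have haQ' : (a : ℝ) ≤ Q := by exact_mod_cast haQ
  calc _ ≤ _ := sum_le_sum_of_subset_of_nonneg hsub fun _ _ _ => by positivity
    _ ≤ _ := sum_le_sum hterm
    _ ≤ 0.53 * Q := by
      rw [← sum_div, div_le_iff₀ (by norm_num)]
      norm_num at hcast ⊢
      linarith

theorem sum_sigma_div_totient_le {Q : ℕ} (hQ : 11 ≤ Q) :
    ∑ k ∈ sieveModuli Q, ((∑ d ∈ k.divisors, d : ℕ) : ℝ) / (Nat.totient k : ℝ) ≤ 0.53 * Q := by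
  by_cases h395 : 395 ≤ Q
  · exact sum_sigma_div_totient_le_of_large h395
  set checkpoints : List (ℕ × ℕ) := [(11, 12), (13, 16), (17, 22), (23, 30), (31, 40), (41, 52),
    (53, 66), (67, 84), (85, 108), (109, 142), (143, 184), (185, 238), (239, 306), (307, 394)]
    with hcp
  have hcover : ∀ Q < 395, 11 ≤ Q → ∃ x ∈ checkpoints, x.1 ≤ Q ∧ Q ≤ x.2 := by
    decide +kernel
  have hcheck : ∀ x ∈ checkpoints, ∑ k ∈ (Icc 1 x.2).filter (fun k => Nat.gcd k 6 = 1),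
      (10000 * (∑ d ∈ k.divisors, d) / Nat.totient k + 1) ≤ 5300 * x.1 := by
    decide +kernel
  obtain ⟨x, hx, hxQ, hQx⟩ := hcover Q (by omega) hQ
  exact sum_sigma_div_totient_le_of_check hxQ hQx (hcheck x hx)

/-- The set `A` avoids some residue class modulo `p`. -/
def MissesClass (A : Finset ℕ) (p : ℕ) : Prop :=
  ∃ c : ℕ, ∀ k ∈ A, ¬ k ≡ c [MOD p]

theorem MissesClass.mono {A A' : Finset ℕ} {p : ℕ} (h : MissesClass A p) (hA : A' ⊆ A) :
    MissesClass A' p :=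
  h.imp fun _ hc k hk => hc k (hA hk)

/-- Passing to the largest fibre of `A` modulo a prime `p` for which `A` misses a class. -/
theorem MissesClass.exists_fiber {A : Finset ℕ} {p : ℕ} (hp : p.Prime) (h : MissesClass A p) :
    ∃ A' : Finset ℕ, #A ≤ (p - 1) * #A' ∧ (∀ j ∈ A', ∃ k ∈ A, p * j ≤ k) ∧
      ∀ l, l.Prime → l ≠ p → MissesClass A l → MissesClass A' l := by
  obtain ⟨c, hc⟩ := h
  obtain ⟨r, hr, hmax⟩ := exists_max_image (range p) (fun r => #(A.filter fun k => k % p = r))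
    ⟨0, mem_range.mpr hp.pos⟩
  have hrp := mem_range.mp hr
  refine ⟨(A.filter fun k => k % p = r).image (· / p), ?_, ?_, ?_⟩
  · have hcard : #((A.filter fun k => k % p = r).image (· / p)) =
        #(A.filter fun k => k % p = r) := by
      refine card_image_of_injOn fun a ha b hb hab => ?_
      have ha' := (mem_filter.mp ha).2
      have hb' := (mem_filter.mp hb).2
      have hab' : a / p = b / p := hab
      rw [← Nat.div_add_mod a p, ← Nat.div_add_mod b p, ha', hb', hab']
    have hmaps : ∀ k ∈ A, k % p ∈ (range p).erase (c % p) := fun k hk =>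
      mem_erase.mpr ⟨hc k hk, mem_range.mpr (Nat.mod_lt _ hp.pos)⟩
    rw [hcard, card_eq_sum_card_fiberwise hmaps]
    refine (sum_le_card_nsmul _ _ _ fun x hx => hmax x (mem_of_mem_erase hx)).trans ?_
    rw [card_erase_of_mem (mem_range.mpr (Nat.mod_lt _ hp.pos)), card_range, smul_eq_mul]
  · intro j hj
    obtain ⟨k, hk, rfl⟩ := mem_image.mp hj
    exact ⟨k, (mem_filter.mp hk).1, Nat.mul_div_le k p⟩
  · rintro l hl hlp ⟨d, hd⟩
    obtain ⟨x, hxr, hxd⟩ := Nat.chineseRemainder ((Nat.coprime_primes hp hl).mpr hlp.symm) r d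
    refine ⟨x / p, fun j hj hjx => ?_⟩
    obtain ⟨k, hk, rfl⟩ := mem_image.mp hj
    obtain ⟨hkA, hkr⟩ := mem_filter.mp hk
    refine hd k hkA (Nat.ModEq.trans ?_ hxd)
    have hxr' : x % p = r := by rw [hxr, Nat.mod_eq_of_lt hrp]
    rw [← Nat.div_add_mod k p, ← Nat.div_add_mod x p, hkr, hxr']
    exact (hjx.mul_left p).add_right r

theorem MissesClass.exists_fiber_of_lt {A : Finset ℕ} {p : ℕ} {L : ℝ} (hp : p.Prime)
    (h : MissesClass A p) (hA : ∀ k ∈ A, (k : ℝ) < L) :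
    ∃ A' : Finset ℕ, (#A : ℝ) ≤ ((p : ℝ) - 1) * #A' ∧ (∀ j ∈ A', (j : ℝ) < L / p) ∧
      ∀ l, l.Prime → l ≠ p → MissesClass A l → MissesClass A' l := by
  obtain ⟨A', h1, h2, h3⟩ := h.exists_fiber hp
  refine ⟨A', ?_, fun j hj => ?_, h3⟩
  · have h1' : (#A : ℝ) ≤ (((p - 1) * #A' : ℕ) : ℝ) := by exact_mod_cast h1
    rwa [Nat.cast_mul, Nat.cast_sub hp.one_lt.le, Nat.cast_one] at h1'
  · obtain ⟨k, hk, hjk⟩ := h2 j hj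
    have hjk' : (p : ℝ) * j ≤ k := by exact_mod_cast hjk
    rw [lt_div_iff₀ (by exact_mod_cast hp.pos)]
    linarith [hA k hk]

theorem subset_range_ceil {A : Finset ℕ} {x : ℝ} (hA : ∀ k ∈ A, (k : ℝ) < x) :
    A ⊆ range ⌈x⌉₊ := fun k hk => mem_range.mpr (Nat.lt_ceil.mpr (hA k hk))

theorem card_le_add_one {A : Finset ℕ} {x : ℝ} (hx : 0 ≤ x) (hA : ∀ k ∈ A, (k : ℝ) < x) :
    (#A : ℝ) ≤ x + 1 := by
  have h : #A ≤ ⌈x⌉₊ := by simpa using card_le_card (subset_range_ceil hA)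
  have h' : (#A : ℝ) ≤ (⌈x⌉₊ : ℝ) := by exact_mod_cast h
  linarith [Nat.ceil_lt_add_one hx]

theorem log_le_tangent {x : ℝ} (hx : 0 < x) (k : ℕ) :
    Real.log x ≤ k - 1 + x / 2.7182 ^ k := by
  have h := Real.log_le_sub_one_of_pos (div_pos hx (Real.exp_pos k))
  rw [Real.log_div hx.ne' (Real.exp_pos _).ne', Real.log_exp] at h
  have he : (2.7182 : ℝ) ^ k ≤ Real.exp k := by
    rw [← Real.exp_one_pow]
    exact pow_le_pow_left₀ (by norm_num) (by linarith [Real.exp_one_gt_d9]) k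
  have : x / Real.exp k ≤ x / 2.7182 ^ k := by gcongr
  linarith

theorem card_le_of_missesClass_of_le {A : Finset ℕ} {L : ℝ} (hL : 3 ≤ L) (hL' : L ≤ 1296)
    (hA : ∀ k ∈ A, (k : ℝ) < L) (hm : ∀ p : ℕ, p.Prime → (p : ℝ) ≤ L → MissesClass A p) :
    (#A : ℝ) ≤ 2 * L / Real.log L := by
  have hlog : 0 < Real.log L := Real.log_pos (by linarith)
  have key : ∀ {b : ℝ} (k : ℕ), (#A : ℝ) ≤ b → b * (k - 1 + L / 2.7182 ^ k) ≤ 2 * L →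
      (#A : ℝ) ≤ 2 * L / Real.log L := by
    intro b k hb hk
    rw [le_div_iff₀ hlog]
    have hb0 : 0 ≤ b := (Nat.cast_nonneg _).trans hb
    calc (#A : ℝ) * Real.log L ≤ b * (k - 1 + L / 2.7182 ^ k) :=
          mul_le_mul hb (log_le_tangent (by linarith) k) hlog.le hb0
      _ ≤ 2 * L := hk
  obtain ⟨A₂, h2, h2L, h2m⟩ :=
    (hm 2 Nat.prime_two (by norm_num; linarith)).exists_fiber_of_lt Nat.prime_two hA
  rcases le_total L 35 with h35 | h35
  · have hb : (#A : ℝ) ≤ L / 2 + 1 := by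
      have := card_le_add_one (by positivity) h2L
      push_cast at h2 this
      linarith
    rcases le_total L 8.8 with h | h
    · refine key 1 hb ?_
      norm_num at *
      nlinarith [mul_nonneg (sub_nonneg.mpr hL) (sub_nonneg.mpr h)]
    rcases le_total L 19 with h' | h'
    · refine key 2 hb ?_
      norm_num at *
      nlinarith [mul_nonneg (sub_nonneg.mpr h) (sub_nonneg.mpr h')]
    · refine key 3 hb ?_
      norm_num at *
      nlinarith [mul_nonneg (sub_nonneg.mpr h') (sub_nonneg.mpr h35)]
  obtain ⟨A₃, h3, h3L, h3m⟩ := (h2m 3 Nat.prime_three (by norm_num)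
    (hm 3 Nat.prime_three (by norm_num; linarith))).exists_fiber_of_lt Nat.prime_three h2L
  rcases le_total L 270 with h270 | h270
  · have hb : (#A : ℝ) ≤ L / 3 + 2 := by
      have := card_le_add_one (by positivity) h3L
      push_cast at h2 h3 this
      linarith
    rcases le_total L 145 with h | h
    · refine key 4 hb ?_
      norm_num at *
      nlinarith [mul_nonneg (sub_nonneg.mpr h35) (sub_nonneg.mpr h)]
    · refine key 5 hb ?_
      norm_num at *
      nlinarith [mul_nonneg (sub_nonneg.mpr h) (sub_nonneg.mpr h270)]
  obtain ⟨A₅, h5, h5L, -⟩ := (h3m 5 Nat.prime_five (by norm_num) (h2m 5 Nat.prime_five (by norm_num)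
    (hm 5 Nat.prime_five (by norm_num; linarith)))).exists_fiber_of_lt Nat.prime_five h3L
  have hb : (#A : ℝ) ≤ 8 * (L / 30 + 1) := by
    have := card_le_add_one (by positivity) h5L
    push_cast at h2 h3 h5 this
    linarith
  rcases le_total L 850 with h | h
  · refine key 6 hb ?_
    norm_num at *
    nlinarith [mul_nonneg (sub_nonneg.mpr h270) (sub_nonneg.mpr h)]
  · refine key 7 hb ?_
    norm_num at *
    nlinarith [mul_nonneg (sub_nonneg.mpr h) (sub_nonneg.mpr hL')]

/-- Selberg's bound for a set avoiding a class modulo every prime in `[5, Q]`. -/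
theorem card_le_of_missesClass_primes {A : Finset ℕ} {x : ℝ} {Q : ℕ} (hx : 0 ≤ x) (hQ : 12 ≤ Q)
    (hA : ∀ k ∈ A, (k : ℝ) < x)
    (hm : ∀ p : ℕ, p.Prime → 5 ≤ p → p ≤ Q → MissesClass A p) :
    (#A : ℝ) ≤ (x + 1) / (Real.log (5.4 * (Q + 1)) / 3) +
      (0.53 * Q / (Real.log (5.4 * (Q + 1)) / 3)) ^ 2 := by
  have hm' : ∀ p : ℕ, ∃ c : ℕ, p.Prime → 5 ≤ p → p ≤ Q → ∀ k ∈ A, ¬ k ≡ c [MOD p] := by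
    intro p
    by_cases h : p.Prime ∧ 5 ≤ p ∧ p ≤ Q
    · obtain ⟨c, hc⟩ := hm p h.1 h.2.1 h.2.2
      exact ⟨c, fun _ _ _ => hc⟩
    · exact ⟨0, fun h1 h2 h3 => absurd ⟨h1, h2, h3⟩ h⟩
  choose c hc using hm'
  obtain ⟨z, hz⟩ := Nat.chineseRemainderOfFinset c id ((Icc 5 Q).filter Nat.Prime)
    (fun p hp => (mem_filter.mp hp).2.ne_zero)
    (fun p hp p' hp' hne => (Nat.coprime_primes (mem_filter.mp hp).2 (mem_filter.mp hp').2).mpr hne)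
  have hsieve : ∀ j ∈ A, ∀ d ∈ sieveModuli Q, (d : ℤ) ∣ (j : ℤ) - (z : ℤ) → d = 1 := by
    intro j hj d hd hdvd
    by_contra hd1
    obtain ⟨p, hp, hpd⟩ := Nat.exists_prime_and_dvd hd1
    obtain ⟨⟨hd0, hdQ⟩, -, hd6⟩ := mem_sieveModuli.mp hd
    have hp6 := (coprime_six_iff p).mp (hd6.coprime_dvd_left hpd)
    have hpQ := (Nat.le_of_dvd hd0 hpd).trans hdQ
    have hp5 : 5 ≤ p := by have := hp.one_lt; omega
    have hzp : z ≡ c p [MOD p] := hz p (mem_filter.mpr ⟨mem_Icc.mpr ⟨hp5, hpQ⟩, hp⟩)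
    refine hc p hp hp5 hpQ j hj (Nat.ModEq.trans ?_ hzp)
    exact (Nat.modEq_iff_dvd.mpr (dvd_trans (Int.natCast_dvd_natCast.mpr hpd) hdvd)).symm
  have h := card_le_of_selberg (D := sieveModuli Q) (fun k hk => (mem_sieveModuli.mp hk).2.1)
    (fun k hk d hd => mem_sieveModuli_of_dvd hk hd)
    (mem_sieveModuli.mpr ⟨⟨le_rfl, by omega⟩, squarefree_one, Nat.coprime_one_left 6⟩)
    (subset_range_ceil hA) z hsieve
  have hS : Real.log (5.4 * (Q + 1)) / 3 ≤ ∑ k ∈ sieveModuli Q, 1 / (Nat.totient k : ℝ) := by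
    linarith [log_le_coprimeHarmonic hQ, coprimeHarmonic_le_sum_inv_totient Q]
  have hlog : 0 < Real.log (5.4 * (Q + 1)) / 3 := by
    have : (0 : ℝ) ≤ Q := Nat.cast_nonneg _
    exact div_pos (Real.log_pos (by linarith)) (by norm_num)
  have hT := sum_sigma_div_totient_le (Q := Q) (by omega)
  refine h.trans (add_le_add ?_ ?_)
  · exact div_le_div₀ (by linarith) (Nat.ceil_lt_add_one hx).le hlog hS
  · exact pow_le_pow_left₀ (div_nonneg (sum_nonneg fun _ _ => by positivity) (hlog.trans_le hS).le)
      (div_le_div₀ (by positivity) hT hlog hS) 2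

theorem seven_twelfths_le_log : 7 / 12 ≤ Real.log 1.8 := by
  rw [Real.le_log_iff_exp_le (by norm_num)]
  refine le_of_pow_le_pow_left₀ (n := 12) (by norm_num) (by norm_num) ?_
  rw [← Real.exp_nat_mul]
  have : ((12 : ℕ) : ℝ) * (7 / 12) = (7 : ℕ) * 1 := by norm_num
  rw [this, Real.exp_nat_mul]
  calc Real.exp 1 ^ 7 ≤ 2.7182818286 ^ 7 :=
        pow_le_pow_left₀ (Real.exp_pos 1).le Real.exp_one_lt_d9.le 7
    _ ≤ 1.8 ^ 12 := by norm_num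

theorem card_le_of_missesClass_of_large {A : Finset ℕ} {L : ℝ} (hL : 1296 ≤ L)
    (hA : ∀ k ∈ A, (k : ℝ) < L) (hm : ∀ p : ℕ, p.Prime → (p : ℝ) ≤ L → MissesClass A p) :
    (#A : ℝ) ≤ 2 * L / Real.log L := by
  obtain ⟨A₂, h2, h2L, h2m⟩ :=
    (hm 2 Nat.prime_two (by norm_num; linarith)).exists_fiber_of_lt Nat.prime_two hA
  obtain ⟨A₃, h3, h3L, h3m⟩ := (h2m 3 Nat.prime_three (by norm_num)
    (hm 3 Nat.prime_three (by norm_num; linarith))).exists_fiber_of_lt Nat.prime_three h2L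
  set s := √L with hs
  have hs2 : s ^ 2 = L := Real.sq_sqrt (by linarith)
  have hs36 : 36 ≤ s := Real.le_sqrt_of_sq_le (by linarith)
  set Q := ⌊s / 3⌋₊ with hQdef
  have hQ12 : 12 ≤ Q := Nat.le_floor (by norm_num; linarith)
  have hQs : (Q : ℝ) ≤ s / 3 := Nat.floor_le (by linarith)
  have hQs' : s / 3 < Q + 1 := Nat.lt_floor_add_one _
  have hbound := card_le_of_missesClass_primes (x := L / (2 : ℕ) / (3 : ℕ)) (by positivity) hQ12
    h3L fun p hp hp5 hpQ => h3m p hp (by omega) (h2m p hp (by omega) (hm p hp (by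
      have : (p : ℝ) ≤ Q := by exact_mod_cast hpQ
      nlinarith)))
  set Λ := Real.log (1.8 * s) with hΛ
  have hΛlog : Λ = Real.log 1.8 + Real.log L / 2 := by
    rw [hΛ, Real.log_mul (by norm_num) (by linarith), hs, Real.log_sqrt (by linarith)]
  have hν := seven_twelfths_le_log
  have hν' := Real.log_le_sub_one_of_pos (x := 1.8) (by norm_num)
  have hlog : 0 < Real.log L := Real.log_pos (by linarith)
  have hΛ0 : 0 < Λ := by rw [hΛlog]; linarith
  have hΛQ : Λ ≤ Real.log (5.4 * (Q + 1)) := Real.log_le_log (by linarith) (by linarith)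
  have hA₃ : (#A₃ : ℝ) ≤ (L / 6 + 1) / (Λ / 3) + (0.53 * (s / 3) / (Λ / 3)) ^ 2 := by
    refine hbound.trans ?_
    have : L / (2 : ℕ) / (3 : ℕ) = L / 6 := by push_cast; ring
    rw [this]
    have : 0 < Real.log (5.4 * (Q + 1)) := hΛ0.trans_le hΛQ
    gcongr
  have hA : (#A : ℝ) ≤ (L + 6) / Λ + 0.5618 * L / Λ ^ 2 := by
    have heq : 2 * ((L / 6 + 1) / (Λ / 3) + (0.53 * (s / 3) / (Λ / 3)) ^ 2) =
        (L + 6) / Λ + 0.5618 * L / Λ ^ 2 := by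
      rw [← hs2]
      field_simp
      ring
    push_cast at h2 h3
    linarith
  have htan := log_le_tangent (x := L) (by linarith) 7
  have hsmall : 6 * Λ + 0.5618 * L ≤ Real.log 1.8 * L := by
    have : 7 / 12 * L ≤ Real.log 1.8 * L := by gcongr
    norm_num at *
    linarith
  refine hA.trans ?_
  rw [div_add_div _ _ (by positivity) (by positivity), div_le_div_iff₀ (by positivity) hlog]
  have hlog' : Real.log L = 2 * (Λ - Real.log 1.8) := by linarith
  rw [hlog']
  have h1 : 0 ≤ Λ ^ 2 * (Real.log 1.8 * L - (6 * Λ + 0.5618 * L)) :=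
    mul_nonneg (by positivity) (by linarith)
  have h2 : 0 ≤ Λ * Real.log 1.8 * (6 * Λ + 0.5618 * L) := by
    have : 0 ≤ Real.log 1.8 := by linarith
    positivity
  nlinarith

/-- A set of integers in `[0, L)` missing a class modulo every prime up to `L` has at most
`2L / log L` elements. -/
theorem card_le_of_missesClass {A : Finset ℕ} {L : ℝ} (hL : 3 ≤ L)
    (hA : ∀ k ∈ A, (k : ℝ) < L) (hm : ∀ p : ℕ, p.Prime → (p : ℝ) ≤ L → MissesClass A p) :
    (#A : ℝ) ≤ 2 * L / Real.log L :=
  (le_total L 1296).elim (fun h => card_le_of_missesClass_of_le hL h hA hm)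
    fun h => card_le_of_missesClass_of_large h hA hm

theorem exists_subset_missesClass (A s : Finset ℕ) (hs : ∀ p ∈ s, 0 < p) :
    ∃ A' ⊆ A, (#A : ℝ) * ∏ p ∈ s, (1 - (p : ℝ)⁻¹) ≤ #A' ∧ ∀ p ∈ s, MissesClass A' p := by
  induction s using Finset.induction_on with
  | empty => exact ⟨A, subset_rfl, by simp, by simp⟩
  | insert p s hps ih =>
    obtain ⟨A₁, h1, h2, h3⟩ := ih fun l hl => hs l (mem_insert_of_mem hl)
    have hp := hs p (mem_insert_self p s)
    have hp1 : (1 : ℝ) ≤ p := by exact_mod_cast hp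
    obtain ⟨c, hc, hcard⟩ := exists_card_fiber_le_of_card_le_nsmul (s := A₁) (t := range p)
      (f := (· % p)) (b := (#A₁ : ℝ) / p) ⟨0, mem_range.mpr hp⟩
      (by rw [card_range, nsmul_eq_mul]; field_simp; rfl)
    refine ⟨A₁.filter fun k => ¬ k % p = c, (filter_subset _ _).trans h1, ?_, ?_⟩
    · have hsplit := card_filter_add_card_filter_not (s := A₁) (fun k => k % p = c)
      have hsplit' : (#(A₁.filter fun k => k % p = c) : ℝ) +
          #(A₁.filter fun k => ¬ k % p = c) = #A₁ := by exact_mod_cast hsplit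
      have hp' : 0 ≤ 1 - (p : ℝ)⁻¹ := sub_nonneg.mpr (inv_le_one_of_one_le₀ hp1)
      rw [prod_insert hps]
      calc (#A : ℝ) * ((1 - (p : ℝ)⁻¹) * ∏ p ∈ s, (1 - (p : ℝ)⁻¹))
          = (1 - (p : ℝ)⁻¹) * (#A * ∏ p ∈ s, (1 - (p : ℝ)⁻¹)) := by ring
        _ ≤ (1 - (p : ℝ)⁻¹) * #A₁ := by gcongr
        _ = #A₁ - #A₁ / p := by ring
        _ ≤ _ := by linarith
    · intro l hl
      rcases mem_insert.mp hl with rfl | hl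
      · refine ⟨c, fun k hk hkc => (mem_filter.mp hk).2 ?_⟩
        rw [hkc, Nat.mod_eq_of_lt (mem_range.mp hc)]
      · exact (h3 l hl).mono (filter_subset _ _)

/-- The Brun–Titchmarsh inequality for the primes `a + kq` with `0 ≤ k < L`. -/
theorem card_primes_progression_le {q a : ℕ} (hq : 1 ≤ q) {L : ℝ} (hL : 3 ≤ L) (ha : L < a)
    {A : Finset ℕ} (hA : ∀ k ∈ A, (k : ℝ) < L) (hprime : ∀ k ∈ A, (a + k * q).Prime) :
    (#A : ℝ) ≤ (q : ℝ) / (Nat.totient q : ℝ) * (2 * L / Real.log L) := by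
  obtain ⟨A', hsub, hcard, hmiss⟩ := exists_subset_missesClass A q.primeFactors
    fun p hp => (Nat.prime_of_mem_primeFactors hp).pos
  have hA' := card_le_of_missesClass hL (fun k hk => hA k (hsub hk)) fun l hl hlL => by
    by_cases hlq : l ∣ q
    · exact hmiss l (Nat.mem_primeFactors.mpr ⟨hl, hlq, by omega⟩)
    have hcop : Nat.Coprime q l := ((Nat.Prime.coprime_iff_not_dvd hl).mpr hlq).symm
    obtain ⟨c, hc⟩ : ∃ c, l ∣ a + c * q := by
      obtain ⟨x, hxa, hx0⟩ := Nat.chineseRemainder hcop a 0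
      have hle : a ≤ x + a * (q * l) :=
        (Nat.le_mul_of_pos_right a (Nat.mul_pos hq hl.pos)).trans (Nat.le_add_left _ _)
      have hmod : a ≡ x + a * (q * l) [MOD q] := by
        refine hxa.symm.trans ((Nat.modEq_iff_dvd' (Nat.le_add_right _ _)).mpr ?_)
        rw [Nat.add_sub_cancel_left]
        exact ⟨a * l, by ring⟩
      obtain ⟨c, hc⟩ := (Nat.modEq_iff_dvd' hle).mp hmod
      refine ⟨c, ?_⟩
      have : a + c * q = x + a * (q * l) := by rw [mul_comm c q]; omega
      rw [this]
      exact dvd_add ((Nat.modEq_zero_iff_dvd).mp hx0) ⟨a * q, by ring⟩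
    refine ⟨c, fun k hk hkc => ?_⟩
    have hdvd : l ∣ a + k * q :=
      (Nat.modEq_zero_iff_dvd).mp (((hkc.mul_right q).add_left a).trans
        (Nat.modEq_zero_iff_dvd.mpr hc))
    have heq := (Nat.prime_dvd_prime_iff_eq hl (hprime k (hsub hk))).mp hdvd
    have : (a : ℝ) ≤ l := by exact_mod_cast heq ▸ Nat.le_add_right a (k * q)
    linarith
  have hφ : (0 : ℝ) < Nat.totient q := by exact_mod_cast Nat.totient_pos.mpr hq
  have hq0 : (0 : ℝ) < q := by exact_mod_cast hq
  have htot := totient_eq_cast_mul_prod q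
  rw [div_mul_eq_mul_div, le_div_iff₀ hφ, htot]
  calc (#A : ℝ) * (q * ∏ p ∈ q.primeFactors, (1 - (p : ℝ)⁻¹))
      = q * (#A * ∏ p ∈ q.primeFactors, (1 - (p : ℝ)⁻¹)) := by ring
    _ ≤ q * #A' := by gcongr
    _ ≤ _ := by gcongr

/-- The number of primes `x < n` with `M < x` and `x ≡ n (mod q)`. -/
noncomputable def primeRank (q : ℕ) (M : ℝ) (n : ℕ) : ℕ :=
  #((range n).filter fun x : ℕ => x.Prime ∧ M < (x : ℝ) ∧ x % q = n % q)

/-- Distinct congruent primes whose ranks agree modulo `K` are at least `Lq` apart. -/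
theorem le_sub_of_primeRank_modEq {q K p p' : ℕ} (hq : 1 ≤ q) {M L : ℝ} (hL : 3 ≤ L)
    (hLM : L ≤ M) (hK : (q : ℝ) / (Nat.totient q : ℝ) * (2 * L / Real.log L) ≤ K)
    (hp : p.Prime) (hp' : p'.Prime) (hMp : M < p) (hlt : p < p') (hmod : p % q = p' % q)
    (hrank : primeRank q M p ≡ primeRank q M p' [MOD K]) :
    L * q ≤ (p' : ℝ) - p := by
  by_contra! hclose
  set S := (Ico p p').filter fun x : ℕ => x.Prime ∧ M < (x : ℝ) ∧ x % q = p % q with hS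
  have hsum : primeRank q M p' = primeRank q M p + #S := by
    rw [primeRank, primeRank, ← hmod, range_eq_Ico, range_eq_Ico,
      ← Ico_union_Ico_eq_Ico (Nat.zero_le p) hlt.le, filter_union, card_union_of_disjoint]
    exact disjoint_filter_filter (Ico_disjoint_Ico_consecutive 0 p p')
  have hpS : p ∈ S := mem_filter.mpr ⟨left_mem_Ico.mpr hlt, hp, hMp, rfl⟩
  have hKS : K ≤ #S := by
    refine Nat.le_of_dvd (card_pos.mpr ⟨p, hpS⟩) ?_
    have := (Nat.modEq_iff_dvd' (by omega)).mp hrank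
    rwa [hsum, Nat.add_sub_cancel_left] at this
  have hp'S : p' ∉ S := fun h => by simp [hS] at h
  have hmem : ∀ x ∈ insert p' S, x.Prime ∧ p ≤ x ∧ x ≤ p' ∧ p + (x - p) / q * q = x := by
    intro x hx
    have hx' : x.Prime ∧ p ≤ x ∧ x ≤ p' ∧ x % q = p % q := by
      rcases mem_insert.mp hx with rfl | hx
      · exact ⟨hp', hlt.le, le_rfl, hmod.symm⟩
      · obtain ⟨h1, h2, -, h3⟩ := mem_filter.mp hx
        exact ⟨h2, (mem_Ico.mp h1).1, (mem_Ico.mp h1).2.le, h3⟩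
    obtain ⟨h1, h2, h3, h4⟩ := hx'
    refine ⟨h1, h2, h3, ?_⟩
    have hdvd : q ∣ x - p := (Nat.modEq_iff_dvd' h2).mp h4.symm
    rw [Nat.div_mul_cancel hdvd]
    omega
  have hinj : Set.InjOn (fun x => (x - p) / q) (insert p' S : Finset ℕ) := by
    intro x hx y hy hxy
    have hxy' : (x - p) / q = (y - p) / q := hxy
    rw [← (hmem x hx).2.2.2, ← (hmem y hy).2.2.2, hxy']
  have hq0 : (0 : ℝ) < q := by exact_mod_cast hq
  have hbound := card_primes_progression_le (A := (insert p' S).image fun x => (x - p) / q) hq hL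
    (hLM.trans_lt hMp) (fun k hk => by
      obtain ⟨x, hx, rfl⟩ := mem_image.mp hk
      obtain ⟨-, -, h3, h4⟩ := hmem x hx
      have h5 : ((p + (x - p) / q * q : ℕ) : ℝ) ≤ p' := by rw [h4]; exact_mod_cast h3
      rw [Nat.cast_add, Nat.cast_mul] at h5
      exact lt_of_mul_lt_mul_right (by linarith) hq0.le)
    (fun k hk => by
      obtain ⟨x, hx, rfl⟩ := mem_image.mp hk
      rw [(hmem x hx).2.2.2]
      exact (hmem x hx).1)
  rw [card_image_of_injOn hinj, card_insert_of_notMem hp'S] at hbound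
  have hKS' : (K : ℝ) ≤ #S := by exact_mod_cast hKS
  push_cast at hbound
  linarith

/-- Lemma 5.2 (a): the primes in `(M, 2M]` can be partitioned into at most
`⌈B⌉` classes (encoded by a colouring `g` with values `< ⌈B⌉₊`), where
`B = (q/φ(q))·2L/log L`, such that distinct primes congruent mod `q` in a
class are separated by at least `Lq`. -/
theorem statement13 (q : ℕ) (hq : 1 ≤ q) (M L : ℝ) (hM : 2 ≤ M)
    (hL : 3 ≤ L) (hLM : L ≤ M / q) :
    ∃ g : ℕ → ℕ,
      (∀ p : ℕ, p.Prime → M < (p : ℝ) → (p : ℝ) ≤ 2 * M →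
        g p < ⌈(q : ℝ) / (Nat.totient q : ℝ) * (2 * L / Real.log L)⌉₊) ∧
      ∀ p p' : ℕ, p.Prime → p'.Prime →
        M < (p : ℝ) → (p : ℝ) ≤ 2 * M → M < (p' : ℝ) → (p' : ℝ) ≤ 2 * M →
        g p = g p' → p % q = p' % q → p ≠ p' →
        L * q ≤ |(p : ℝ) - (p' : ℝ)| := by
  set B := (q : ℝ) / (Nat.totient q : ℝ) * (2 * L / Real.log L) with hB
  have hq1 : (1 : ℝ) ≤ q := by exact_mod_cast hq
  have hLM' : L ≤ M := hLM.trans (div_le_self (by linarith) hq1)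
  have hB0 : 0 < B := by
    have hφ : (0 : ℝ) < Nat.totient q := by exact_mod_cast Nat.totient_pos.mpr hq
    have hlog : 0 < Real.log L := Real.log_pos (by linarith)
    positivity
  refine ⟨fun p => primeRank q M p % ⌈B⌉₊, fun p _ _ _ => Nat.mod_lt _ (Nat.ceil_pos.mpr hB0), ?_⟩
  intro p p' hp hp' hMp _ hMp' _ hg hmod hne
  rcases lt_or_gt_of_ne hne with hlt | hlt
  · rw [abs_sub_comm]
    exact (le_sub_of_primeRank_modEq hq hL hLM' (Nat.le_ceil B) hp hp' hMp hlt hmod hg).trans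
      (le_abs_self _)
  · exact (le_sub_of_primeRank_modEq hq hL hLM' (Nat.le_ceil B) hp' hp hMp' hlt hmod.symm
      hg.symm).trans (le_abs_self _)
end

section
/- Let q ≥ 1, R > 1, and let λ be the Selberg sieve weights λ(d) = (d μ(d)/φ(d)) · G_{qd}(R/d)/G_q(R) for d ≤ R with gcd(d,q) = 1, and λ(d) = 0 otherwise. Then for every positive integer r: Σ_{d ≡ 0 (mod r)} λ(d)/d = μ(r)/(φ(r) · G_q(R)) if r ≤ R and gcd(r,q) = 1, and Σ_{d ≡ 0 (mod r)} λ(d)/d = 0 otherwise. -/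
open Finset

/-- The sum of `μ(d)` over `r ∣ d ∣ n` is `μ(r)` if `n = r` and vanishes otherwise, for squarefree
`n`. -/
theorem sum_moebius_filter_dvd_divisors {r n : ℕ} (hr : r ≠ 0) (hn : Squarefree n) :
    ∑ d ∈ n.divisors with r ∣ d, ArithmeticFunction.moebius d =
      if n = r then ArithmeticFunction.moebius r else 0 := by
  by_cases hrn : r ∣ n
  · obtain ⟨m, rfl⟩ := hrn
    have hcop : Nat.Coprime r m := Nat.coprime_of_squarefree_mul hn
    have hm : m ≠ 0 := fun h => hn.ne_zero (by simp [h])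
    have himage : {d ∈ (r * m).divisors | r ∣ d} = m.divisors.image (r * ·) := by
      ext d
      simp only [mem_filter, Nat.mem_divisors, mem_image]
      constructor
      · rintro ⟨⟨hd, -⟩, e, rfl⟩
        exact ⟨e, ⟨(Nat.mul_dvd_mul_iff_left (Nat.pos_of_ne_zero hr)).1 hd, hm⟩, rfl⟩
      · rintro ⟨e, ⟨he, -⟩, rfl⟩
        exact ⟨⟨Nat.mul_dvd_mul_left r he, hn.ne_zero⟩, dvd_mul_right r e⟩
    have hone : ∑ e ∈ m.divisors, ArithmeticFunction.moebius e = if m = 1 then 1 else 0 := by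
      rw [← ArithmeticFunction.coe_mul_zeta_apply, ArithmeticFunction.moebius_mul_coe_zeta,
        ArithmeticFunction.one_apply]
    rw [himage, sum_image fun a _ b _ h => Nat.eq_of_mul_eq_mul_left (Nat.pos_of_ne_zero hr) h]
    have hmul : ∀ e ∈ m.divisors, ArithmeticFunction.moebius (r * e) =
        ArithmeticFunction.moebius r * ArithmeticFunction.moebius e := fun e he =>
      ArithmeticFunction.isMultiplicative_moebius.map_mul_of_coprime
        (hcop.coprime_dvd_right (Nat.dvd_of_mem_divisors he))
    rw [sum_congr rfl hmul, ← mul_sum, hone]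
    have : r * m = r ↔ m = 1 := by simp [hr]
    simp [this]
  · rw [if_neg fun h => hrn h.symm.dvd]
    refine sum_eq_zero fun d hd => ?_
    simp only [mem_filter, Nat.mem_divisors] at hd
    exact absurd (hd.2.trans hd.1.1) hrn

/-- The summand `μ(n)²/φ(n)` of `G_q`, extended by zero to `n` not coprime to `q`. -/
noncomputable def gTerm (q n : ℕ) : ℝ :=
  if Nat.gcd n q = 1 then ((ArithmeticFunction.moebius n : ℤ) : ℝ) ^ 2 / (Nat.totient n : ℝ)
  else 0

theorem gTerm_eq_zero_of_not_squarefree {q n : ℕ} (hn : ¬ Squarefree n) : gTerm q n = 0 := by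
  simp [gTerm, ArithmeticFunction.moebius_eq_zero_of_not_squarefree hn]

theorem gTerm_mul {q d m : ℕ} (hd : Squarefree d) (hdq : Nat.gcd d q = 1) :
    gTerm q (d * m) = gTerm (q * d) m / Nat.totient d := by
  by_cases hcop : Nat.Coprime d m
  · have hgcd : Nat.gcd (d * m) q = 1 ↔ Nat.gcd m (q * d) = 1 := by
      change Nat.Coprime _ _ ↔ Nat.Coprime _ _
      rw [Nat.coprime_mul_iff_left, Nat.coprime_mul_iff_right]
      exact ⟨fun h => ⟨h.2, hcop.symm⟩, fun h => ⟨hdq, h.1⟩⟩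
    have hsq : ((ArithmeticFunction.moebius d : ℤ) : ℝ) ^ 2 = 1 := by
      exact_mod_cast ArithmeticFunction.moebius_sq_eq_one_of_squarefree hd
    simp only [gTerm, hgcd]
    split_ifs
    · rw [ArithmeticFunction.isMultiplicative_moebius.map_mul_of_coprime hcop,
        Nat.totient_mul hcop]
      push_cast
      rw [mul_pow, hsq, one_mul, div_div, mul_comm (Nat.totient d : ℝ)]
    · simp
  · rw [gTerm_eq_zero_of_not_squarefree fun h => hcop (Nat.coprime_of_squarefree_mul h), gTerm,
      if_neg, zero_div]
    exact fun h => hcop (Nat.Coprime.coprime_mul_left_right h).symm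

/-- Reindexing a sum over the multiples of `d` up to `R`. -/
theorem sum_filter_dvd_Icc_floor {M : Type*} [AddCommMonoid M] (f : ℕ → M) (R : ℝ) {d : ℕ}
    (hd : 0 < d) :
    ∑ n ∈ Icc 1 ⌊R⌋₊ with d ∣ n, f n = ∑ m ∈ Icc 1 ⌊R / d⌋₊, f (d * m) := by
  have himage : {n ∈ Icc 1 ⌊R⌋₊ | d ∣ n} = (Icc 1 ⌊R / d⌋₊).image (d * ·) := by
    ext n
    simp only [mem_filter, mem_Icc, mem_image, Nat.floor_div_natCast, Nat.le_div_iff_mul_le hd]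
    constructor
    · rintro ⟨⟨h1, h2⟩, m, rfl⟩
      exact ⟨m, ⟨Nat.pos_of_mul_pos_left h1, by rwa [mul_comm]⟩, rfl⟩
    · rintro ⟨m, ⟨h1, h2⟩, rfl⟩
      exact ⟨⟨Nat.mul_pos hd h1, by rwa [mul_comm]⟩, dvd_mul_right d m⟩
  rw [himage, sum_image fun a _ b _ h => Nat.eq_of_mul_eq_mul_left hd h]

theorem selbergLambda_div_eq_sum {q : ℕ} {R : ℝ} {d : ℕ} (hd : 0 < d) (hdR : (d : ℝ) ≤ R) :
    selbergLambda q R d / d =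
      (∑ n ∈ Icc 1 ⌊R⌋₊ with d ∣ n, ((ArithmeticFunction.moebius d : ℤ) : ℝ) * gTerm q n) /
        Gsum q R := by
  by_cases hdq : Nat.gcd d q = 1
  · by_cases hsq : Squarefree d
    · have hd0 : (d : ℝ) ≠ 0 := by positivity
      have hG : Gsum (q * d) (R / d) = ∑ m ∈ Icc 1 ⌊R / d⌋₊, gTerm (q * d) m := rfl
      rw [← mul_sum, sum_filter_dvd_Icc_floor _ _ hd, sum_congr rfl fun m _ => gTerm_mul hsq hdq,
        ← sum_div, ← hG, selbergLambda, if_pos ⟨hdR, hdq⟩]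
      field_simp
    · simp [selbergLambda, ArithmeticFunction.moebius_eq_zero_of_not_squarefree hsq]
  · rw [selbergLambda, if_neg fun h => hdq h.2, sum_eq_zero, zero_div, zero_div]
    intro n hn
    rw [gTerm, if_neg, mul_zero]
    exact fun h => hdq (Nat.Coprime.coprime_dvd_left (mem_filter.1 hn).2 h)

/-- Lemma 4.3 (a): `∑_{d ≡ 0 (mod r)} λ(d)/d = μ(r)/(φ(r) G_q(R))` if `r ≤ R`
and `(r,q) = 1`, and `0` otherwise. -/
theorem statement16 (q : ℕ) (hq : 1 ≤ q) (R : ℝ) (hR : 1 < R) (r : ℕ) (hr : 1 ≤ r) :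
    ∑ d ∈ (Finset.Icc 1 ⌊R⌋₊).filter (fun d => r ∣ d), selbergLambda q R d / d =
      if (r : ℝ) ≤ R ∧ Nat.gcd r q = 1 then
        ((ArithmeticFunction.moebius r : ℤ) : ℝ) / (Nat.totient r * Gsum q R)
      else 0 := by
  have hR0 : 0 ≤ R := by linarith
  have hinner : ∀ n ∈ Icc 1 ⌊R⌋₊,
      ∑ d ∈ n.divisors with r ∣ d, ((ArithmeticFunction.moebius d : ℤ) : ℝ) * gTerm q n =
        if n = r then ((ArithmeticFunction.moebius r : ℤ) : ℝ) * gTerm q r else 0 := by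
    intro n _
    by_cases hn : Squarefree n
    · rw [← sum_mul, ← Int.cast_sum, sum_moebius_filter_dvd_divisors (by omega) hn]
      split_ifs with h <;> simp [h]
    · rw [gTerm_eq_zero_of_not_squarefree hn]
      split_ifs with h
      · simp [gTerm_eq_zero_of_not_squarefree (h ▸ hn)]
      · simp
  have hswap : ∑ d ∈ Icc 1 ⌊R⌋₊ with r ∣ d, ∑ n ∈ Icc 1 ⌊R⌋₊ with d ∣ n,
        ((ArithmeticFunction.moebius d : ℤ) : ℝ) * gTerm q n =
      ∑ n ∈ Icc 1 ⌊R⌋₊, ∑ d ∈ n.divisors with r ∣ d,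
        ((ArithmeticFunction.moebius d : ℤ) : ℝ) * gTerm q n := by
    refine sum_comm' fun d n => ?_
    simp only [mem_filter, mem_Icc, Nat.mem_divisors]
    constructor
    · rintro ⟨⟨-, hrd⟩, hn, hdn⟩
      exact ⟨⟨⟨hdn, by omega⟩, hrd⟩, hn⟩
    · rintro ⟨⟨⟨hdn, -⟩, hrd⟩, hn⟩
      exact ⟨⟨⟨Nat.pos_of_dvd_of_pos hdn hn.1, (Nat.le_of_dvd hn.1 hdn).trans hn.2⟩, hrd⟩, hn, hdn⟩
  have hexpand : ∀ d ∈ {d ∈ Icc 1 ⌊R⌋₊ | r ∣ d}, selbergLambda q R d / d =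
      (∑ n ∈ Icc 1 ⌊R⌋₊ with d ∣ n, ((ArithmeticFunction.moebius d : ℤ) : ℝ) * gTerm q n) /
        Gsum q R := fun d hd => by
    obtain ⟨h1, h2⟩ := mem_Icc.1 (mem_filter.1 hd).1
    exact selbergLambda_div_eq_sum h1 ((Nat.le_floor_iff hR0).1 h2)
  rw [sum_congr rfl hexpand, ← sum_div, hswap, sum_congr rfl hinner, sum_ite_eq']
  simp only [mem_Icc, hr, true_and, Nat.le_floor_iff hR0, gTerm]
  by_cases hrR : (r : ℝ) ≤ R <;> by_cases hrq : Nat.gcd r q = 1 <;> simp only [hrR, hrq, and_self,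
    and_true, and_false, if_true, if_false, mul_zero, zero_div]
  have hcube : ((ArithmeticFunction.moebius r : ℤ) : ℝ) *
      ((ArithmeticFunction.moebius r : ℤ) : ℝ) ^ 2 = ((ArithmeticFunction.moebius r : ℤ) : ℝ) := by
    rcases ArithmeticFunction.moebius_eq_or r with h | h | h <;> simp [h]
  rw [← mul_div_assoc, hcube, div_div]
end

section
/- Let 0 < ρ < 1/8. There exists X₀(ρ) such that for all X ≥ X₀(ρ) and every squarefree positive integer v with v ≤ X^{1/ρ}: |Σ_{n ≤ X, gcd(n,v)=1} (μ(n)/n) log(X/n) − v/φ(v)| ≤ (v/φ(v)) · 1/log X. -/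
open Finset

/-- The sum `∑_{n ≤ X} (μ(n)/n) log(X/n)`. -/
noncomputable def moebiusLogSum (X : ℝ) : ℝ :=
  ∑ n ∈ Icc 1 ⌊X⌋₊, ((ArithmeticFunction.moebius n : ℤ) : ℝ) / n * Real.log (X / n)

open scoped Classical in
/-- The indicator of the integers all of whose prime factors divide `v`. -/
noncomputable def factoredIndicator (v : ℕ) : ArithmeticFunction ℤ :=
  ⟨fun n => if n ∈ Nat.factoredNumbers v.primeFactors then 1 else 0, by
    simp [Nat.mem_factoredNumbers]⟩

/-- The Möbius function restricted to the integers coprime to `v`. -/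
noncomputable def moebiusCoprime (v : ℕ) : ArithmeticFunction ℤ :=
  ⟨fun n => if Nat.gcd n v = 1 then ArithmeticFunction.moebius n else 0, by simp⟩

theorem factoredIndicator_isMultiplicative (v : ℕ) : (factoredIndicator v).IsMultiplicative := by
  rw [ArithmeticFunction.IsMultiplicative.iff_ne_zero]
  refine ⟨by simp [factoredIndicator, Nat.mem_factoredNumbers], ?_⟩
  intro m n hm hn _
  have : m * n ∈ Nat.factoredNumbers v.primeFactors ↔
      m ∈ Nat.factoredNumbers v.primeFactors ∧ n ∈ Nat.factoredNumbers v.primeFactors :=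
    ⟨fun h => ⟨Nat.mem_factoredNumbers_of_dvd h (Dvd.intro _ rfl),
      Nat.mem_factoredNumbers_of_dvd h (Dvd.intro_left _ rfl)⟩,
      fun h => Nat.mul_mem_factoredNumbers h.1 h.2⟩
  simp only [factoredIndicator, ArithmeticFunction.coe_mk, this]
  by_cases h1 : m ∈ Nat.factoredNumbers v.primeFactors <;>
    by_cases h2 : n ∈ Nat.factoredNumbers v.primeFactors <;> simp [h1, h2]

theorem moebiusCoprime_isMultiplicative (v : ℕ) : (moebiusCoprime v).IsMultiplicative := by
  rw [ArithmeticFunction.IsMultiplicative.iff_ne_zero]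
  refine ⟨by simp [moebiusCoprime], ?_⟩
  intro m n hm hn hmn
  have : (m * n).gcd v = 1 ↔ m.gcd v = 1 ∧ n.gcd v = 1 := Nat.coprime_mul_iff_left
  simp only [moebiusCoprime, ArithmeticFunction.coe_mk, this,
    ArithmeticFunction.isMultiplicative_moebius.map_mul_of_coprime hmn]
  by_cases h1 : m.gcd v = 1 <;> by_cases h2 : n.gcd v = 1 <;> simp [h1, h2]

theorem moebiusCoprime_eq_mul {v : ℕ} (hv : v ≠ 0) :
    moebiusCoprime v = ArithmeticFunction.moebius * factoredIndicator v := by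
  rw [ArithmeticFunction.IsMultiplicative.eq_iff_eq_on_prime_powers _
    (moebiusCoprime_isMultiplicative v) _
    (ArithmeticFunction.isMultiplicative_moebius.mul (factoredIndicator_isMultiplicative v))]
  intro p i hp
  have hind : ∀ j, p ^ j ∈ Nat.factoredNumbers v.primeFactors ↔ (j = 0 ∨ p ∣ v) := by
    intro j
    rcases Nat.eq_zero_or_pos j with rfl | hj
    · simp [Nat.mem_factoredNumbers]
    · rw [Nat.mem_factoredNumbers_iff_primeFactors_subset,
        Nat.primeFactors_prime_pow hj.ne' hp]
      simp [hp, hv, hj.ne', hp.ne_zero]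
  have hgcd : ∀ j, (p ^ j).gcd v = 1 ↔ (j = 0 ∨ ¬ p ∣ v) := by
    intro j
    rcases Nat.eq_zero_or_pos j with rfl | hj
    · simp
    · rw [← Nat.coprime_iff_gcd_eq_one, Nat.coprime_pow_left_iff hj, hp.coprime_iff_not_dvd]
      simp [hj.ne']
  rw [ArithmeticFunction.mul_apply, Nat.sum_divisorsAntidiagonal
    (f := fun a b => ArithmeticFunction.moebius a * factoredIndicator v b),
    Nat.sum_divisors_prime_pow hp]
  have hdiv : ∀ k ∈ range (i + 1), ArithmeticFunction.moebius (p ^ k) *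
      factoredIndicator v (p ^ i / p ^ k) = ArithmeticFunction.moebius (p ^ k) *
      (if i - k = 0 ∨ p ∣ v then 1 else 0) := by
    intro k hk
    rw [Nat.pow_div (Nat.lt_succ_iff.1 (mem_range.1 hk)) hp.pos]
    simp [factoredIndicator, hind]
  rw [sum_congr rfl hdiv]
  have hmu : ∀ k, ArithmeticFunction.moebius (p ^ (k + 2)) = 0 := fun k => by
    rw [ArithmeticFunction.moebius_apply_prime_pow hp (by omega)]; simp
  have hmu1 : ArithmeticFunction.moebius p = -1 := ArithmeticFunction.moebius_apply_prime hp
  simp only [moebiusCoprime, ArithmeticFunction.coe_mk, hgcd]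
  match i with
  | 0 => simp
  | 1 => 
    rw [sum_range_succ, sum_range_one]
    by_cases h : p ∣ v <;> simp [h, hmu1]
  | j + 2 =>
    rw [sum_range_succ', sum_range_succ']
    rw [sum_eq_zero (fun k hk => by rw [hmu]; simp)]
    by_cases h : p ∣ v <;> simp [h, hmu1, hmu]

theorem sum_moebiusCoprime_eq {v : ℕ} (hv : v ≠ 0) (X : ℝ) :
    (∑ n ∈ (Finset.Icc 1 ⌊X⌋₊).filter (fun n => Nat.gcd n v = 1),
          ((ArithmeticFunction.moebius n : ℤ) : ℝ) / n * Real.log (X / n)) =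
    ∑ d ∈ Icc 1 ⌊X⌋₊, ((factoredIndicator v d : ℤ) : ℝ) / d * moebiusLogSum (X / d) := by
  have h1 : (∑ n ∈ (Finset.Icc 1 ⌊X⌋₊).filter (fun n => Nat.gcd n v = 1),
          ((ArithmeticFunction.moebius n : ℤ) : ℝ) / n * Real.log (X / n)) =
      ∑ n ∈ Icc 1 ⌊X⌋₊, ((moebiusCoprime v n : ℤ) : ℝ) / n * Real.log (X / n) := by
    rw [sum_filter]
    refine sum_congr rfl fun n _ => ?_
    by_cases h : n.gcd v = 1 <;> simp [moebiusCoprime, h]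
  rw [h1, moebiusCoprime_eq_mul hv]
  have h2 : ∀ n ∈ Icc 1 ⌊X⌋₊,
      (((ArithmeticFunction.moebius * factoredIndicator v) n : ℤ) : ℝ) / n * Real.log (X / n) =
      ∑ x ∈ n.divisorsAntidiagonal, ((factoredIndicator v x.2 : ℤ) : ℝ) / x.2 *
        (((ArithmeticFunction.moebius x.1 : ℤ) : ℝ) / x.1 * Real.log (X / x.2 / x.1)) := by
    intro n hn
    rw [ArithmeticFunction.mul_apply]
    push_cast
    rw [sum_div, sum_mul]
    refine sum_congr rfl fun x hx => ?_
    have := (Nat.mem_divisorsAntidiagonal.1 hx).1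
    rw [← this]
    push_cast
    rw [div_div, mul_comm (x.2 : ℝ) x.1, ← div_mul_div_comm]
    ring
  rw [sum_congr rfl h2, sum_sigma']
  simp only [moebiusLogSum, mul_sum]
  rw [sum_sigma']
  refine sum_bij' (fun x _ => ⟨x.2.2, x.2.1⟩) (fun x _ => ⟨x.1 * x.2, (x.2, x.1)⟩) ?_ ?_ ?_ ?_ ?_
  · rintro ⟨n, a, b⟩ h
    simp only [mem_sigma, mem_Icc, Nat.mem_divisorsAntidiagonal, Nat.floor_div_natCast] at h ⊢
    obtain ⟨⟨h1, h2⟩, rfl, h3⟩ := h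
    have ha : 0 < a := Nat.pos_of_ne_zero fun h => by simp [h] at h3
    have hb : 0 < b := Nat.pos_of_ne_zero fun h => by simp [h] at h3
    exact ⟨⟨hb, (Nat.le_mul_of_pos_left b ha).trans h2⟩, ha, (Nat.le_div_iff_mul_le hb).2 h2⟩
  · rintro ⟨b, a⟩ h
    simp only [mem_sigma, mem_Icc, Nat.mem_divisorsAntidiagonal, Nat.floor_div_natCast] at h ⊢
    obtain ⟨⟨h1, h2⟩, h3, h4⟩ := h
    rw [Nat.le_div_iff_mul_le h1] at h4
    exact ⟨⟨Nat.mul_pos h1 h3, by rwa [mul_comm]⟩, mul_comm _ _, (Nat.mul_pos h1 h3).ne'⟩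
  · rintro ⟨n, a, b⟩ h
    simp only [mem_sigma, Nat.mem_divisorsAntidiagonal] at h
    obtain ⟨_, rfl, _⟩ := h
    simp [mul_comm]
  · rintro ⟨b, a⟩ _
    rfl
  · rintro ⟨n, a, b⟩ _
    rfl

theorem moebiusLogSum_of_lt_one {X : ℝ} (hX : X < 1) : moebiusLogSum X = 0 := by
  simp [moebiusLogSum, Nat.floor_eq_zero.2 hX]

/-- The completely multiplicative function `n ↦ n ^ (-r)` on the natural numbers. -/
noncomputable def rpowNegHom (r : ℝ) : ℕ →* ℝ where
  toFun n := (n : ℝ) ^ (-r)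
  map_one' := by simp
  map_mul' m n := by
    push_cast
    exact Real.mul_rpow (Nat.cast_nonneg _) (Nat.cast_nonneg _)

theorem hasSum_factoredIndicator_mul_rpow {r : ℝ} (hr : 0 < r) (v : ℕ) :
    HasSum (fun d : ℕ => ((factoredIndicator v d : ℤ) : ℝ) * (d : ℝ) ^ (-r))
      (∏ p ∈ v.primeFactors, (1 - (p : ℝ) ^ (-r))⁻¹) := by
  have h := (EulerProduct.summable_and_hasSum_factoredNumbers_prod_filter_prime_geometric
    (f := rpowNegHom r) (fun {p} hp => by
      have hp1 : (1 : ℝ) < p := by exact_mod_cast hp.one_lt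
      change ‖(p : ℝ) ^ (-r)‖ < 1
      rw [Real.norm_of_nonneg (by positivity)]
      exact Real.rpow_lt_one_of_one_lt_of_neg hp1 (neg_lt_zero.2 hr)) v.primeFactors).2
  rw [filter_true_of_mem (fun p hp => Nat.prime_of_mem_primeFactors hp)] at h
  rw [show (fun m : Nat.factoredNumbers v.primeFactors => rpowNegHom r m) =
    (rpowNegHom r : ℕ → ℝ) ∘ Subtype.val from rfl, hasSum_subtype_iff_indicator] at h
  refine (congrArg (HasSum · _) (funext fun d => ?_)).mp h
  by_cases hd : d ∈ Nat.factoredNumbers v.primeFactors <;>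
    simp [factoredIndicator, hd, rpowNegHom]

theorem prod_one_sub_inv_eq_div_totient {v : ℕ} (hv : v ≠ 0) :
    ∏ p ∈ v.primeFactors, (1 - (p : ℝ) ^ (-1 : ℝ))⁻¹ = (v : ℝ) / (Nat.totient v : ℝ) := by
  have h := Nat.totient_eq_mul_prod_factors v
  have h' : (v.totient : ℝ) = v * ∏ p ∈ v.primeFactors, (1 - (p : ℝ)⁻¹) := by
    have h2 := congrArg (fun q : ℚ => (q : ℝ)) h
    push_cast at h2
    exact h2
  have hv' : (v : ℝ) ≠ 0 := by exact_mod_cast hv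
  simp only [Real.rpow_neg_one]
  rw [prod_inv_distrib, h', ← div_div, div_self hv', one_div]

theorem two_pow_card_primeFactors_le {v : ℕ} (hv : Squarefree v) :
    2 ^ (v.primeFactors.card) ≤ v := by
  calc 2 ^ (v.primeFactors.card) ≤ ∏ p ∈ v.primeFactors, p :=
        pow_card_le_prod _ _ _ (fun p hp => (Nat.prime_of_mem_primeFactors hp).two_le)
    _ = v := Nat.prod_primeFactors_of_squarefree hv

theorem inv_one_sub_rpow_neg_half_le {p : ℕ} (hp : 2 ≤ p) :
    (1 - (p : ℝ) ^ (-(1 / 2) : ℝ))⁻¹ ≤ Real.exp (4 * (p : ℝ) ^ (-(1 / 2) : ℝ)) := by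
  have hx0 : 0 < (p : ℝ) ^ (-(1 / 2) : ℝ) := Real.rpow_pos_of_pos (by positivity) _
  have hx1 : (p : ℝ) ^ (-(1 / 2) : ℝ) ≤ 3 / 4 := by
    rw [Real.rpow_neg (by positivity), ← Real.sqrt_eq_rpow]
    rw [inv_le_comm₀ (by positivity) (by norm_num)]
    apply Real.le_sqrt_of_sq_le
    have : (2 : ℝ) ≤ p := by exact_mod_cast hp
    norm_num; linarith
  set x := (p : ℝ) ^ (-(1 / 2) : ℝ)
  calc (1 - x)⁻¹ ≤ 4 * x + 1 := by
        rw [inv_le_iff_one_le_mul₀ (by linarith)]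
        nlinarith
    _ ≤ _ := Real.add_one_le_exp _

theorem prod_inv_one_sub_rpow_neg_half_le {v : ℕ} {A X : ℝ} (hv : Squarefree v) (hA : 0 ≤ A)
    (hX : 1 ≤ X) (hvX : (v : ℝ) ≤ X ^ A) :
    ∏ p ∈ v.primeFactors, (1 - (p : ℝ) ^ (-(1 / 2) : ℝ))⁻¹ ≤
      Real.exp (4 * ((64 * A + 1) ^ 2 + 1)) * X ^ (1 / 8 : ℝ) := by
  set m : ℝ := 64 * A + 1 with hm
  have hm0 : 0 < m := by positivity
  have hlogX : 0 ≤ Real.log X := Real.log_nonneg hX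
  have hcard : (v.primeFactors.card : ℝ) ≤ 2 * (A * Real.log X) := by
    have h1 : ((2 : ℝ) ^ (v.primeFactors.card)) ≤ X ^ A :=
      le_trans (by exact_mod_cast two_pow_card_primeFactors_le hv) hvX
    have h2 := Real.log_le_log (by positivity) h1
    rw [Real.log_pow, Real.log_rpow (by linarith)] at h2
    have := Real.log_two_gt_d9
    nlinarith [Nat.cast_nonneg (α := ℝ) v.primeFactors.card]
  have hsum : ∑ p ∈ v.primeFactors, (p : ℝ) ^ (-(1 / 2) : ℝ) ≤
      (m ^ 2 + 1) + v.primeFactors.card * m⁻¹ := by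
    have hle : ∀ p ∈ v.primeFactors, (p : ℝ) ^ (-(1 / 2) : ℝ) ≤
        (if p ∈ range (⌊m ^ 2⌋₊ + 1) then 1 else 0) + m⁻¹ := by
      intro p hp
      have hp1 : (1 : ℝ) ≤ p := by exact_mod_cast (Nat.prime_of_mem_primeFactors hp).one_lt.le
      split_ifs with h
      · have : (p : ℝ) ^ (-(1 / 2) : ℝ) ≤ 1 :=
          Real.rpow_le_one_of_one_le_of_nonpos hp1 (by norm_num)
        have := inv_pos.2 hm0
        linarith
      · rw [zero_add, Real.rpow_neg (by positivity), ← Real.sqrt_eq_rpow]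
        apply inv_anti₀ hm0
        apply Real.le_sqrt_of_sq_le
        rw [mem_range, not_lt] at h
        exact ((Nat.lt_floor_add_one _).trans_le (by exact_mod_cast h)).le
    refine (sum_le_sum hle).trans ?_
    rw [sum_add_distrib, sum_const, nsmul_eq_mul]
    gcongr
    rw [← sum_filter, sum_const, nsmul_one]
    calc ((v.primeFactors.filter (fun p => p ∈ range (⌊m ^ 2⌋₊ + 1))).card : ℝ)
        ≤ ((range (⌊m ^ 2⌋₊ + 1)).card : ℝ) := by
          exact_mod_cast card_le_card fun p hp => (mem_filter.1 hp).2
      _ ≤ m ^ 2 + 1 := by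
          rw [card_range]; push_cast
          have := Nat.floor_le (sq_nonneg m)
          linarith
  calc ∏ p ∈ v.primeFactors, (1 - (p : ℝ) ^ (-(1 / 2) : ℝ))⁻¹
      ≤ ∏ p ∈ v.primeFactors, Real.exp (4 * (p : ℝ) ^ (-(1 / 2) : ℝ)) := by
        refine prod_le_prod (fun p hp => ?_) fun p hp =>
          inv_one_sub_rpow_neg_half_le (Nat.prime_of_mem_primeFactors hp).two_le
        rw [inv_nonneg, sub_nonneg]
        exact Real.rpow_le_one_of_one_le_of_nonpos
          (by exact_mod_cast (Nat.prime_of_mem_primeFactors hp).one_lt.le) (by norm_num)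
    _ = Real.exp (4 * ∑ p ∈ v.primeFactors, (p : ℝ) ^ (-(1 / 2) : ℝ)) := by
        rw [← Real.exp_sum, mul_sum]
    _ ≤ Real.exp (4 * (m ^ 2 + 1) + Real.log X * (1 / 8)) := by
        apply Real.exp_le_exp.2
        have h3 : (v.primeFactors.card : ℝ) * m⁻¹ ≤ Real.log X / 32 := by
          rw [← div_eq_mul_inv, div_le_iff₀ hm0]
          nlinarith
        linarith
    _ = _ := by rw [Real.exp_add, Real.rpow_def_of_pos (by linarith)]

open Filter Topology in
theorem exists_moebiusLogSum_sub_one_bounds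
    (h : Tendsto (fun u : ℝ => u * (moebiusLogSum (Real.exp u) - 1)) atTop (𝓝 0)) :
    ∃ C Y : ℝ, 0 ≤ C ∧ 1 < Y ∧ (∀ y, 0 < y → |moebiusLogSum y - 1| ≤ C) ∧
      ∀ y, Y ≤ y → |moebiusLogSum y - 1| ≤ 1 / 4 / Real.log y := by
  have h1 : ∀ᶠ u : ℝ in atTop, |u * (moebiusLogSum (Real.exp u) - 1)| < 1 / 4 := by
    have := h.abs
    rw [abs_zero] at this
    exact this.eventually_lt_const (by norm_num)
  obtain ⟨U, hU⟩ := (h1.and (eventually_ge_atTop 1)).exists_forall_of_atTop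
  have hU1 : 1 ≤ U := (hU U le_rfl).2
  have key : ∀ y, Real.exp U ≤ y → |moebiusLogSum y - 1| ≤ 1 / 4 / Real.log y := by
    intro y hy
    have hy0 : 0 < y := (Real.exp_pos _).trans_le hy
    have hl : U ≤ Real.log y := (Real.le_log_iff_exp_le hy0).2 hy
    have h2 := (hU _ hl).1
    rw [Real.exp_log hy0, abs_mul, abs_of_pos (by linarith)] at h2
    rw [le_div_iff₀ (by linarith)]
    linarith
  refine ⟨Real.exp U * U + 1, Real.exp U, by positivity, by
    rw [Real.one_lt_exp_iff]; linarith, fun y hy => ?_, key⟩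
  rcases le_or_gt (Real.exp U) y with hyU | hyU
  · refine (key y hyU).trans ?_
    have hl : U ≤ Real.log y := (Real.le_log_iff_exp_le hy).2 hyU
    have : 1 / 4 / Real.log y ≤ 1 := by
      rw [div_le_one (by linarith)]; linarith
    have : 0 ≤ Real.exp U * U := by positivity
    linarith
  · have h3 : |moebiusLogSum y| ≤ Real.exp U * U := by
      calc |moebiusLogSum y| ≤ ∑ n ∈ Icc 1 ⌊y⌋₊, U := by
            refine (abs_sum_le_sum_abs _ _).trans (sum_le_sum fun n hn => ?_)
            obtain ⟨hn1, hn2⟩ := mem_Icc.1 hn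
            have hn1' : (1 : ℝ) ≤ n := by exact_mod_cast hn1
            have hny : (n : ℝ) ≤ y := (Nat.cast_le.2 hn2).trans (Nat.floor_le hy.le)
            have hmu : |((ArithmeticFunction.moebius n : ℤ) : ℝ)| ≤ 1 := by
              exact_mod_cast ArithmeticFunction.abs_moebius_le_one
            have hl0 : 0 ≤ Real.log (y / n) :=
              Real.log_nonneg ((one_le_div (by linarith)).2 hny)
            have hlU : Real.log (y / n) ≤ U := by
              rw [Real.log_le_iff_le_exp (by positivity)]
              exact (div_le_self hy.le hn1').trans hyU.le
            rw [abs_mul, abs_div, abs_of_nonneg hl0, Nat.abs_cast]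
            calc _ ≤ 1 * Real.log (y / n) := by
                  gcongr
                  exact div_le_one_of_le₀ (hmu.trans hn1') (by positivity)
              _ ≤ U := by linarith
        _ ≤ Real.exp U * U := by
            rw [sum_const, nsmul_eq_mul, Nat.card_Icc]
            gcongr
            simpa using (Nat.floor_le hy.le).trans hyU.le
    calc |moebiusLogSum y - 1| ≤ |moebiusLogSum y| + |1| := abs_sub _ _
      _ ≤ _ := by rw [abs_one]; linarith

open Filter Topology in
theorem exists_moebius_sum_coprime_bound
    (h : Tendsto (fun u : ℝ => u * (moebiusLogSum (Real.exp u) - 1)) atTop (𝓝 0))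
    (A : ℝ) (hA : 0 ≤ A) :
    ∃ X₀ : ℝ, ∀ X : ℝ, X₀ ≤ X → ∀ v : ℕ, Squarefree v → (v : ℝ) ≤ X ^ A →
      |(∑ n ∈ (Finset.Icc 1 ⌊X⌋₊).filter (fun n => Nat.gcd n v = 1),
          ((ArithmeticFunction.moebius n : ℤ) : ℝ) / n * Real.log (X / n)) -
        (v : ℝ) / (Nat.totient v : ℝ)| ≤
      (v : ℝ) / (Nat.totient v : ℝ) * (1 / Real.log X) := by
  obtain ⟨C, Y, hC, hY, hbd, hlarge⟩ := exists_moebiusLogSum_sub_one_bounds h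
  set B := C * Real.exp (4 * ((64 * A + 1) ^ 2 + 1)) with hB
  have hdecay : ∀ᶠ X : ℝ in atTop, B * (Real.log X / X ^ (1 / 8 : ℝ)) < 1 / 2 := by
    have h0 : Tendsto (fun X : ℝ => B * (Real.log X / X ^ (1 / 8 : ℝ))) atTop (𝓝 (B * 0)) :=
      ((isLittleO_log_rpow_atTop (by norm_num)).tendsto_div_nhds_zero).const_mul B
    rw [mul_zero] at h0
    exact h0.eventually_lt_const (by norm_num)
  obtain ⟨X₀, hX₀⟩ := (hdecay.and (eventually_ge_atTop (Y ^ 2))).exists_forall_of_atTop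
  refine ⟨X₀, fun X hX v hv hvX => ?_⟩
  obtain ⟨hdec, hXY⟩ := hX₀ X hX
  have hX1 : 1 < X := by nlinarith
  have hX0 : 0 < X := by linarith
  have hlog : 0 < Real.log X := Real.log_pos hX1
  have hv0 : v ≠ 0 := hv.ne_zero
  have hV := hasSum_factoredIndicator_mul_rpow one_pos v
  rw [prod_one_sub_inv_eq_div_totient hv0] at hV
  have hW := hasSum_factoredIndicator_mul_rpow (r := 1 / 2) (by norm_num) v
  have hWle := prod_inv_one_sub_rpow_neg_half_le hv hA hX1.le hvX
  set V := (v : ℝ) / (Nat.totient v : ℝ) with hVdef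
  set W := ∏ p ∈ v.primeFactors, (1 - (p : ℝ) ^ (-(1 / 2) : ℝ))⁻¹
  have hV1 : 1 ≤ V := by
    rw [hVdef, one_le_div (by exact_mod_cast Nat.totient_pos.2 (Nat.pos_of_ne_zero hv0))]
    exact_mod_cast Nat.totient_le v
  have hS : HasSum (fun d : ℕ => ((factoredIndicator v d : ℤ) : ℝ) / d * moebiusLogSum (X / d))
      (∑ d ∈ Icc 1 ⌊X⌋₊, ((factoredIndicator v d : ℤ) : ℝ) / d * moebiusLogSum (X / d)) := by
    refine hasSum_sum_of_ne_finset_zero fun d hd => ?_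
    rcases Nat.eq_zero_or_pos d with rfl | hd0
    · simp
    · have : ⌊X⌋₊ < d := by
        by_contra hcon
        exact hd (mem_Icc.2 ⟨hd0, not_lt.1 hcon⟩)
      rw [moebiusLogSum_of_lt_one, mul_zero]
      rw [div_lt_one (by exact_mod_cast hd0)]
      exact (Nat.floor_lt hX0.le).1 this
  rw [sum_moebiusCoprime_eq hv0]
  have hmaj := (hV.mul_right (1 / 2 / Real.log X)).add
    (hW.mul_right (C * X ^ (-(1 / 4) : ℝ)))
  have hle := (hS.sub hV).norm_le_of_bounded hmaj fun d => by
    have hind : (0 : ℝ) ≤ ((factoredIndicator v d : ℤ) : ℝ) := by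
      simp only [factoredIndicator, ArithmeticFunction.coe_mk]
      split_ifs <;> simp
    rcases Nat.eq_zero_or_pos d with rfl | hd0
    · simp
    have hd0' : (0 : ℝ) < d := by exact_mod_cast hd0
    have heq : ((factoredIndicator v d : ℤ) : ℝ) / d * moebiusLogSum (X / d) -
        ((factoredIndicator v d : ℤ) : ℝ) * (d : ℝ) ^ (-1 : ℝ) =
        ((factoredIndicator v d : ℤ) : ℝ) * ((d : ℝ) ^ (-1 : ℝ) *
          (moebiusLogSum (X / d) - 1)) := by
      rw [Real.rpow_neg_one]; ring
    rw [heq, norm_mul, norm_mul, Real.norm_of_nonneg hind, Real.norm_of_nonneg (by positivity),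
      Real.norm_eq_abs, mul_assoc, mul_assoc, ← mul_add]
    apply mul_le_mul_of_nonneg_left _ hind
    rcases le_or_gt (d : ℝ) (Real.sqrt X) with hd | hd
    · have hsq : Real.sqrt X ≤ X / d := by
        rw [le_div_iff₀ hd0']
        calc Real.sqrt X * d ≤ Real.sqrt X * Real.sqrt X := by gcongr
          _ = X := Real.mul_self_sqrt hX0.le
      have hYs : Y ≤ Real.sqrt X := Real.le_sqrt_of_sq_le hXY
      have h1 := hlarge (X / d) (hYs.trans hsq)
      have hls : Real.log X / 2 ≤ Real.log (X / d) := by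
        rw [← Real.log_sqrt hX0.le]
        exact Real.log_le_log (Real.sqrt_pos.2 hX0) hsq
      have h2 : |moebiusLogSum (X / d) - 1| ≤ 1 / 2 / Real.log X := by
        refine h1.trans ?_
        rw [div_le_div_iff₀ (by linarith) hlog]
        linarith
      calc _ ≤ (d : ℝ) ^ (-1 : ℝ) * (1 / 2 / Real.log X) := by gcongr
        _ ≤ _ := le_add_of_nonneg_right (by positivity)
    · have h1 := hbd (X / d) (by positivity)
      have h2 : (d : ℝ) ^ (-1 : ℝ) ≤ (d : ℝ) ^ (-(1 / 2) : ℝ) * X ^ (-(1 / 4) : ℝ) := by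
        rw [show (-1 : ℝ) = -(1 / 2) + -(1 / 2) by norm_num, Real.rpow_add hd0']
        gcongr
        rw [show (-(1 / 4) : ℝ) = (1 / 2) * (-(1 / 2)) by norm_num, Real.rpow_mul hX0.le,
          ← Real.sqrt_eq_rpow]
        exact Real.rpow_le_rpow_of_nonpos (Real.sqrt_pos.2 hX0) hd.le (by norm_num)
      calc _ ≤ ((d : ℝ) ^ (-(1 / 2) : ℝ) * X ^ (-(1 / 4) : ℝ)) * C := by gcongr
        _ = (d : ℝ) ^ (-(1 / 2) : ℝ) * (C * X ^ (-(1 / 4) : ℝ)) := by ring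
        _ ≤ _ := le_add_of_nonneg_left (by positivity)
  rw [Real.norm_eq_abs] at hle
  refine hle.trans ?_
  have hWfin : W * (C * X ^ (-(1 / 4) : ℝ)) ≤ 1 / 2 / Real.log X := by
    calc W * (C * X ^ (-(1 / 4) : ℝ))
        ≤ (Real.exp (4 * ((64 * A + 1) ^ 2 + 1)) * X ^ (1 / 8 : ℝ)) *
          (C * X ^ (-(1 / 4) : ℝ)) := by gcongr
      _ = B * (X ^ (1 / 8 : ℝ) * X ^ (-(1 / 4) : ℝ)) := by rw [hB]; ring
      _ = B * (X ^ (1 / 8 : ℝ))⁻¹ := by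
          rw [← Real.rpow_add hX0, ← Real.rpow_neg hX0.le]; norm_num
      _ ≤ 1 / 2 / Real.log X := by
          rw [le_div_iff₀ hlog]
          calc _ = B * (Real.log X / X ^ (1 / 8 : ℝ)) := by ring
            _ ≤ _ := hdec.le
  have : 1 / 2 / Real.log X ≤ V * (1 / 2 / Real.log X) :=
    le_mul_of_one_le_left (by positivity) hV1
  calc _ ≤ V * (1 / 2 / Real.log X) + V * (1 / 2 / Real.log X) := by linarith
    _ = _ := by ring

/-- The difference between `(n + 1) ^ (-z)` and the integral of `x ^ (-z)` over
`[n + 1, n + 2]`, for `z ≠ 1`. -/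
noncomputable def zetaTerm (n : ℕ) (z : ℂ) : ℂ :=
  ((n + 1 : ℕ) : ℂ) ^ (-z) -
    (((n + 1 : ℕ) : ℂ) ^ (1 - z) - ((n + 2 : ℕ) : ℂ) ^ (1 - z)) / (z - 1)

theorem zetaTerm_eq_integral (n : ℕ) {z : ℂ} (hz : z ≠ 1) :
    zetaTerm n z = ∫ x : ℝ in ((n : ℝ) + 1)..((n : ℝ) + 1 + 1),
      (((n : ℂ) + 1) ^ (-z) - (x : ℂ) ^ (-z)) := by
  have hz' : z - 1 ≠ 0 := sub_ne_zero.2 hz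
  have h0 : (0 : ℝ) ∉ Set.uIcc ((n : ℝ) + 1) ((n : ℝ) + 1 + 1) := by
    rw [Set.uIcc_of_le (by linarith)]
    intro h
    have : (0 : ℝ) ≤ n := Nat.cast_nonneg n
    linarith [h.1]
  rw [intervalIntegral.integral_sub intervalIntegrable_const
    (intervalIntegral.intervalIntegrable_cpow (Or.inr h0)), intervalIntegral.integral_const,
    integral_cpow (Or.inr ⟨fun h => hz (neg_injective h), h0⟩)]
  simp only [zetaTerm]
  push_cast
  rw [show -z + 1 = 1 - z by ring, show (n : ℂ) + 1 + 1 = n + 2 by ring]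
  have : 1 - z ≠ 0 := sub_ne_zero.2 hz.symm
  simp only [add_sub_cancel_left, one_smul]
  field_simp
  ring

theorem norm_cpow_sub_cpow_le {a x : ℝ} (ha : 1 ≤ a) (hx : x ∈ Set.Icc a (a + 1)) {z : ℂ}
    (hz : 0 ≤ z.re) :
    ‖(a : ℂ) ^ (-z) - (x : ℂ) ^ (-z)‖ ≤ 2 * a ^ (-z.re) * (‖z‖ / a) ^ (1 / 16 : ℝ) := by
  have ha0 : 0 < a := by linarith
  have hx0 : 0 < x := by linarith [hx.1]
  have hpow : 0 < a ^ (-z.re) := Real.rpow_pos_of_pos ha0 _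
  have hna : ‖(a : ℂ) ^ (-z)‖ = a ^ (-z.re) := by
    rw [Complex.norm_cpow_eq_rpow_re_of_pos ha0, Complex.neg_re]
  have hnx : ‖(x : ℂ) ^ (-z)‖ ≤ a ^ (-z.re) := by
    rw [Complex.norm_cpow_eq_rpow_re_of_pos hx0, Complex.neg_re]
    exact Real.rpow_le_rpow_of_nonpos ha0 hx.1 (by linarith)
  rcases le_or_gt 1 (‖z‖ / a) with h | h
  · calc _ ≤ ‖(a : ℂ) ^ (-z)‖ + ‖(x : ℂ) ^ (-z)‖ := norm_sub_le _ _
      _ ≤ 2 * a ^ (-z.re) * 1 := by linarith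
      _ ≤ _ := by
        gcongr
        exact Real.one_le_rpow h (by norm_num)
  · rcases eq_or_ne z 0 with rfl | hz0
    · simp
    have hderiv : ∀ y ∈ Set.Icc a (a + 1), HasDerivWithinAt (fun y : ℝ => (y : ℂ) ^ (-z))
        (-z * (y : ℂ) ^ (-z - 1)) (Set.Icc a (a + 1)) y := by
      intro y hy
      exact (hasDerivAt_ofReal_cpow_const (by linarith [hy.1]) (neg_ne_zero.2 hz0)).hasDerivWithinAt
    have hb : ∀ y ∈ Set.Icc a (a + 1), ‖-z * (y : ℂ) ^ (-z - 1)‖ ≤ ‖z‖ * (a ^ (-z.re) / a) := by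
      intro y hy
      have hy0 : 0 < y := by linarith [hy.1]
      rw [norm_mul, norm_neg, Complex.norm_cpow_eq_rpow_re_of_pos hy0]
      gcongr
      rw [Complex.sub_re, Complex.neg_re, Complex.one_re, ← Real.rpow_sub_one ha0.ne']
      exact Real.rpow_le_rpow_of_nonpos ha0 hy.1 (by linarith)
    have := (convex_Icc a (a + 1)).norm_image_sub_le_of_norm_hasDerivWithin_le hderiv hb hx
      (Set.left_mem_Icc.2 (by linarith))
    have hxa : ‖a - x‖ ≤ 1 := by
      rw [Real.norm_eq_abs, abs_le]; constructor <;> linarith [hx.1, hx.2]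
    have hq : 0 ≤ ‖z‖ / a := by positivity
    have hle : ‖z‖ / a ≤ (‖z‖ / a) ^ (1 / 16 : ℝ) := by
      have := Real.rpow_le_rpow_of_exponent_ge' hq h.le (by norm_num : (0 : ℝ) ≤ 1 / 16)
        (by norm_num : (1 / 16 : ℝ) ≤ 1)
      rwa [Real.rpow_one] at this
    calc _ ≤ ‖z‖ * (a ^ (-z.re) / a) * ‖a - x‖ := this
      _ ≤ ‖z‖ * (a ^ (-z.re) / a) * 1 := by gcongr
      _ = a ^ (-z.re) * (‖z‖ / a) := by ring
      _ ≤ a ^ (-z.re) * (‖z‖ / a) ^ (1 / 16 : ℝ) := by gcongr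
      _ ≤ _ := by
        have : 0 ≤ a ^ (-z.re) * (‖z‖ / a) ^ (1 / 16 : ℝ) := by positivity
        linarith

theorem norm_zetaTerm_le (n : ℕ) {z : ℂ} (hz : z ≠ 1) (hre : 1 - 1 / 32 ≤ z.re) :
    ‖zetaTerm n z‖ ≤ 2 * ‖z‖ ^ (1 / 16 : ℝ) * ((n : ℝ) + 1) ^ (-(33 / 32) : ℝ) := by
  have ha : (1 : ℝ) ≤ (n : ℝ) + 1 := by linarith [Nat.cast_nonneg (α := ℝ) n]
  have ha0 : (0 : ℝ) < (n : ℝ) + 1 := by linarith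
  rw [zetaTerm_eq_integral n hz]
  have h := intervalIntegral.norm_integral_le_of_norm_le_const
    (a := (n : ℝ) + 1) (b := (n : ℝ) + 1 + 1)
    (f := fun x : ℝ => ((n : ℂ) + 1) ^ (-z) - (x : ℂ) ^ (-z))
    (C := 2 * ‖z‖ ^ (1 / 16 : ℝ) * ((n : ℝ) + 1) ^ (-(33 / 32) : ℝ)) (fun x hx => by
      rw [Set.uIoc_of_le (by linarith)] at hx
      have := norm_cpow_sub_cpow_le ha (Set.Ioc_subset_Icc_self hx) (z := z) (by linarith)
      push_cast at this
      refine this.trans ?_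
      rw [Real.div_rpow (norm_nonneg _) ha0.le]
      calc _ = 2 * ‖z‖ ^ (1 / 16 : ℝ) *
            (((n : ℝ) + 1) ^ (-z.re) * (((n : ℝ) + 1) ^ (1 / 16 : ℝ))⁻¹) := by ring
        _ ≤ _ := by
          gcongr
          rw [← Real.rpow_neg ha0.le, ← Real.rpow_add ha0]
          exact Real.rpow_le_rpow_of_exponent_le ha (by linarith))
  simpa using h

theorem summable_natCast_add_one_rpow :
    Summable fun n : ℕ => ((n : ℝ) + 1) ^ (-(33 / 32) : ℝ) := by
  have := (summable_nat_add_iff 1).2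
    (Real.summable_nat_rpow.2 (by norm_num : (-(33 / 32) : ℝ) < -1))
  simpa using this

/-- The value of `ζ(z) - 1 / (z - 1)` as a series converging for `Re z ≥ 31 / 32`. -/
noncomputable def zetaRegular (z : ℂ) : ℂ := ∑' n, zetaTerm n z

theorem summable_zetaTerm {z : ℂ} (hz : z ≠ 1) (hre : 1 - 1 / 32 ≤ z.re) :
    Summable fun n => zetaTerm n z :=
  Summable.of_norm_bounded (summable_natCast_add_one_rpow.mul_left _)
    fun n => norm_zetaTerm_le n hz hre

theorem norm_zetaRegular_le {z : ℂ} (hz : z ≠ 1) (hre : 1 - 1 / 32 ≤ z.re) :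
    ‖zetaRegular z‖ ≤
      2 * ‖z‖ ^ (1 / 16 : ℝ) * ∑' n : ℕ, ((n : ℝ) + 1) ^ (-(33 / 32) : ℝ) :=
  tsum_of_norm_bounded (summable_natCast_add_one_rpow.hasSum.mul_left _)
    fun n => norm_zetaTerm_le n hz hre

theorem riemannZeta_eq_zetaRegular_add {z : ℂ} (hre : 1 < z.re) :
    riemannZeta z = zetaRegular z + 1 / (z - 1) := by
  have hz : z ≠ 1 := by rintro rfl; simp at hre
  have hz' : z - 1 ≠ 0 := sub_ne_zero.2 hz
  have h1 := summable_zetaTerm hz (by linarith)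
  have h2 : Summable fun n : ℕ => 1 / ((n : ℂ) + 1) ^ z := by
    have := (summable_nat_add_iff 1).2 (Complex.summable_one_div_nat_cpow.2 hre)
    simpa using this
  have h3 := h2.sub h1
  have heq : ∀ n : ℕ, 1 / ((n : ℂ) + 1) ^ z - zetaTerm n z =
      (((n + 1 : ℕ) : ℂ) ^ (1 - z) - ((n + 1 + 1 : ℕ) : ℂ) ^ (1 - z)) / (z - 1) := by
    intro n
    simp only [zetaTerm, Complex.cpow_neg, add_assoc, one_add_one_eq_two]
    push_cast
    ring
  have hlim := h3.hasSum.tendsto_sum_nat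
  have hlim2 : Filter.Tendsto (fun N : ℕ => ∑ n ∈ range N,
      (1 / ((n : ℂ) + 1) ^ z - zetaTerm n z)) Filter.atTop (nhds ((1 - 0) / (z - 1))) := by
    have : (fun N : ℕ => ∑ n ∈ range N, (1 / ((n : ℂ) + 1) ^ z - zetaTerm n z)) =
        fun N : ℕ => (1 - ((N + 1 : ℕ) : ℂ) ^ (1 - z)) / (z - 1) := by
      funext N
      rw [sum_congr rfl (fun n _ => heq n), ← sum_div,
        sum_range_sub' (fun n : ℕ => ((n + 1 : ℕ) : ℂ) ^ (1 - z))]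
      simp
    rw [this]
    refine (Filter.Tendsto.const_sub 1 ?_).div_const _
    rw [tendsto_zero_iff_norm_tendsto_zero]
    have h5 : (fun N : ℕ => ‖((N + 1 : ℕ) : ℂ) ^ (1 - z)‖) =
        fun N : ℕ => ((N + 1 : ℕ) : ℝ) ^ (-(z.re - 1)) := by
      funext N
      rw [Complex.norm_natCast_cpow_of_pos (Nat.succ_pos N)]
      simp
    rw [h5]
    exact (tendsto_rpow_neg_atTop (by linarith : 0 < z.re - 1)).comp
      (tendsto_natCast_atTop_atTop.comp (Filter.tendsto_add_atTop_nat 1))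
  have h6 := tendsto_nhds_unique hlim hlim2
  rw [h2.tsum_sub h1, ← zeta_eq_tsum_one_div_nat_add_one_cpow hre] at h6
  rw [sub_zero] at h6
  rw [← h6, zetaRegular]
  ring

theorem differentiableOn_zetaRegular {U : Set ℂ} (hU : IsOpen U) {M : ℝ}
    (hM : ∀ z ∈ U, z ≠ 1 ∧ 1 - 1 / 32 ≤ z.re ∧ ‖z‖ ≤ M) : DifferentiableOn ℂ zetaRegular U := by
  refine Complex.differentiableOn_tsum_of_summable_norm
    (u := fun n : ℕ => 2 * M ^ (1 / 16 : ℝ) * ((n : ℝ) + 1) ^ (-(33 / 32) : ℝ))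
    (summable_natCast_add_one_rpow.mul_left _) (fun n z hz => ?_) hU (fun n z hz => ?_)
  · have h1 : z - 1 ≠ 0 := sub_ne_zero.2 (hM z hz).1
    have hn1 : ((n + 1 : ℕ) : ℂ) ≠ 0 := by exact_mod_cast Nat.succ_ne_zero n
    have hn2 : ((n + 2 : ℕ) : ℂ) ≠ 0 := by exact_mod_cast Nat.succ_ne_zero (n + 1)
    apply DifferentiableAt.differentiableWithinAt
    unfold zetaTerm
    refine DifferentiableAt.sub ?_ (DifferentiableAt.div (DifferentiableAt.sub ?_ ?_) ?_ h1)
    · exact (differentiableAt_id.neg).const_cpow (Or.inl hn1)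
    · exact (differentiableAt_id.const_sub 1).const_cpow (Or.inl hn1)
    · exact (differentiableAt_id.const_sub 1).const_cpow (Or.inl hn2)
    · exact differentiableAt_id.sub_const 1
  · obtain ⟨h1, h2, h3⟩ := hM z hz
    refine (norm_zetaTerm_le n h1 h2).trans ?_
    gcongr

theorem exists_norm_riemannZeta_le :
    ∃ C : ℝ, 0 < C ∧ ∀ s : ℂ, 1 < s.re → s.re ≤ 2 → 1 ≤ |s.im| →
      ‖riemannZeta s‖ ≤ C * |s.im| ^ (1 / 16 : ℝ) ∧
      ‖deriv riemannZeta s‖ ≤ C * |s.im| ^ (1 / 16 : ℝ) := by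
  set S := ∑' n : ℕ, ((n : ℝ) + 1) ^ (-(33 / 32) : ℝ) with hS
  have hS0 : 0 ≤ S := tsum_nonneg fun n => by positivity
  refine ⟨8 * S * 64 + 1, by positivity, fun s hs1 hs2 hs3 => ?_⟩
  have hw1 : 1 ≤ |s.im| ^ (1 / 16 : ℝ) := Real.one_le_rpow hs3 (by norm_num)
  have him : ∀ z : ℂ, ‖z - s‖ < 1 / 32 → z ≠ 1 ∧ 1 - 1 / 32 ≤ z.re ∧ ‖z‖ ≤ 4 * |s.im| := by
    intro z hz
    have h1 := (Complex.abs_re_le_norm (z - s)).trans hz.le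
    have h2 := (Complex.abs_im_le_norm (z - s)).trans hz.le
    rw [Complex.sub_re] at h1
    rw [Complex.sub_im] at h2
    refine ⟨?_, by linarith [(abs_le.1 h1).1], ?_⟩
    · rintro rfl
      rw [Complex.one_im, zero_sub, abs_neg] at h2
      linarith
    · have h3 : ‖s‖ ≤ |s.re| + |s.im| := Complex.norm_le_abs_re_add_abs_im s
      rw [abs_of_pos (by linarith : 0 < s.re)] at h3
      have h4 : ‖z‖ ≤ ‖z - s‖ + ‖s‖ := by simpa using norm_add_le (z - s) s
      linarith
  have hbound : ∀ z : ℂ, ‖z - s‖ < 1 / 32 → ‖zetaRegular z‖ ≤ 8 * S * |s.im| ^ (1 / 16 : ℝ) := by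
    intro z hz
    obtain ⟨h1, h2, h3⟩ := him z hz
    refine (norm_zetaRegular_le h1 h2).trans ?_
    have h4 : ‖z‖ ^ (1 / 16 : ℝ) ≤ 4 * |s.im| ^ (1 / 16 : ℝ) := by
      calc ‖z‖ ^ (1 / 16 : ℝ) ≤ (4 * |s.im|) ^ (1 / 16 : ℝ) := by gcongr
        _ = 4 ^ (1 / 16 : ℝ) * |s.im| ^ (1 / 16 : ℝ) :=
          Real.mul_rpow (by norm_num) (abs_nonneg _)
        _ ≤ _ := by
          gcongr
          exact Real.rpow_le_self_of_one_le (by norm_num) (by norm_num)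
    calc _ ≤ 2 * (4 * |s.im| ^ (1 / 16 : ℝ)) * S := by gcongr
      _ = _ := by ring
  have hs1' : s ≠ 1 := by rintro rfl; simp at hs1
  have hinv : ‖1 / (s - 1)‖ ≤ 1 := by
    rw [norm_div, norm_one, div_le_one (norm_pos_iff.2 (sub_ne_zero.2 hs1'))]
    have := Complex.abs_im_le_norm (s - 1)
    rw [Complex.sub_im, Complex.one_im, sub_zero] at this
    linarith
  have hdiff : DifferentiableOn ℂ zetaRegular (Metric.ball s (1 / 32)) :=
    differentiableOn_zetaRegular Metric.isOpen_ball (M := 4 * |s.im|) fun z hz =>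
      him z (by rwa [mem_ball_iff_norm] at hz)
  constructor
  · rw [riemannZeta_eq_zetaRegular_add hs1]
    have := hbound s (by simp)
    calc _ ≤ ‖zetaRegular s‖ + ‖1 / (s - 1)‖ := norm_add_le _ _
      _ ≤ _ := by nlinarith
  · have hev : riemannZeta =ᶠ[nhds s] fun z => zetaRegular z + 1 / (z - 1) := by
      filter_upwards [(isOpen_lt continuous_const Complex.continuous_re).mem_nhds hs1] with z hz
      exact riemannZeta_eq_zetaRegular_add hz
    have hd1 : DifferentiableAt ℂ zetaRegular s :=
      hdiff.differentiableAt (Metric.ball_mem_nhds _ (by norm_num))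
    have hd2 : HasDerivAt (fun z : ℂ => 1 / (z - 1)) (-1 / (s - 1) ^ 2) s := by
      simpa [one_div] using ((hasDerivAt_id s).sub_const 1).fun_inv (sub_ne_zero.2 hs1')
    rw [hev.deriv_eq, (hd1.hasDerivAt.fun_add hd2).deriv]
    have hC := Complex.norm_deriv_le_of_forall_mem_sphere_norm_le (c := s) (R := 1 / 64)
      (f := zetaRegular) (C := 8 * S * |s.im| ^ (1 / 16 : ℝ)) (by norm_num)
      ((hdiff.mono (by
        intro z hz
        rw [closure_ball _ (by norm_num)] at hz
        exact Metric.closedBall_subset_ball (by norm_num) hz)).diffContOnCl)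
      (fun z hz => hbound z (by
        rw [mem_sphere_iff_norm] at hz
        rw [hz]; norm_num))
    have h7 : ‖-1 / (s - 1) ^ 2‖ ≤ 1 := by
      have : -1 / (s - 1) ^ 2 = -(1 / (s - 1)) ^ 2 := by
        rw [div_pow, one_pow, neg_div]
      rw [this, norm_neg, norm_pow]
      exact pow_le_one₀ (norm_nonneg _) hinv
    calc _ ≤ ‖deriv zetaRegular s‖ + ‖-1 / (s - 1) ^ 2‖ := norm_add_le _ _
      _ ≤ 8 * S * |s.im| ^ (1 / 16 : ℝ) / (1 / 64) + 1 := add_le_add hC h7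
      _ ≤ _ := by linarith

theorem exists_norm_riemannZeta_ofReal_le :
    ∃ C : ℝ, 0 < C ∧ ∀ x : ℝ, 0 < x → x ≤ 1 → ‖riemannZeta (1 + x)‖ ≤ C / x := by
  have hcont : Continuous fun x : ℝ => riemannZeta₁ (1 + x) :=
    differentiable_riemannZeta₁.continuous.comp (by fun_prop)
  obtain ⟨C, hC⟩ := (isCompact_Icc (a := (0 : ℝ)) (b := 1)).exists_bound_of_continuousOn
    hcont.continuousOn
  refine ⟨max C 1, by positivity, fun x hx0 hx1 => ?_⟩
  have hne : (1 + x : ℂ) ≠ 1 := by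
    simpa using hx0.ne'
  rw [riemannZeta_eq_inv_sub_mul hne, norm_mul, add_sub_cancel_left, norm_inv,
    Complex.norm_real, Real.norm_of_nonneg hx0.le, div_eq_inv_mul]
  gcongr
  exact (hC x ⟨hx0.le, hx1⟩).trans (le_max_left _ _)

theorem riemannZeta_three_four_one {x : ℝ} (hx : 0 < x) (t : ℝ) :
    1 ≤ ‖riemannZeta (1 + x)‖ ^ 3 * ‖riemannZeta (1 + x + Complex.I * t)‖ ^ 4 *
      ‖riemannZeta (1 + x + 2 * Complex.I * t)‖ := by
  have h := DirichletCharacter.norm_LFunction_product_ge_one (1 : DirichletCharacter ℂ 1) hx t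
  simpa [DirichletCharacter.LFunctionTrivChar, DirichletCharacter.LFunction_modOne_eq] using h

theorem exists_le_norm_riemannZeta :
    ∃ c : ℝ, 0 < c ∧ ∀ s : ℂ, 1 < s.re → s.re ≤ 2 → 1 ≤ |s.im| →
      c / (|s.im| ^ (1 / 16 : ℝ)) ^ 4 ≤ ‖riemannZeta s‖ := by
  obtain ⟨C₁, hC₁, hz⟩ := exists_norm_riemannZeta_le
  obtain ⟨C₀, hC₀, hr⟩ := exists_norm_riemannZeta_ofReal_le
  set c₀ : ℝ := ((2 * C₀ ^ 3 * C₁)⁻¹) ^ (1 / 4 : ℝ) with hc₀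
  have hc₀pos : 0 < c₀ := by positivity
  have hc₀4 : c₀ ^ 4 = (2 * C₀ ^ 3 * C₁)⁻¹ := by
    rw [hc₀, ← Real.rpow_natCast, ← Real.rpow_mul (by positivity)]
    norm_num
  set k : ℝ := min 1 (c₀ / (2 * C₁)) with hk
  have hk0 : 0 < k := lt_min one_pos (by positivity)
  have hk1 : k ≤ 1 := min_le_left _ _
  have hkC : C₁ * k ≤ c₀ / 2 := by
    calc C₁ * k ≤ C₁ * (c₀ / (2 * C₁)) := by gcongr; exact min_le_right _ _
      _ = c₀ / 2 := by field_simp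
  refine ⟨c₀ * k ^ 3 / 2, by positivity, fun s hs1 hs2 hs3 => ?_⟩
  set t := s.im with ht
  set w := |t| ^ (1 / 16 : ℝ) with hw
  have hw1 : 1 ≤ w := Real.one_le_rpow hs3 (by norm_num)
  have hw0 : 0 < w := by linarith
  -- the lower bound away from the line `Re s = 1`
  have hfar : ∀ x : ℝ, k ^ 4 / w ^ 5 ≤ x → x ≤ 1 →
      c₀ * k ^ 3 / w ^ 4 ≤ ‖riemannZeta (1 + x + Complex.I * t)‖ := by
    intro x hx hx1
    have hx0 : 0 < x := lt_of_lt_of_le (by positivity) hx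
    have h341 := riemannZeta_three_four_one hx0 t
    have h2 : ‖riemannZeta (1 + x + 2 * Complex.I * t)‖ ≤ C₁ * (2 * w) := by
      have him : (1 + x + 2 * Complex.I * t : ℂ).im = 2 * t := by simp
      have hre : (1 + x + 2 * Complex.I * t : ℂ).re = 1 + x := by simp
      have := (hz (1 + x + 2 * Complex.I * t) (by rw [hre]; linarith) (by rw [hre]; linarith)
        (by rw [him, abs_mul, abs_two]; linarith)).1
      rw [him] at this
      refine this.trans ?_
      gcongr
      rw [abs_mul, abs_two, Real.mul_rpow (by norm_num) (abs_nonneg _)]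
      gcongr
      exact Real.rpow_le_self_of_one_le (by norm_num) (by norm_num)
    have h4 : (c₀ * k ^ 3 / w ^ 4) ^ 4 ≤ ‖riemannZeta (1 + x + Complex.I * t)‖ ^ 4 := by
      set Z := ‖riemannZeta (1 + x + Complex.I * t)‖ ^ 4 with hZ
      have hZ0 : 0 ≤ Z := by positivity
      have h5 : 1 ≤ (C₀ / x) ^ 3 * Z * (C₁ * (2 * w)) := by
        refine h341.trans ?_
        gcongr
        exact hr x hx0 hx1
      have h6 : x ^ 3 ≤ 2 * C₀ ^ 3 * C₁ * w * Z := by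
        have : (C₀ / x) ^ 3 * Z * (C₁ * (2 * w)) = 2 * C₀ ^ 3 * C₁ * w * Z / x ^ 3 := by
          rw [div_pow]; ring
        rw [this, le_div_iff₀ (by positivity), one_mul] at h5
        exact h5
      have h7 : (k ^ 4 / w ^ 5) ^ 3 ≤ 2 * C₀ ^ 3 * C₁ * w * Z :=
        (pow_le_pow_left₀ (by positivity) hx 3).trans h6
      have h8 : (c₀ * k ^ 3 / w ^ 4) ^ 4 = c₀ ^ 4 / w * (k ^ 4 / w ^ 5) ^ 3 := by
        field_simp
      rw [h8, hc₀4]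
      calc _ ≤ (2 * C₀ ^ 3 * C₁)⁻¹ / w * (2 * C₀ ^ 3 * C₁ * w * Z) := by gcongr
        _ = Z := by field_simp
    exact le_of_pow_le_pow_left₀ (by norm_num) (norm_nonneg _) h4
  have hη1 : k ^ 4 / w ^ 5 ≤ 1 :=
    (div_le_one (by positivity)).2 ((pow_le_one₀ hk0.le hk1).trans (one_le_pow₀ hw1))
  have hs : s = 1 + ((s.re - 1 : ℝ) : ℂ) + Complex.I * t := by
    apply Complex.ext <;> simp [ht]
  rcases le_or_gt (k ^ 4 / w ^ 5) (s.re - 1) with h | h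
  · have := hfar _ h (by linarith)
    rw [← hs] at this
    refine le_trans ?_ this
    gcongr
    linarith [show 0 < c₀ * k ^ 3 by positivity]
  · set s' : ℂ := 1 + ((k ^ 4 / w ^ 5 : ℝ) : ℂ) + Complex.I * t with hs'
    have hre' : s'.re = 1 + k ^ 4 / w ^ 5 := by simp only [hs', Complex.add_re, Complex.one_re,
      Complex.ofReal_re, Complex.mul_re, Complex.I_re, Complex.I_im, Complex.ofReal_im]; ring
    have him' : s'.im = t := by simp only [hs', Complex.add_im, Complex.one_im,
      Complex.ofReal_re, Complex.mul_im, Complex.I_re, Complex.I_im, Complex.ofReal_im]; ring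
    have h1 := hfar _ le_rfl hη1
    rw [← hs'] at h1
    have hconv : Convex ℝ (Set.Ioc (1 : ℝ) 2 ×ℂ {t}) :=
      ((convex_Ioc 1 2).linear_preimage Complex.reLm).inter
        ((convex_singleton t).linear_preimage Complex.imLm)
    have hmv := hconv.norm_image_sub_le_of_norm_deriv_le (f := riemannZeta) (C := C₁ * w)
      (x := s) (y := s')
      (fun z hz' => by
        apply differentiableAt_riemannZeta
        rintro rfl
        simpa using hz'.1.1)
      (fun z hz' => by
        have hzim : z.im = t := hz'.2
        have := (hz z hz'.1.1 hz'.1.2 (by rw [hzim]; exact hs3)).2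
        rwa [hzim] at this)
      ⟨⟨hs1, hs2⟩, rfl⟩
      ⟨⟨by rw [hre']; linarith [show 0 < k ^ 4 / w ^ 5 by positivity],
        by rw [hre']; linarith⟩, him'⟩
    have hdist : ‖s' - s‖ ≤ k ^ 4 / w ^ 5 := by
      have : s' - s = ((k ^ 4 / w ^ 5 - (s.re - 1) : ℝ) : ℂ) := by
        apply Complex.ext
        · rw [Complex.sub_re, hre', Complex.ofReal_re]; ring
        · rw [Complex.sub_im, him', Complex.ofReal_im, ht]; ring
      rw [this, Complex.norm_real, Real.norm_of_nonneg (by linarith)]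
      linarith
    have htri : ‖riemannZeta s'‖ ≤ ‖riemannZeta s‖ + ‖riemannZeta s' - riemannZeta s‖ := by
      simpa using norm_add_le (riemannZeta s) (riemannZeta s' - riemannZeta s)
    have hsmall : ‖riemannZeta s' - riemannZeta s‖ ≤ c₀ * k ^ 3 / 2 / w ^ 4 := by
      calc _ ≤ C₁ * w * ‖s' - s‖ := hmv
        _ ≤ C₁ * w * (k ^ 4 / w ^ 5) := by gcongr
        _ = C₁ * k * k ^ 3 / w ^ 4 := by field_simp
        _ ≤ c₀ / 2 * k ^ 3 / w ^ 4 := by gcongr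
        _ = _ := by ring
    have : c₀ * k ^ 3 / w ^ 4 = c₀ * k ^ 3 / 2 / w ^ 4 + c₀ * k ^ 3 / 2 / w ^ 4 := by ring
    linarith

/-- The function `1 / ((z - 1) ^ 2 ζ(z)) - 1 / (z - 1)`, with its singularity at `1` removed. -/
noncomputable def invZetaRegular (z : ℂ) : ℂ := -riemannZeta₀ z / riemannZeta₁ z

theorem isOpen_riemannZeta₁_ne_zero : IsOpen {z : ℂ | riemannZeta₁ z ≠ 0} :=
  isOpen_ne_fun differentiable_riemannZeta₁.continuous continuous_const

theorem riemannZeta₁_ne_zero_of_one_le_re {z : ℂ} (hz : 1 ≤ z.re) : riemannZeta₁ z ≠ 0 := by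
  rcases eq_or_ne z 1 with rfl | h1
  · simp
  · have := riemannZeta_ne_zero_of_one_le_re hz
    rw [riemannZeta_eq_inv_sub_mul h1] at this
    exact right_ne_zero_of_mul this

theorem continuousOn_deriv_invZetaRegular :
    ContinuousOn (deriv invZetaRegular) {z : ℂ | riemannZeta₁ z ≠ 0} := by
  have h : DifferentiableOn ℂ invZetaRegular {z : ℂ | riemannZeta₁ z ≠ 0} := by
    intro z hz
    exact ((differentiable_riemannZeta₀ z).neg.div (differentiable_riemannZeta₁ z)
      hz).differentiableWithinAt
  exact (h.deriv isOpen_riemannZeta₁_ne_zero).continuousOn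

theorem deriv_invZetaRegular_eq {z : ℂ} (hz : 1 < z.re) :
    deriv invZetaRegular z = -deriv riemannZeta z / riemannZeta z ^ 2 / (z - 1) ^ 2 -
      2 / (riemannZeta z * (z - 1) ^ 3) + 1 / (z - 1) ^ 2 := by
  have hz1 : z ≠ 1 := by rintro rfl; simp at hz
  have hz1' : z - 1 ≠ 0 := sub_ne_zero.2 hz1
  have hζ : riemannZeta z ≠ 0 := riemannZeta_ne_zero_of_one_le_re hz.le
  have hev : invZetaRegular =ᶠ[nhds z]
      fun y => 1 / (riemannZeta y * (y - 1) ^ 2) - 1 / (y - 1) := by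
    filter_upwards [(isOpen_lt continuous_const Complex.continuous_re).mem_nhds hz] with y hy
    have hy' : (1 : ℝ) < y.re := hy
    have hy1 : y ≠ 1 := by rintro rfl; simp at hy'
    have hy1' : y - 1 ≠ 0 := sub_ne_zero.2 hy1
    have h1 := riemannZeta₁_ne_zero_of_one_le_re hy'.le
    rw [riemannZeta_eq_inv_sub_mul hy1, invZetaRegular]
    have h2 : riemannZeta₁ y = 1 + (y - 1) * riemannZeta₀ y := rfl
    field_simp
    rw [h2]; ring
  have hd := (differentiableAt_riemannZeta hz1).hasDerivAt
  have hsub := (hasDerivAt_id z).sub_const 1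
  have h1 : HasDerivAt (fun y => riemannZeta y * (y - 1) ^ 2)
      (deriv riemannZeta z * (z - 1) ^ 2 + riemannZeta z * (2 * (z - 1))) z := by
    simpa using hd.fun_mul (hsub.fun_pow 2)
  have h2 := (h1.fun_inv (mul_ne_zero hζ (pow_ne_zero 2 hz1'))).fun_sub (hsub.fun_inv hz1')
  simp only [one_div] at hev
  rw [hev.deriv_eq]
  simp only [id] at h2
  rw [h2.deriv]
  field_simp
  ring

theorem exists_norm_deriv_invZetaRegular_le :
    ∃ C : ℝ, 0 ≤ C ∧ ∀ x t : ℝ, 0 < x → x ≤ 1 →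
      ‖deriv invZetaRegular (1 + x + t * Complex.I)‖ ≤ C * (1 + ‖t‖) ^ (-(23 / 16) : ℝ) := by
  obtain ⟨C₁, hC₁, hz⟩ := exists_norm_riemannZeta_le
  obtain ⟨c, hc, hlow⟩ := exists_le_norm_riemannZeta
  have hcomp : IsCompact (Set.Icc (1 : ℝ) 2 ×ℂ Set.Icc (-1 : ℝ) 1) :=
    isCompact_Icc.reProdIm isCompact_Icc
  obtain ⟨M, hM⟩ := hcomp.exists_bound_of_continuousOn
    (continuousOn_deriv_invZetaRegular.mono fun z hz' => riemannZeta₁_ne_zero_of_one_le_re hz'.1.1)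
  set K := C₁ / c ^ 2 + 2 / c + 1 with hK
  have hK0 : 0 ≤ K := by positivity
  refine ⟨4 * (|M| + K), by positivity, fun x t hx0 hx1 => ?_⟩
  have hre : (1 + x + t * Complex.I : ℂ).re = 1 + x := by simp
  have him : (1 + x + t * Complex.I : ℂ).im = t := by simp
  set z : ℂ := 1 + x + t * Complex.I with hzdef
  have htwo : (2 : ℝ) ^ (23 / 16 : ℝ) ≤ 4 := by
    calc (2 : ℝ) ^ (23 / 16 : ℝ) ≤ 2 ^ (2 : ℝ) :=
          Real.rpow_le_rpow_of_exponent_le (by norm_num) (by norm_num)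
      _ = 4 := by norm_num
  rw [Real.norm_eq_abs t]
  rcases le_or_gt |t| 1 with ht | ht
  · have h1 : ‖deriv invZetaRegular z‖ ≤ |M| :=
      (hM z ⟨by rw [Set.mem_preimage, hre]; exact ⟨by linarith, by linarith⟩,
        by rw [Set.mem_preimage, him]; exact abs_le.1 ht⟩).trans (le_abs_self M)
    have h2 : 1 ≤ 4 * (1 + |t|) ^ (-(23 / 16) : ℝ) := by
      have h3 : (1 + |t|) ^ (23 / 16 : ℝ) ≤ 4 :=
        (Real.rpow_le_rpow (by positivity) (by linarith) (by norm_num)).trans htwo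
      rw [Real.rpow_neg (by positivity), ← div_eq_mul_inv, one_le_div (by positivity)]
      exact h3
    calc _ ≤ (|M| + K) * 1 := by linarith
      _ ≤ (|M| + K) * (4 * (1 + |t|) ^ (-(23 / 16) : ℝ)) := by gcongr
      _ = _ := by ring
  · set w := |t| ^ (1 / 16 : ℝ) with hw
    have hw1 : 1 ≤ w := Real.one_le_rpow ht.le (by norm_num)
    have hw0 : 0 < w := by linarith
    have ht16 : |t| = w ^ 16 := by
      rw [hw, ← Real.rpow_natCast, ← Real.rpow_mul (abs_nonneg _)]; norm_num
    have h1 := (hz z (by rw [hre]; linarith) (by rw [hre]; linarith) (by rw [him]; exact ht.le)).2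
    have h2 := hlow z (by rw [hre]; linarith) (by rw [hre]; linarith) (by rw [him]; exact ht.le)
    rw [him, ← hw] at h1 h2
    have hnorm : w ^ 16 ≤ ‖z - 1‖ := by
      have := Complex.abs_im_le_norm (z - 1)
      rwa [Complex.sub_im, him, Complex.one_im, sub_zero, ht16] at this
    have hinv : ‖riemannZeta z‖⁻¹ ≤ w ^ 4 / c := by
      rw [← inv_div]
      exact inv_anti₀ (by positivity) h2
    have hinv1 : ‖z - 1‖⁻¹ ≤ (w ^ 16)⁻¹ := inv_anti₀ (by positivity) hnorm
    have hmain : ‖deriv invZetaRegular z‖ ≤ K * (w ^ 23)⁻¹ := by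
      rw [deriv_invZetaRegular_eq (by rw [hre]; linarith)]
      have e1 : ‖-deriv riemannZeta z / riemannZeta z ^ 2 / (z - 1) ^ 2‖ ≤
          C₁ / c ^ 2 * (w ^ 23)⁻¹ := by
        calc _ = ‖deriv riemannZeta z‖ * (‖riemannZeta z‖⁻¹) ^ 2 * (‖z - 1‖⁻¹) ^ 2 := by
              simp only [norm_div, norm_neg, norm_pow]
              ring
          _ ≤ (C₁ * w) * (w ^ 4 / c) ^ 2 * ((w ^ 16)⁻¹) ^ 2 := by gcongr
          _ = _ := by field_simp
      have e2 : ‖2 / (riemannZeta z * (z - 1) ^ 3)‖ ≤ 2 / c * (w ^ 23)⁻¹ := by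
        calc _ = 2 * ‖riemannZeta z‖⁻¹ * (‖z - 1‖⁻¹) ^ 3 := by
              simp only [norm_div, norm_mul, norm_pow, Complex.norm_ofNat]
              rw [div_eq_mul_inv, mul_inv, inv_pow]; ring
          _ ≤ 2 * (w ^ 4 / c) * ((w ^ 16)⁻¹) ^ 3 := by gcongr
          _ = 2 / c * (w ^ 44)⁻¹ := by field_simp
          _ ≤ _ := by
            gcongr
            norm_num
      have e3 : ‖1 / (z - 1) ^ 2‖ ≤ 1 * (w ^ 23)⁻¹ := by
        calc _ = (‖z - 1‖⁻¹) ^ 2 := by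
              rw [norm_div, norm_one, norm_pow, one_div, inv_pow]
          _ ≤ ((w ^ 16)⁻¹) ^ 2 := by gcongr
          _ = (w ^ 32)⁻¹ := by rw [inv_pow, ← pow_mul]
          _ ≤ _ := by
            rw [one_mul]
            gcongr
            norm_num
      calc _ ≤ _ := norm_add_le _ _
        _ ≤ _ := add_le_add_left (norm_sub_le _ _) _
        _ ≤ C₁ / c ^ 2 * (w ^ 23)⁻¹ + 2 / c * (w ^ 23)⁻¹ + 1 * (w ^ 23)⁻¹ := by gcongr
        _ = _ := by rw [hK]; ring
    have hfin : (w ^ 23)⁻¹ ≤ 4 * (1 + |t|) ^ (-(23 / 16) : ℝ) := by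
      have e4 : (1 + |t|) ^ (23 / 16 : ℝ) ≤ 4 * w ^ 23 := by
        calc (1 + |t|) ^ (23 / 16 : ℝ) ≤ (2 * |t|) ^ (23 / 16 : ℝ) := by
              apply Real.rpow_le_rpow (by positivity) (by linarith) (by norm_num)
          _ = 2 ^ (23 / 16 : ℝ) * |t| ^ (23 / 16 : ℝ) := Real.mul_rpow (by norm_num) (abs_nonneg _)
          _ ≤ 4 * |t| ^ (23 / 16 : ℝ) := by gcongr
          _ = 4 * w ^ 23 := by
            rw [hw, ← Real.rpow_natCast, ← Real.rpow_mul (abs_nonneg _)]; norm_num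
      rw [Real.rpow_neg (by positivity), ← div_eq_mul_inv, inv_eq_one_div,
        div_le_div_iff₀ (by positivity) (by positivity)]
      linarith
    calc _ ≤ K * (w ^ 23)⁻¹ := hmain
      _ ≤ (|M| + K) * (4 * (1 + |t|) ^ (-(23 / 16) : ℝ)) := by
        gcongr
        linarith [abs_nonneg M]
      _ = _ := by ring

open Filter Topology MeasureTheory

/-- The function `u ↦ u ^ k * exp (-s * u)`, cut off at the negative half-line for `k ≠ 0`. -/
noncomputable def powMulExp (k : ℕ) (s : ℂ) (u : ℝ) : ℂ :=
  ((max u 0 : ℝ) : ℂ) ^ k * Complex.exp (-s * u)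

theorem tendsto_pow_mul_cexp_neg_mul (k : ℕ) {s : ℂ} (hs : 0 < s.re) :
    Tendsto (fun u : ℝ => (u : ℂ) ^ k * Complex.exp (-s * u)) atTop (𝓝 0) := by
  rw [tendsto_zero_iff_norm_tendsto_zero]
  refine (tendsto_rpow_mul_exp_neg_mul_atTop_nhds_zero k s.re hs).congr' ?_
  filter_upwards [eventually_ge_atTop 0] with u hu
  simp [Complex.norm_exp, abs_of_nonneg hu]

theorem integrableOn_pow_mul_cexp_neg_mul (k : ℕ) {s : ℂ} (hs : 0 < s.re) :
    IntegrableOn (fun u : ℝ => (u : ℂ) ^ k * Complex.exp (-s * u)) (Set.Ioi 0) := by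
  have h := integrableOn_rpow_mul_exp_neg_mul_rpow (s := (k : ℝ)) (p := 1)
    (by linarith [Nat.cast_nonneg (α := ℝ) k]) one_pos hs
  refine Integrable.mono' h (by fun_prop) ?_
  filter_upwards [ae_restrict_mem measurableSet_Ioi] with u hu
  have hu' : 0 < u := hu
  simp [Complex.norm_exp, abs_of_pos hu']

theorem integral_pow_mul_cexp_neg_mul (k : ℕ) {s : ℂ} (hs : 0 < s.re) :
    ∫ u : ℝ in Set.Ioi 0, (u : ℂ) ^ k * Complex.exp (-s * u) = k.factorial / s ^ (k + 1) := by
  have hs0 : s ≠ 0 := by rintro rfl; simp at hs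
  induction k with
  | zero =>
    have := integral_exp_mul_complex_Ioi (a := -s) (by simpa using hs) 0
    simpa using this
  | succ k ih =>
    have hderiv : ∀ u : ℝ, HasDerivAt (fun u : ℝ => (u : ℂ) ^ (k + 1) * Complex.exp (-s * u))
        ((k + 1) * ((u : ℂ) ^ k * Complex.exp (-s * u)) -
          s * ((u : ℂ) ^ (k + 1) * Complex.exp (-s * u))) u := by
      intro u
      have h1 : HasDerivAt (fun u : ℝ => (u : ℂ)) 1 u := Complex.ofRealCLM.hasDerivAt
      have h2 := (h1.fun_pow (k + 1)).fun_mul (h1.const_mul (-s)).cexp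
      convert! h2 using 1
      simp
      ring
    have hint := ((integrableOn_pow_mul_cexp_neg_mul k hs).const_mul (k + 1 : ℂ)).sub
      ((integrableOn_pow_mul_cexp_neg_mul (k + 1) hs).const_mul s)
    have h := integral_Ioi_of_hasDerivAt_of_tendsto' (a := 0) (fun u _ => hderiv u) hint
      (tendsto_pow_mul_cexp_neg_mul (k + 1) hs)
    rw [integral_sub ((integrableOn_pow_mul_cexp_neg_mul k hs).const_mul _)
      ((integrableOn_pow_mul_cexp_neg_mul (k + 1) hs).const_mul s), integral_const_mul,
      integral_const_mul, ih] at h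
    simp only [Complex.ofReal_zero, ne_eq, Nat.add_eq_zero_iff, one_ne_zero, and_false,
      not_false_eq_true, zero_pow, zero_mul, sub_zero] at h
    rw [eq_div_iff (pow_ne_zero _ hs0), Nat.factorial_succ]
    push_cast
    generalize (∫ u : ℝ in Set.Ioi 0, (u : ℂ) ^ (k + 1) * Complex.exp (-s * u)) = J at h ⊢
    rw [sub_eq_zero] at h
    field_simp at h
    rw [pow_succ s (k + 1)]
    linear_combination -h

theorem powMulExp_eq_indicator {k : ℕ} (hk : k ≠ 0) (s : ℂ) :
    powMulExp k s =
      (Set.Ioi 0).indicator fun u : ℝ => (u : ℂ) ^ k * Complex.exp (-s * u) := by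
  ext u
  rcases le_or_gt u 0 with hu | hu
  · rw [Set.indicator_of_notMem (by simpa using hu), powMulExp, max_eq_right hu]
    simp [hk]
  · rw [Set.indicator_of_mem (Set.mem_Ioi.2 hu), powMulExp, max_eq_left hu.le]

theorem integrable_powMulExp {k : ℕ} (hk : k ≠ 0) {s : ℂ} (hs : 0 < s.re) :
    Integrable (powMulExp k s) := by
  rw [powMulExp_eq_indicator hk, integrable_indicator_iff measurableSet_Ioi]
  exact integrableOn_pow_mul_cexp_neg_mul k hs

theorem integral_powMulExp {k : ℕ} (hk : k ≠ 0) {s : ℂ} (hs : 0 < s.re) :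
    ∫ u, powMulExp k s u = k.factorial / s ^ (k + 1) := by
  rw [powMulExp_eq_indicator hk, integral_indicator measurableSet_Ioi]
  exact integral_pow_mul_cexp_neg_mul k hs

theorem integral_tsum_translate_add_translate {c d : ℕ → ℂ} (hc : Summable c) (hd : Summable d)
    {f g : ℝ → ℂ} (hf : Integrable f) (hg : Integrable g) (b : ℕ → ℝ) :
    ∫ u, ∑' n, (c n * f (u - b n) + d n * g (u - b n)) =
      (∑' n, c n) * (∫ u, f u) + (∑' n, d n) * ∫ u, g u := by
  have hf' : ∀ n, Integrable fun u => c n * f (u - b n) := fun n =>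
    (hf.comp_sub_right (b n)).const_mul (c n)
  have hg' : ∀ n, Integrable fun u => d n * g (u - b n) := fun n =>
    (hg.comp_sub_right (b n)).const_mul (d n)
  have hle : ∀ n, ∫ u, ‖c n * f (u - b n) + d n * g (u - b n)‖ ≤
      ‖c n‖ * (∫ u, ‖f u‖) + ‖d n‖ * ∫ u, ‖g u‖ := fun n => by
    calc _ ≤ ∫ u, (‖c n * f (u - b n)‖ + ‖d n * g (u - b n)‖) :=
          integral_mono ((hf' n).add (hg' n)).norm ((hf' n).norm.add (hg' n).norm)
            fun u => norm_add_le _ _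
      _ = _ := by
          rw [integral_add (hf' n).norm (hg' n).norm]
          simp only [norm_mul, integral_const_mul, integral_sub_right_eq_self (fun u => ‖f u‖),
            integral_sub_right_eq_self (fun u => ‖g u‖)]
  have h := hasSum_integral_of_summable_integral_norm
    (F := fun n u => c n * f (u - b n) + d n * g (u - b n)) (fun n => (hf' n).add (hg' n))
    (.of_nonneg_of_le (fun n => integral_nonneg fun u => norm_nonneg _) hle
      ((hc.norm.mul_right _).add (hd.norm.mul_right _)))
  refine h.unique ?_
  convert! (hc.hasSum.mul_right _).add (hd.hasSum.mul_right _) using 2 with n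
  rw [integral_add (hf' n) (hg' n), integral_const_mul, integral_const_mul,
    integral_sub_right_eq_self f, integral_sub_right_eq_self g]

theorem moebiusLogSum_exp_eq {u : ℝ} {N : ℕ} (h : ⌊Real.exp u⌋₊ ≤ N) :
    moebiusLogSum (Real.exp u) = ∑ n ∈ Icc 1 N,
      ((ArithmeticFunction.moebius n : ℤ) : ℝ) / n * max (u - Real.log n) 0 := by
  rw [moebiusLogSum, ← sum_subset (Icc_subset_Icc_right h)]
  · refine sum_congr rfl fun n hn => ?_
    rw [mem_Icc] at hn
    have hn0 : (0 : ℝ) < n := by exact_mod_cast hn.1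
    have h1 : (n : ℝ) ≤ Real.exp u := (Nat.le_floor_iff (Real.exp_pos u).le).1 hn.2
    rw [Real.log_div (Real.exp_ne_zero u) hn0.ne', Real.log_exp, max_eq_left]
    rw [sub_nonneg, Real.log_le_iff_le_exp hn0]
    exact h1
  · intro n hn hn'
    rw [mem_Icc] at hn hn'
    have hn0 : (0 : ℝ) < n := by exact_mod_cast hn.1
    have h1 : Real.exp u < n := (Nat.floor_lt (Real.exp_pos u).le).1 (by
      by_contra! hlt
      exact hn' ⟨hn.1, hlt⟩)
    rw [max_eq_right, mul_zero]
    rw [sub_nonpos]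
    exact ((Real.lt_log_iff_exp_lt hn0).2 h1).le

theorem hasSum_moebiusLogSum_exp (u : ℝ) :
    HasSum (fun n : ℕ => ((ArithmeticFunction.moebius n : ℤ) : ℝ) / n * max (u - Real.log n) 0)
      (moebiusLogSum (Real.exp u)) := by
  have key : ∀ n ∉ Icc 1 ⌊Real.exp u⌋₊,
      ((ArithmeticFunction.moebius n : ℤ) : ℝ) / n * max (u - Real.log n) 0 = 0 := by
    intro n hn
    rcases Nat.eq_zero_or_pos n with rfl | hn0
    · simp
    · have hn1 : (0 : ℝ) < n := by exact_mod_cast hn0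
      rw [mem_Icc, not_and, not_le] at hn
      have h1 : Real.exp u < n := (Nat.floor_lt (Real.exp_pos u).le).1 (hn hn0)
      rw [max_eq_right, mul_zero]
      rw [sub_nonpos]
      exact ((Real.lt_log_iff_exp_lt hn1).2 h1).le
  rw [moebiusLogSum_exp_eq le_rfl]
  exact hasSum_sum_of_ne_finset_zero key

theorem continuous_moebiusLogSum_exp : Continuous fun u : ℝ => moebiusLogSum (Real.exp u) := by
  rw [continuous_iff_continuousAt]
  intro u₀
  have h : Continuous fun u : ℝ => ∑ n ∈ Icc 1 ⌊Real.exp (u₀ + 1)⌋₊,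
      ((ArithmeticFunction.moebius n : ℤ) : ℝ) / n * max (u - Real.log n) 0 := by fun_prop
  refine h.continuousAt.congr ?_
  filter_upwards [Iio_mem_nhds (lt_add_one u₀)] with u hu
  exact (moebiusLogSum_exp_eq (Nat.floor_le_floor (Real.exp_le_exp.2 (le_of_lt hu)))).symm

theorem abs_moebiusLogSum_exp_le {u : ℝ} (hu : 0 ≤ u) :
    |moebiusLogSum (Real.exp u)| ≤ u * (1 + u) := by
  have hexp : 1 ≤ Real.exp u := Real.one_le_exp hu
  have h := harmonic_floor_le_one_add_log (Real.exp u) hexp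
  rw [Real.log_exp, harmonic_eq_sum_Icc] at h
  push_cast at h
  rw [moebiusLogSum_exp_eq le_rfl]
  calc _ ≤ ∑ n ∈ Icc 1 ⌊Real.exp u⌋₊, u * (n : ℝ)⁻¹ := by
        refine (abs_sum_le_sum_abs _ _).trans (sum_le_sum fun n hn => ?_)
        have hn1 : (1 : ℝ) ≤ n := by exact_mod_cast (mem_Icc.1 hn).1
        have hμ : |((ArithmeticFunction.moebius n : ℤ) : ℝ)| ≤ 1 := by
          exact_mod_cast ArithmeticFunction.abs_moebius_le_one
        have hmax : |max (u - Real.log n) 0| ≤ u := by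
          rw [abs_of_nonneg (le_max_right _ _)]
          exact max_le (by linarith [Real.log_nonneg hn1]) hu
        rw [abs_mul, abs_div, Nat.abs_cast, mul_comm]
        gcongr
        rw [div_eq_mul_inv]
        exact mul_le_of_le_one_left (by positivity) hμ
    _ = u * ∑ n ∈ Icc 1 ⌊Real.exp u⌋₊, (n : ℝ)⁻¹ := (mul_sum _ _ _).symm
    _ ≤ u * (1 + u) := by gcongr

/-- The function `u ↦ u * (moebiusLogSum (exp u) - 1) * exp (-s * u)` on the positive half-line,
extended by zero. -/
noncomputable def moebiusLaplaceKernel (s : ℂ) (u : ℝ) : ℂ :=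
  ((max u 0 * (moebiusLogSum (Real.exp u) - 1) : ℝ) : ℂ) * Complex.exp (-s * u)

theorem continuous_moebiusLaplaceKernel (s : ℂ) : Continuous (moebiusLaplaceKernel s) := by
  have := continuous_moebiusLogSum_exp
  unfold moebiusLaplaceKernel
  fun_prop

theorem integrable_moebiusLaplaceKernel {s : ℂ} (hs : 0 < s.re) :
    Integrable (moebiusLaplaceKernel s) := by
  have h := (((integrable_powMulExp (k := 3) (by norm_num) hs).norm.add
    (integrable_powMulExp (k := 2) (by norm_num) hs).norm).add
    (integrable_powMulExp (k := 1) (by norm_num) hs).norm)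
  refine h.mono' (continuous_moebiusLaplaceKernel s).aestronglyMeasurable (.of_forall fun u => ?_)
  simp only [Pi.add_apply, powMulExp, moebiusLaplaceKernel, norm_mul, norm_pow, Complex.norm_real,
    Real.norm_eq_abs, ← add_mul]
  gcongr
  rw [abs_of_nonneg (le_max_right u 0)]
  rcases le_or_gt u 0 with hu | hu
  · simp [max_eq_right hu]
  · rw [max_eq_left hu.le]
    have h1 := abs_moebiusLogSum_exp_le hu.le
    have h2 : |moebiusLogSum (Real.exp u) - 1| ≤ u * (1 + u) + 1 := by
      refine (abs_sub _ _).trans ?_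
      rw [abs_one]
      linarith
    calc _ ≤ u * (u * (1 + u) + 1) := by gcongr
      _ = _ := by ring

theorem moebiusLaplaceKernel_eq (s : ℂ) (u : ℝ) :
    moebiusLaplaceKernel s u =
      (∑' n, (LSeries.term (fun n => ((ArithmeticFunction.moebius n : ℤ) : ℂ)) (1 + s) n *
          powMulExp 2 s (u - Real.log n) +
        LSeries.term (LSeries.logMul fun n => ((ArithmeticFunction.moebius n : ℤ) : ℂ))
          (1 + s) n * powMulExp 1 s (u - Real.log n))) - powMulExp 1 s u := by
  have hsum := ((Complex.hasSum_ofReal.2 (hasSum_moebiusLogSum_exp u)).mul_left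
    ((max u 0 : ℝ) : ℂ)).mul_right (Complex.exp (-s * u))
  have hker : moebiusLaplaceKernel s u = ((max u 0 : ℝ) : ℂ) *
      ((moebiusLogSum (Real.exp u) : ℝ) : ℂ) * Complex.exp (-s * u) - powMulExp 1 s u := by
    simp only [moebiusLaplaceKernel, powMulExp]
    push_cast
    ring
  rw [hker, ← hsum.tsum_eq]
  congr 1
  refine tsum_congr fun n => ?_
  rcases Nat.eq_zero_or_pos n with rfl | hn0
  · simp
  have hn : n ≠ 0 := hn0.ne'
  have hnC : (n : ℂ) ≠ 0 := Nat.cast_ne_zero.2 hn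
  have hlog : 0 ≤ Real.log n := Real.log_natCast_nonneg n
  rw [LSeries.term_of_ne_zero hn, LSeries.term_of_ne_zero hn, LSeries.logMul]
  rcases le_or_gt (u - Real.log n) 0 with hu | hu
  · simp [powMulExp, max_eq_right hu]
  · have hexp : Complex.exp (-s * ((u - Real.log n : ℝ) : ℂ)) =
        (n : ℂ) ^ s * Complex.exp (-s * u) := by
      rw [Complex.cpow_def_of_ne_zero hnC, ← Complex.exp_add, ← Complex.natCast_log]
      push_cast
      ring_nf
    rw [powMulExp, powMulExp, hexp, max_eq_left hu.le, max_eq_left (by linarith : 0 ≤ u),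
      Complex.cpow_add _ _ hnC, Complex.cpow_one, ← Complex.natCast_log]
    have hns : (n : ℂ) ^ s ≠ 0 := by simp [Complex.cpow_eq_zero_iff, hnC]
    push_cast
    field_simp
    ring

theorem integral_moebiusLaplaceKernel {s : ℂ} (hs : 0 < s.re) :
    ∫ u, moebiusLaplaceKernel s u = -deriv invZetaRegular (1 + s) := by
  set M : ℕ → ℂ := fun n => ((ArithmeticFunction.moebius n : ℤ) : ℂ) with hM
  have hs1 : 1 < (1 + s).re := by simpa using hs
  have hs0 : s ≠ 0 := by rintro rfl; simp at hs
  have habs : LSeries.abscissaOfAbsConv M < (1 + s).re := by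
    rw [hM, ArithmeticFunction.abscissaOfAbsConv_moebius]
    exact_mod_cast hs1
  have hinv : ∀ z : ℂ, 1 < z.re → LSeries M z = (riemannZeta z)⁻¹ := by
    intro z hz
    have := LSeries_one_mul_Lseries_moebius hz
    rw [LSeries_one_eq_riemannZeta hz] at this
    exact eq_inv_of_mul_eq_one_right this
  have hζ : riemannZeta (1 + s) ≠ 0 := riemannZeta_ne_zero_of_one_le_re hs1.le
  have hlogMul : LSeries (LSeries.logMul M) (1 + s) =
      deriv riemannZeta (1 + s) / riemannZeta (1 + s) ^ 2 := by
    have h1 := LSeries_deriv habs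
    have hev : LSeries M =ᶠ[𝓝 (1 + s)] fun z => (riemannZeta z)⁻¹ := by
      filter_upwards [(isOpen_lt continuous_const Complex.continuous_re).mem_nhds hs1] with z hz
      exact hinv z hz
    have hne : 1 + s ≠ 1 := by simpa using hs0
    rw [hev.deriv_eq, ((differentiableAt_riemannZeta hne).hasDerivAt.fun_inv hζ).deriv] at h1
    rw [← neg_eq_iff_eq_neg.2 h1]
    ring
  have hS1 : Summable (LSeries.term M (1 + s)) :=
    ArithmeticFunction.LSeriesSummable_moebius_iff.2 hs1
  have hS2 : Summable (LSeries.term (LSeries.logMul M) (1 + s)) :=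
    LSeriesSummable_logMul_of_lt_re habs
  have hker := integrable_powMulExp one_ne_zero hs
  have hsum : Integrable fun u => moebiusLaplaceKernel s u + powMulExp 1 s u :=
    (integrable_moebiusLaplaceKernel hs).add hker
  have hint : ∫ u, (moebiusLaplaceKernel s u + powMulExp 1 s u) =
      LSeries M (1 + s) * (2 / s ^ 3) + LSeries (LSeries.logMul M) (1 + s) * (1 / s ^ 2) := by
    simp only [moebiusLaplaceKernel_eq, sub_add_cancel]
    rw [integral_tsum_translate_add_translate hS1 hS2 (integrable_powMulExp two_ne_zero hs) hker,
      integral_powMulExp two_ne_zero hs, integral_powMulExp one_ne_zero hs]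
    simp [LSeries]
  rw [integral_add (integrable_moebiusLaplaceKernel hs) hker, integral_powMulExp one_ne_zero hs,
    hlogMul, hinv _ hs1] at hint
  rw [deriv_invZetaRegular_eq hs1, eq_sub_of_add_eq hint]
  simp only [add_sub_cancel_left, Nat.factorial_one, Nat.cast_one]
  field_simp
  ring

theorem tendsto_mul_moebiusLogSum_exp_sub_one :
    Tendsto (fun u : ℝ => u * (moebiusLogSum (Real.exp u) - 1)) atTop (𝓝 0) := by
  open FourierTransform in
  obtain ⟨C, hC, hbound⟩ := exists_norm_deriv_invZetaRegular_le
  set H : ℝ → ℝ → ℂ := fun x ξ =>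
    -deriv invZetaRegular (1 + x + (2 * Real.pi * ξ : ℝ) * Complex.I) with hH
  have hHcont : ∀ x, 0 ≤ x → Continuous (H x) := fun x hx => by
    refine (continuousOn_deriv_invZetaRegular.comp_continuous (by fun_prop) fun ξ => ?_).neg
    exact riemannZeta₁_ne_zero_of_one_le_re (by simpa using hx)
  have hdom : Integrable fun ξ : ℝ => C * (1 + ‖2 * Real.pi * ξ‖) ^ (-(23 / 16) : ℝ) :=
    ((integrable_one_add_norm (E := ℝ) (μ := volume) (r := 23 / 16)
      (by norm_num)).comp_mul_left' (by positivity)).const_mul C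
  have hHle : ∀ x, 0 < x → x ≤ 1 → ∀ ξ,
      ‖H x ξ‖ ≤ C * (1 + ‖2 * Real.pi * ξ‖) ^ (-(23 / 16) : ℝ) := fun x hx0 hx1 ξ => by
    rw [hH, norm_neg]
    exact hbound x _ hx0 hx1
  have hfourier : ∀ x : ℝ, 0 < x → 𝓕 (moebiusLaplaceKernel x) = H x := fun x hx => by
    ext ξ
    have hre : 0 < (x + (2 * Real.pi * ξ : ℝ) * Complex.I : ℂ).re := by simpa using hx
    rw [Real.fourier_real_eq_integral_exp_smul,
      show H x ξ = _ from congrArg (fun z => -deriv invZetaRegular z) (add_assoc _ _ _),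
      ← integral_moebiusLaplaceKernel hre]
    congr 1 with u
    rw [moebiusLaplaceKernel, moebiusLaplaceKernel, smul_eq_mul, mul_left_comm, ← Complex.exp_add]
    push_cast
    ring_nf
  have hinv : ∀ x : ℝ, 0 < x → x ≤ 1 → ∀ u : ℝ,
      moebiusLaplaceKernel x u = 𝓕⁻ (H x) u := fun x hx0 hx1 u => by
    have hint : Integrable (H x) := hdom.mono' (hHcont x hx0.le).aestronglyMeasurable
      (.of_forall (hHle x hx0 hx1))
    have h := (continuous_moebiusLaplaceKernel x).fourierInv_fourier_eq
      (integrable_moebiusLaplaceKernel (by simpa using hx0)) (by rwa [hfourier x hx0])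
    rw [← hfourier x hx0, h]
  have hlim : ∀ u : ℝ, moebiusLaplaceKernel 0 u = 𝓕⁻ (H 0) u := fun u => by
    have hsmall : ∀ᶠ x : ℝ in 𝓝[>] 0, x ∈ Set.Ioc (0 : ℝ) 1 := Ioc_mem_nhdsGT one_pos
    have h1 : Tendsto (fun x : ℝ => moebiusLaplaceKernel x u) (𝓝[>] 0)
        (𝓝 (moebiusLaplaceKernel 0 u)) := by
      have : Continuous fun x : ℝ => moebiusLaplaceKernel x u := by
        unfold moebiusLaplaceKernel
        fun_prop
      simpa using (this.tendsto 0).mono_left nhdsWithin_le_nhds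
    have h2 : Tendsto (fun x : ℝ => 𝓕⁻ (H x) u) (𝓝[>] 0) (𝓝 (𝓕⁻ (H 0) u)) := by
      simp only [Real.fourierInv_eq']
      refine tendsto_integral_filter_of_dominated_convergence _ ?_ ?_ hdom
        (.of_forall fun ξ => ?_)
      · filter_upwards [hsmall] with x hx
        have := hHcont x hx.1.le
        exact Continuous.aestronglyMeasurable (by fun_prop)
      · filter_upwards [hsmall] with x hx
        refine .of_forall fun ξ => ?_
        rw [norm_smul, Complex.norm_exp_ofReal_mul_I, one_mul]
        exact hHle x hx.1 hx.2 ξ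
      · refine Tendsto.const_smul ?_ _
        have hne : riemannZeta₁ (1 + ((0 : ℝ) : ℂ) + (2 * Real.pi * ξ : ℝ) * Complex.I) ≠ 0 :=
          riemannZeta₁_ne_zero_of_one_le_re (by simp)
        have hc : ContinuousAt (fun x : ℝ => H x ξ) 0 := by
          refine (ContinuousAt.comp (x := 0) (g := deriv invZetaRegular) (f := fun x : ℝ =>
            (1 + x + (2 * Real.pi * ξ : ℝ) * Complex.I : ℂ)) ?_ (by fun_prop)).neg
          exact continuousOn_deriv_invZetaRegular.continuousAt
            (isOpen_riemannZeta₁_ne_zero.mem_nhds hne)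
        exact hc.tendsto.mono_left nhdsWithin_le_nhds
    refine tendsto_nhds_unique (h1.congr' ?_) h2
    filter_upwards [hsmall] with x hx using hinv x hx.1 hx.2 u
  have hzero : Tendsto (𝓕⁻ (H 0)) atTop (𝓝 0) := by
    have h := (Real.zero_at_infty_fourier (H 0)).comp
      (tendsto_neg_atTop_atBot.mono_right atBot_le_cocompact)
    exact h.congr fun u => (Real.fourierInv_eq_fourier_neg (H 0) u).symm
  have hre := (Complex.continuous_re.tendsto 0).comp hzero
  rw [Complex.zero_re] at hre
  refine hre.congr' ?_
  filter_upwards [eventually_ge_atTop 0] with u hu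
  rw [Function.comp_apply, ← hlim u, moebiusLaplaceKernel, max_eq_left hu]
  simp

/-- Lemma 4.6 (a): for squarefree `v ≤ X^{1/ρ}` and `X` large,
`∑_{n ≤ X, (n,v)=1} (μ(n)/n) log(X/n) = (v/φ(v))(1 + O*(1/log X))`. -/
theorem statement17 (ρ : ℝ) (hρ0 : 0 < ρ) (hρ1 : ρ < 1 / 8) :
    ∃ X₀ : ℝ, ∀ X : ℝ, X₀ ≤ X → ∀ v : ℕ, Squarefree v → (v : ℝ) ≤ X ^ (1 / ρ) →
      |(∑ n ∈ (Finset.Icc 1 ⌊X⌋₊).filter (fun n => Nat.gcd n v = 1),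
          ((ArithmeticFunction.moebius n : ℤ) : ℝ) / n * Real.log (X / n)) -
        (v : ℝ) / (Nat.totient v : ℝ)| ≤
      (v : ℝ) / (Nat.totient v : ℝ) * (1 / Real.log X) := by
  exact exists_moebius_sum_coprime_bound tendsto_mul_moebiusLogSum_exp_sub_one (1 / ρ)
    (by positivity)
end
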